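/- Fix an integer k ≥ 2 and positive real numbers w₁, …, w_k. Then: (i) there is a constant C > 0 such that for every n and every set E of n points in ℝ³, the number of (k+1)-tuples (x₀, x₁, …, x_k) of pairwise distinct points of E with ‖x₀ − x_i‖ = w_i for all i = 1, …, k is at most C · n^k; and (ii) there exist a constant c > 0 and N such that for every n > N there is a set E of n points in ℝ³ containing at least c · n^k such tuples. In other words, for the k-star G with edge weights w₁, …, w_k, f₃(G; n) ≈ n^k. -/

import Mathlib

open scoped InnerProductSpace

noncomputable section

/-- Points in three-dimensional space. -/
abbrev Pt3 : Type := EuclideanSpace ℝ (Fin 3)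

/-- The set of distance `k`-star configurations with weights `w` in a point set
`E ⊆ ℝ³`: `(k+1)`-tuples `(x 0, x 1, …, x k)` of pairwise distinct points of `E` such
that the distance from the center `x 0` to the `i`-th leaf `x (i+1)` equals `w i`. -/
def distStarConfigs3 (k : ℕ) (w : Fin k → ℝ) (E : Finset Pt3) : Set (Fin (k + 1) → Pt3) :=
  {x | (∀ i, x i ∈ E) ∧ Function.Injective x ∧ ∀ i : Fin k, ‖x 0 - x i.succ‖ = w i}

namespace StarBounds

open MvPolynomial Module

/-! ### Hilbert functions of finite point sets -/

section Hilbert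

variable {σ : Type*}

open Classical in
/-- Restriction of functions on `σ → ℝ` to `Q`, extended by zero. -/
def mask (Q : Finset (σ → ℝ)) : ((σ → ℝ) → ℝ) →ₗ[ℝ] ((σ → ℝ) → ℝ) where
  toFun f y := if y ∈ Q then f y else 0
  map_add' f g := by ext y; by_cases h : y ∈ Q <;> simp [h]
  map_smul' c f := by ext y; by_cases h : y ∈ Q <;> simp [h]

/-- Polynomials as functions on `σ → ℝ`. -/
def evalFun : MvPolynomial σ ℝ →ₗ[ℝ] ((σ → ℝ) → ℝ) where
  toFun p y := eval y p
  map_add' p q := by ext y; simp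
  map_smul' c p := by ext y; simp [smul_eval]

/-- Evaluation of a polynomial at the points of `Q`. -/
def ev (Q : Finset (σ → ℝ)) : MvPolynomial σ ℝ →ₗ[ℝ] ((σ → ℝ) → ℝ) := mask Q ∘ₗ evalFun

/-- The Hilbert function of `Q`: the dimension of the space of restrictions to `Q` of
polynomials of degree at most `t`. -/
def hil (Q : Finset (σ → ℝ)) (t : ℕ) : ℕ :=
  finrank ℝ ((restrictTotalDegree σ ℝ t).map (ev Q))

open Classical in
lemma mask_apply (Q : Finset (σ → ℝ)) (f : (σ → ℝ) → ℝ) (y : σ → ℝ) :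
    mask Q f y = if y ∈ Q then f y else 0 := by
  simp only [mask, LinearMap.coe_mk, AddHom.coe_mk]

open Classical in
lemma ev_apply (Q : Finset (σ → ℝ)) (p : MvPolynomial σ ℝ) (y : σ → ℝ) :
    ev Q p y = if y ∈ Q then eval y p else 0 := by
  simp only [ev, LinearMap.comp_apply, mask_apply, evalFun, LinearMap.coe_mk, AddHom.coe_mk]

lemma ev_apply_mem {Q : Finset (σ → ℝ)} {y : σ → ℝ} (hy : y ∈ Q) (p : MvPolynomial σ ℝ) :
    ev Q p y = eval y p := by simp [ev_apply, hy]

lemma ev_eq_zero_iff {Q : Finset (σ → ℝ)} {p : MvPolynomial σ ℝ} :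
    ev Q p = 0 ↔ ∀ y ∈ Q, eval y p = 0 := by
  constructor
  · intro h y hy
    rw [← ev_apply_mem hy, h]; rfl
  · intro h
    ext y
    by_cases hy : y ∈ Q
    · simp [ev_apply, hy, h y hy]
    · simp [ev_apply, hy]

lemma mask_comp_ev {Q P : Finset (σ → ℝ)} (h : Q ⊆ P) (p : MvPolynomial σ ℝ) :
    mask Q (ev P p) = ev Q p := by
  ext y
  by_cases hy : y ∈ Q
  · simp [mask_apply, ev_apply, hy, h hy]
  · simp [mask_apply, ev_apply, hy]

lemma finrank_map_add_finrank_inf_ker {V W : Type*} [AddCommGroup V] [Module ℝ V]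
    [AddCommGroup W] [Module ℝ W] (S : Submodule ℝ V) [FiniteDimensional ℝ S] (f : V →ₗ[ℝ] W) :
    finrank ℝ (S.map f) + finrank ℝ (S ⊓ LinearMap.ker f : Submodule ℝ V) = finrank ℝ S := by
  have h := LinearMap.finrank_range_add_finrank_ker (f.domRestrict S)
  rw [LinearMap.range_domRestrict] at h
  rw [← h]
  congr 1
  have : (LinearMap.ker (f.domRestrict S)).map S.subtype = S ⊓ LinearMap.ker f := by
    rw [LinearMap.ker_domRestrict]
    exact Submodule.map_comap_subtype _ _
  rw [← this]
  exact Submodule.finrank_map_subtype_eq S _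

lemma finrank_le_of_le_map {V W : Type*} [AddCommGroup V] [Module ℝ V]
    [AddCommGroup W] [Module ℝ W] {S : Submodule ℝ V} [FiniteDimensional ℝ S]
    {T : Submodule ℝ W} (f : V →ₗ[ℝ] W) (h : T ≤ S.map f) : finrank ℝ T ≤ finrank ℝ S :=
  (Submodule.finrank_mono h).trans (Submodule.finrank_map_le f S)

lemma map_mask_map_ev {Q P : Finset (σ → ℝ)} (h : Q ⊆ P) (S : Submodule ℝ (MvPolynomial σ ℝ)) :
    (S.map (ev P)).map (mask Q) = S.map (ev Q) := by
  rw [← Submodule.map_comp]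
  congr 1
  exact LinearMap.ext fun p => mask_comp_ev h p

lemma restrictTotalDegree_mono {s t : ℕ} (h : s ≤ t) :
    restrictTotalDegree σ ℝ s ≤ restrictTotalDegree σ ℝ t := fun p hp => by
  rw [mem_restrictTotalDegree] at hp ⊢
  omega

lemma exists_separating (Q : Finset (σ → ℝ)) (y : σ → ℝ) :
    ∃ p : MvPolynomial σ ℝ, p.totalDegree ≤ Q.card ∧ eval y p = 1 ∧
      ∀ z ∈ Q, z ≠ y → eval z p = 0 := by
  classical
  have h : ∀ z : σ → ℝ, ∃ p : MvPolynomial σ ℝ, p.totalDegree ≤ 1 ∧ eval y p = 1 ∧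
      (z ≠ y → eval z p = 0) := by
    intro z
    by_cases hz : z = y
    · exact ⟨1, by simp, by simp, fun h => absurd hz h⟩
    · obtain ⟨i, hi⟩ := Function.ne_iff.1 hz
      have hne : y i - z i ≠ 0 := sub_ne_zero.2 (Ne.symm hi)
      refine ⟨C ((y i - z i)⁻¹) * (X i - C (z i)), ?_, ?_, ?_⟩
      · refine (totalDegree_mul _ _).trans ?_
        have := totalDegree_sub (X i : MvPolynomial σ ℝ) (C (z i))
        simp at this ⊢
        exact this
      · simp [hne]
      · intro _; simp
  choose p hp1 hp2 hp3 using h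
  refine ⟨∏ z ∈ Q, p z, ?_, ?_, ?_⟩
  · refine (totalDegree_finsetProd _ _).trans ?_
    calc ∑ z ∈ Q, (p z).totalDegree ≤ ∑ z ∈ Q, 1 := Finset.sum_le_sum fun z _ => hp1 z
      _ = Q.card := by simp
  · rw [map_prod]; exact Finset.prod_eq_one fun z _ => hp2 z
  · intro z hz hzy
    rw [map_prod]
    exact Finset.prod_eq_zero hz (hp3 z hzy)

variable [Finite σ]

lemma hil_mono_right (Q : Finset (σ → ℝ)) {s t : ℕ} (h : s ≤ t) : hil Q s ≤ hil Q t :=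
  Submodule.finrank_mono (Submodule.map_mono (restrictTotalDegree_mono h))

lemma hil_mono_left {Q P : Finset (σ → ℝ)} (h : Q ⊆ P) (t : ℕ) : hil Q t ≤ hil P t := by
  unfold hil
  rw [← map_mask_map_ev h]
  exact Submodule.finrank_map_le _ _

lemma hil_add_finrank_ker {Q P : Finset (σ → ℝ)} (h : Q ⊆ P) (t : ℕ) :
    hil Q t + finrank ℝ ((restrictTotalDegree σ ℝ t).map (ev P) ⊓ LinearMap.ker (mask Q) :
      Submodule ℝ ((σ → ℝ) → ℝ)) = hil P t := by
  unfold hil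
  rw [← map_mask_map_ev h]
  exact finrank_map_add_finrank_inf_ker _ _

lemma hil_add_hil_le {Q P : Finset (σ → ℝ)} (h : Q ⊆ P) {t D : ℕ} (htD : t ≤ D) :
    hil P t + hil Q D ≤ hil P D + hil Q t := by
  have h1 := hil_add_finrank_ker h t
  have h2 := hil_add_finrank_ker h D
  have h3 : finrank ℝ ((restrictTotalDegree σ ℝ t).map (ev P) ⊓ LinearMap.ker (mask Q) :
      Submodule ℝ ((σ → ℝ) → ℝ)) ≤ finrank ℝ ((restrictTotalDegree σ ℝ D).map (ev P) ⊓
      LinearMap.ker (mask Q) : Submodule ℝ ((σ → ℝ) → ℝ)) :=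
    Submodule.finrank_mono
      (inf_le_inf_right _ (Submodule.map_mono (restrictTotalDegree_mono htD)))
  omega

/-- Multiplication of functions by `g`. -/
def mulFun (g : (σ → ℝ) → ℝ) : ((σ → ℝ) → ℝ) →ₗ[ℝ] ((σ → ℝ) → ℝ) where
  toFun f y := g y * f y
  map_add' f h := by ext y; simp [mul_add]
  map_smul' c f := by ext y; simp; ring

lemma hil_split (Y A B : Finset (σ → ℝ)) (hA : A ⊆ Y) (hB : B ⊆ Y) (g : MvPolynomial σ ℝ)
    (hgA : ∀ y ∈ A, eval y g = 0) (hgB : ∀ y ∈ B, eval y g ≠ 0)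
    (hAB : ∀ y ∈ Y, y ∈ A ∨ y ∈ B)
    {t e s : ℕ} (he : g.totalDegree ≤ e) (hs : s + e ≤ t) :
    hil A t + hil B s ≤ hil Y t := by
  rw [← hil_add_finrank_ker hA t]
  gcongr
  refine finrank_le_of_le_map (mulFun fun y => (eval y g)⁻¹) ?_
  rintro _ ⟨q, hq, rfl⟩
  refine ⟨ev Y (g * q), ⟨⟨g * q, ?_, rfl⟩, ?_⟩, ?_⟩
  · rw [SetLike.mem_coe, mem_restrictTotalDegree] at hq ⊢
    have := totalDegree_mul g q
    omega
  · rw [SetLike.mem_coe, LinearMap.mem_ker, mask_comp_ev hA, ev_eq_zero_iff]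
    intro y hy
    simp [hgA y hy]
  · ext y
    simp only [mulFun, LinearMap.coe_mk, AddHom.coe_mk, ev_apply]
    by_cases hyB : y ∈ B
    · have := hgB y hyB
      simp only [hB hyB, hyB, if_true, map_mul]
      field_simp
    · by_cases hyY : y ∈ Y
      · have hyA := (hAB y hyY).resolve_right hyB
        simp [hyB, hgA y hyA]
      · simp [hyB, hyY]

lemma card_le_hil (Q : Finset (σ → ℝ)) {t : ℕ} (ht : Q.card ≤ t) : Q.card ≤ hil Q t := by
  classical
  let L : ((σ → ℝ) → ℝ) →ₗ[ℝ] (Q → ℝ) := LinearMap.funLeft ℝ ℝ (fun y : Q => (y : σ → ℝ))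
  have h : (⊤ : Submodule ℝ (Q → ℝ)) ≤ ((restrictTotalDegree σ ℝ t).map (ev Q)).map L := by
    intro f _
    choose p hp1 hp2 hp3 using fun y : Q => exists_separating Q (y : σ → ℝ)
    refine ⟨ev Q (∑ y : Q, f y • p y), ⟨_, ?_, rfl⟩, ?_⟩
    · refine Submodule.sum_mem _ fun y _ => Submodule.smul_mem _ _ ?_
      rw [mem_restrictTotalDegree]
      exact (hp1 y).trans ht
    · ext z
      rw [LinearMap.funLeft_apply, ev_apply_mem z.2, map_sum]
      simp only [smul_eval]
      rw [Finset.sum_eq_single z]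
      · rw [hp2]; simp
      · intro y _ hy
        rw [hp3 y z z.2 (fun h => hy (Subtype.ext h.symm))]; simp
      · simp
  have := finrank_le_of_le_map L h
  simpa [hil] using this

lemma hil_zero_le (Q : Finset (σ → ℝ)) : hil Q 0 ≤ 1 := by
  have h : restrictTotalDegree σ ℝ 0 ≤ Submodule.span ℝ {1} := by
    intro p hp
    rw [mem_restrictTotalDegree, Nat.le_zero, totalDegree_eq_zero_iff_eq_C] at hp
    rw [Submodule.mem_span_singleton, hp]
    exact ⟨_, by rw [smul_eq_C_mul, mul_one]⟩
  refine (Submodule.finrank_map_le _ _).trans ((Submodule.finrank_mono h).trans ?_)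
  exact (finrank_span_le_card _).trans (by simp)

lemma hil_pos {Q : Finset (σ → ℝ)} (hQ : Q.Nonempty) (t : ℕ) : 0 < hil Q t := by
  obtain ⟨y, hy⟩ := hQ
  unfold hil
  rw [Module.finrank_pos_iff_exists_ne_zero]
  refine ⟨⟨ev Q 1, 1, by rw [SetLike.mem_coe, mem_restrictTotalDegree]; simp, rfl⟩, ?_⟩
  intro h
  have h1 : ev Q 1 = 0 := congrArg Subtype.val h
  have := ev_eq_zero_iff.1 h1 y hy
  simp at this

end Hilbert

/-! ### Standard monomials and growth of Hilbert functions -/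

section Growth

variable {m : ℕ}

/-- The exponents of total degree at most `t`. -/
def expo (m t : ℕ) : Finset (Fin m →₀ ℕ) :=
  (Finsupp.finite_of_degree_le (σ := Fin m) t).toFinset

lemma mem_expo {t : ℕ} {α : Fin m →₀ ℕ} : α ∈ expo m t ↔ α.degree ≤ t := by
  simp [expo]

lemma restrictTotalDegree_eq_span (t : ℕ) :
    restrictTotalDegree (Fin m) ℝ t =
      Submodule.span ℝ ((fun α => monomial α (1 : ℝ)) '' (expo m t : Set (Fin m →₀ ℕ))) := by
  rw [restrictTotalDegree, restrictSupport_eq_span]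
  congr 2
  ext α
  simp [mem_expo, Finsupp.degree_apply, Finsupp.sum]

/-- Restriction of a monomial to `Q`. -/
def evMon (Q : Finset (Fin m → ℝ)) (α : Fin m →₀ ℕ) : (Fin m → ℝ) → ℝ := ev Q (monomial α 1)

/-- The standard exponents of `Q` for the degree-lexicographic order. -/
def stdExp (Q : Finset (Fin m → ℝ)) : Set (Fin m →₀ ℕ) :=
  {α | evMon Q α ∉ Submodule.span ℝ
    (evMon Q '' {β | MonomialOrder.degLex.toSyn β < MonomialOrder.degLex.toSyn α})}

lemma stdExp_of_add {Q : Finset (Fin m → ℝ)} {α γ : Fin m →₀ ℕ} (h : α + γ ∈ stdExp Q) :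
    α ∈ stdExp Q := by
  by_contra hα
  refine h ?_
  rw [stdExp, Set.mem_ofPred_eq, not_not] at hα
  have key : ∀ β, mulFun (fun y => eval y (monomial γ (1 : ℝ))) (evMon Q β) = evMon Q (β + γ) := by
    intro β
    ext y
    simp only [mulFun, LinearMap.coe_mk, AddHom.coe_mk, evMon, ev_apply]
    by_cases hy : y ∈ Q
    · rw [if_pos hy, if_pos hy, ← map_mul, monomial_mul, one_mul, add_comm]
    · simp [hy]
  rw [← key]
  have h1 := Submodule.mem_map_of_mem (f := mulFun (fun y => eval y (monomial γ (1 : ℝ)))) hα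
  rw [Submodule.map_span] at h1
  refine Submodule.span_mono ?_ h1
  rintro _ ⟨_, ⟨β, hβ, rfl⟩, rfl⟩
  refine ⟨β + γ, ?_, (key β).symm⟩
  rw [Set.mem_ofPred_eq, map_add, map_add]
  exact add_lt_add_left hβ _

lemma degree_le_of_degLex_le {α β : Fin m →₀ ℕ}
    (h : MonomialOrder.degLex.toSyn β ≤ MonomialOrder.degLex.toSyn α) : β.degree ≤ α.degree :=
  Finsupp.DegLex.monotone_degree (MonomialOrder.degLex_le_iff.1 h)

lemma evMon_mem_span_std (Q : Finset (Fin m → ℝ)) (α : Fin m →₀ ℕ) :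
    evMon Q α ∈ Submodule.span ℝ (evMon Q ''
      {β | β ∈ stdExp Q ∧ MonomialOrder.degLex.toSyn β ≤ MonomialOrder.degLex.toSyn α}) := by
  generalize hs : MonomialOrder.degLex.toSyn α = s
  induction s using WellFoundedLT.induction generalizing α with
  | ind s ih =>
    by_cases hα : α ∈ stdExp Q
    · exact Submodule.subset_span ⟨α, ⟨hα, hs.le⟩, rfl⟩
    · rw [stdExp, Set.mem_ofPred_eq, not_not] at hα
      refine Submodule.span_le.2 ?_ hα
      rintro _ ⟨β, hβ, rfl⟩
      rw [Set.mem_ofPred_eq, hs] at hβ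
      refine Submodule.span_mono ?_ (ih _ hβ β rfl)
      rintro _ ⟨δ, ⟨hδ, hδ'⟩, rfl⟩
      exact ⟨δ, ⟨hδ, hδ'.trans hβ.le⟩, rfl⟩

open Classical in
/-- The standard exponents of degree at most `t`. -/
def stdFin (Q : Finset (Fin m → ℝ)) (t : ℕ) : Finset (Fin m →₀ ℕ) :=
  (expo m t).filter (· ∈ stdExp Q)

lemma mem_stdFin {Q : Finset (Fin m → ℝ)} {t : ℕ} {α : Fin m →₀ ℕ} :
    α ∈ stdFin Q t ↔ α.degree ≤ t ∧ α ∈ stdExp Q := by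
  simp [stdFin, mem_expo]

lemma hil_le_card_stdFin (Q : Finset (Fin m → ℝ)) (t : ℕ) : hil Q t ≤ (stdFin Q t).card := by
  classical
  have h : (restrictTotalDegree (Fin m) ℝ t).map (ev Q) ≤
      Submodule.span ℝ (((stdFin Q t).image (evMon Q) : Finset _) : Set ((Fin m → ℝ) → ℝ)) := by
    rw [restrictTotalDegree_eq_span, Submodule.map_span, Submodule.span_le]
    rintro _ ⟨_, ⟨α, hα, rfl⟩, rfl⟩
    refine Submodule.span_mono ?_ (evMon_mem_span_std Q α)
    rintro _ ⟨β, ⟨hβ, hβα⟩, rfl⟩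
    rw [Finset.coe_image]
    refine ⟨β, ?_, rfl⟩
    rw [Finset.mem_coe, mem_expo] at hα
    exact mem_stdFin.2 ⟨(degree_le_of_degLex_le hβα).trans hα, hβ⟩
  refine (Submodule.finrank_mono h).trans ?_
  refine (finrank_span_finset_le_card _).trans Finset.card_image_le

lemma card_stdFin_le_hil (Q : Finset (Fin m → ℝ)) (t : ℕ) : (stdFin Q t).card ≤ hil Q t := by
  classical
  have key : ∀ S : Finset (MonomialOrder.degLex (σ := Fin m)).syn,
      (∀ s ∈ S, MonomialOrder.degLex.toSyn.symm s ∈ stdExp Q) →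
      LinearIndepOn ℝ (fun s => evMon Q (MonomialOrder.degLex.toSyn.symm s)) (S : Set _) := by
    intro S
    induction S using Finset.induction_on_max with
    | empty => intro _; simp
    | insert a S ha ih =>
      intro hS
      have haS : a ∉ (S : Set (MonomialOrder.degLex (σ := Fin m)).syn) :=
        fun h => lt_irrefl _ (ha a h)
      rw [Finset.coe_insert, linearIndepOn_insert haS]
      refine ⟨ih fun s hs => hS s (Finset.mem_insert_of_mem hs), fun hmem => ?_⟩
      refine hS a (Finset.mem_insert_self _ _) (Submodule.span_mono ?_ hmem)
      rintro _ ⟨s, hs, rfl⟩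
      refine ⟨_, ?_, rfl⟩
      rw [Set.mem_ofPred_eq]
      simpa using ha s hs
  have hli := key ((stdFin Q t).map MonomialOrder.degLex.toSyn.toEquiv.toEmbedding) (by
    intro s hs
    rw [Finset.mem_map] at hs
    obtain ⟨α, hα, rfl⟩ := hs
    simpa using (mem_stdFin.1 hα).2)
  have hc := finrank_span_eq_card hli
  rw [← Finset.card_map MonomialOrder.degLex.toSyn.toEquiv.toEmbedding]
  simp only [Finset.coe_sort_coe, Fintype.card_coe] at hc
  rw [← hc]
  refine Submodule.finrank_mono (Submodule.span_le.2 ?_)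
  rintro _ ⟨⟨s, hs⟩, rfl⟩
  rw [Finset.mem_map] at hs
  obtain ⟨α, hα, rfl⟩ := hs
  refine ⟨monomial α 1, ?_, ?_⟩
  · rw [restrictTotalDegree_eq_span]
    exact Submodule.subset_span ⟨α, mem_expo.2 (mem_stdFin.1 hα).1, rfl⟩
  · simp [evMon]

lemma hil_le_mul_hil_div (Q : Finset (Fin m → ℝ)) (D : ℕ) {l : ℕ} (hl : 0 < l) :
    hil Q D ≤ l ^ m * hil Q (D / l) := by
  classical
  refine (hil_le_card_stdFin Q D).trans
    (le_trans ?_ (Nat.mul_le_mul_left _ (card_stdFin_le_hil Q (D / l))))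
  let f : (Fin m →₀ ℕ) → (Fin m →₀ ℕ) := fun α => α.mapRange (· / l) (Nat.zero_div l)
  refine Finset.card_le_mul_card_image_of_maps_to (f := f) ?_ _ ?_
  · intro α hα
    obtain ⟨h1, h2⟩ := mem_stdFin.1 hα
    refine mem_stdFin.2 ⟨?_, ?_⟩
    · rw [Nat.le_div_iff_mul_le hl]
      refine le_trans ?_ h1
      rw [Finsupp.degree_eq_sum, Finsupp.degree_eq_sum, Finset.sum_mul]
      exact Finset.sum_le_sum fun i _ => Nat.div_mul_le_self _ _
    · refine stdExp_of_add (γ := α - f α) ?_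
      rw [add_tsub_cancel_of_le]
      · exact h2
      · intro i; exact Nat.div_le_self _ _
  · intro β _
    have : (Fintype.piFinset fun _ : Fin m => Finset.range l).card = l ^ m := by simp
    rw [← this]
    refine Finset.card_le_card_of_injOn (fun α i => α i % l) ?_ ?_
    · intro α _
      simp [Nat.mod_lt _ hl]
    · intro α hα γ hγ h
      have h1 : f α = f γ := by
        rw [(Finset.mem_filter.1 hα).2, (Finset.mem_filter.1 hγ).2]
      ext i
      have h2 := congrFun h i
      have h3 := DFunLike.congr_fun h1 i
      simp only [f, Finsupp.mapRange_apply] at h3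
      simp only at h2
      rw [← Nat.div_add_mod (α i) l, ← Nat.div_add_mod (γ i) l, h2, h3]

lemma hil_le_pow (Q : Finset (Fin m → ℝ)) (D : ℕ) : hil Q D ≤ (D + 1) ^ m := by
  have h := hil_le_mul_hil_div Q D (Nat.succ_pos D)
  rw [Nat.div_eq_of_lt (Nat.lt_succ_self D)] at h
  calc _ ≤ _ := h
    _ ≤ (D + 1) ^ m * 1 := Nat.mul_le_mul_left _ (hil_zero_le Q)
    _ = _ := mul_one _

end Growth

/-! ### Bézout's inequality in the plane -/

section Bezout

lemma two_mul_card_expo_two (t : ℕ) : 2 * (expo 2 t).card = (t + 1) * (t + 2) := by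
  have h : (expo 2 t).card = ((Finset.range (t + 1)).sigma (fun i => Finset.HasAntidiagonal.antidiagonal i)).card := by
    refine Finset.card_bij' (fun α _ => ⟨α 0 + α 1, (α 0, α 1)⟩)
      (fun p _ => Finsupp.equivFunOnFinite.symm ![p.2.1, p.2.2]) ?_ ?_ ?_ ?_
    · intro α hα
      rw [mem_expo, Finsupp.degree_eq_sum, Fin.sum_univ_two] at hα
      simp; omega
    · rintro ⟨i, a, b⟩ hp
      simp at hp
      rw [mem_expo, Finsupp.degree_eq_sum, Fin.sum_univ_two]
      simp; omega
    · intro α _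
      ext i
      fin_cases i <;> simp
    · rintro ⟨i, a, b⟩ hp
      simp at hp
      simp [hp.2]
  rw [h, Finset.card_sigma]
  simp only [Finset.Nat.card_antidiagonal]
  clear h
  induction t with
  | zero => simp
  | succ t ih =>
    rw [Finset.sum_range_succ, mul_add, ih]
    ring

/-- The dimension of the space of plane polynomials of degree at most `t`. -/
def rdim (t : ℕ) : ℕ := finrank ℝ (restrictTotalDegree (Fin 2) ℝ t)

lemma two_mul_rdim (t : ℕ) : 2 * rdim t = (t + 1) * (t + 2) := by
  rw [← two_mul_card_expo_two, rdim, restrictTotalDegree_eq_span]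
  have h := finrank_span_eq_card ((basisMonomials (Fin 2) ℝ).linearIndependent.comp
    (fun α : expo 2 t => (α : Fin 2 →₀ ℕ)) Subtype.val_injective)
  rw [Fintype.card_coe] at h
  rw [← h, Set.range_comp, show (Set.range fun α : expo 2 t => (α : Fin 2 →₀ ℕ)) =
    (expo 2 t : Set (Fin 2 →₀ ℕ)) from Subtype.range_coe]
  rfl

/-- Polynomials of degree at most `t` vanishing on `Y`. -/
def van (Y : Finset (Fin 2 → ℝ)) (t : ℕ) : Submodule ℝ (MvPolynomial (Fin 2) ℝ) :=
  restrictTotalDegree (Fin 2) ℝ t ⊓ LinearMap.ker (ev Y)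

lemma mem_van {Y : Finset (Fin 2 → ℝ)} {t : ℕ} {p : MvPolynomial (Fin 2) ℝ} :
    p ∈ van Y t ↔ p.totalDegree ≤ t ∧ ∀ y ∈ Y, eval y p = 0 := by
  rw [van, Submodule.mem_inf, mem_restrictTotalDegree, LinearMap.mem_ker, ev_eq_zero_iff]

instance (Y : Finset (Fin 2 → ℝ)) (t : ℕ) : FiniteDimensional ℝ (van Y t) :=
  Submodule.finiteDimensional_of_le (inf_le_left (b := LinearMap.ker (ev Y)))

lemma hil_add_finrank_van (Y : Finset (Fin 2 → ℝ)) (t : ℕ) :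
    hil Y t + finrank ℝ (van Y t) = rdim t :=
  finrank_map_add_finrank_inf_ker _ _

/-- Multiples of `G` with cofactor of degree at most `t`. -/
def multiples (G : MvPolynomial (Fin 2) ℝ) (t : ℕ) : Submodule ℝ (MvPolynomial (Fin 2) ℝ) :=
  (restrictTotalDegree (Fin 2) ℝ t).map (LinearMap.mulLeft ℝ G)

lemma mem_multiples {G p : MvPolynomial (Fin 2) ℝ} {t : ℕ} :
    p ∈ multiples G t ↔ ∃ q : MvPolynomial (Fin 2) ℝ, q.totalDegree ≤ t ∧ G * q = p := by
  simp [multiples, Submodule.mem_map, mem_restrictTotalDegree]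

instance (G : MvPolynomial (Fin 2) ℝ) (t : ℕ) : FiniteDimensional ℝ (multiples G t) := by
  unfold multiples; infer_instance

lemma finrank_multiples {G : MvPolynomial (Fin 2) ℝ} (hG : G ≠ 0) (t : ℕ) :
    finrank ℝ (multiples G t) = rdim t :=
  (Submodule.equivMapOfInjective (LinearMap.mulLeft ℝ G) (mul_right_injective₀ hG) _).symm.finrank_eq

lemma card_le_mul_of_irreducible {G J : MvPolynomial (Fin 2) ℝ} (hG : Irreducible G)
    (hJ : ¬ G ∣ J) (Y : Finset (Fin 2 → ℝ)) (hYG : ∀ y ∈ Y, eval y G = 0)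
    (hYJ : ∀ y ∈ Y, eval y J = 0) : Y.card ≤ G.totalDegree * J.totalDegree := by
  have hJ0 : J ≠ 0 := by rintro rfl; exact hJ (dvd_zero _)
  have hG0 : G ≠ 0 := hG.ne_zero
  set e := G.totalDegree
  set d := J.totalDegree
  obtain ⟨s, hs⟩ : ∃ s, s = Y.card := ⟨_, rfl⟩
  set t := s + e + d with ht
  have h1 := card_le_hil Y (t := t) (by omega)
  have h2 := hil_add_finrank_van Y t
  have hle : multiples G (s + d) ⊔ multiples J (s + e) ≤ van Y t := by
    refine sup_le ?_ ?_
    · intro p hp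
      obtain ⟨q, hq, rfl⟩ := mem_multiples.1 hp
      refine mem_van.2 ⟨(totalDegree_mul _ _).trans (by omega), fun y hy => ?_⟩
      rw [map_mul, hYG y hy, zero_mul]
    · intro p hp
      obtain ⟨q, hq, rfl⟩ := mem_multiples.1 hp
      refine mem_van.2 ⟨(totalDegree_mul _ _).trans (by omega), fun y hy => ?_⟩
      rw [map_mul, hYJ y hy, zero_mul]
  have hinf : multiples G (s + d) ⊓ multiples J (s + e) ≤ multiples (G * J) s := by
    rintro p ⟨hp1, hp2⟩
    obtain ⟨a, ha, rfl⟩ := mem_multiples.1 hp1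
    obtain ⟨b, hb, hab⟩ := mem_multiples.1 hp2
    have hdvd : G ∣ J * b := ⟨a, hab⟩
    obtain ⟨c, rfl⟩ := (hG.prime.dvd_or_dvd hdvd).resolve_left hJ
    refine mem_multiples.2 ⟨c, ?_, by rw [← hab]; ring⟩
    by_cases hc : c = 0
    · simp [hc]
    · rw [totalDegree_mul_of_isDomain hG0 hc] at hb
      omega
  have h3 := Submodule.finrank_mono hle
  have h4 := Submodule.finrank_mono hinf
  have h5 := Submodule.finrank_sup_add_finrank_inf_eq (multiples G (s + d)) (multiples J (s + e))
  rw [finrank_multiples hG0, finrank_multiples hJ0] at h5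
  rw [finrank_multiples (mul_ne_zero hG0 hJ0)] at h4
  have e1 := two_mul_rdim t
  have e2 := two_mul_rdim (s + d)
  have e3 := two_mul_rdim (s + e)
  have e4 := two_mul_rdim s
  have : Y.card + rdim (s + d) + rdim (s + e) ≤ rdim t + rdim s := by omega
  rw [ht] at e1 this
  nlinarith

end Bezout

/-! ### Sign patterns of plane polynomials -/

section SignPatterns

lemma continuous_eval_poly {σ : Type*} (p : MvPolynomial σ ℝ) :
    Continuous fun x : σ → ℝ => eval x p := MvPolynomial.continuous_eval p

/-- The gradient of a plane polynomial as a linear functional. -/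
def gradL (p : MvPolynomial (Fin 2) ℝ) (x : Fin 2 → ℝ) : (Fin 2 → ℝ) →L[ℝ] ℝ :=
  ∑ i, eval x (pderiv i p) • ContinuousLinearMap.proj (R := ℝ) (φ := fun _ : Fin 2 => ℝ) i

lemma gradL_apply (p : MvPolynomial (Fin 2) ℝ) (x v : Fin 2 → ℝ) :
    gradL p x v = eval x (pderiv 0 p) * v 0 + eval x (pderiv 1 p) * v 1 := by
  simp [gradL, Fin.sum_univ_two]

lemma hasStrictFDerivAt_eval (p : MvPolynomial (Fin 2) ℝ) (x : Fin 2 → ℝ) :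
    HasStrictFDerivAt (fun x : Fin 2 → ℝ => eval x p) (gradL p x) x := by
  induction p using MvPolynomial.induction_on with
  | C a =>
    have : gradL (C a) x = 0 := by ext v; simp [gradL_apply]
    rw [this]
    simpa using hasStrictFDerivAt_const (𝕜 := ℝ) a x
  | add p q hp hq =>
    have : gradL (p + q) x = gradL p x + gradL q x := by
      ext v; simp [gradL_apply]; ring
    rw [this]
    refine (hp.add hq).congr_of_eventuallyEq (Filter.Eventually.of_forall fun z => ?_)
    simp
  | mul_X p i hp =>
    have h := hp.mul
      ((ContinuousLinearMap.proj (R := ℝ) (φ := fun _ : Fin 2 => ℝ) i).hasStrictFDerivAt (x := x))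
    have e : gradL (p * X i) x = eval x p • ContinuousLinearMap.proj (R := ℝ)
        (φ := fun _ : Fin 2 => ℝ) i + x i • gradL p x := by
      ext v
      fin_cases i <;> simp [gradL_apply, pderiv_X] <;> ring
    rw [e]
    refine h.congr_of_eventuallyEq (Filter.Eventually.of_forall fun z => ?_)
    simp

lemma totalDegree_pderiv_le (i : Fin 2) (p : MvPolynomial (Fin 2) ℝ) :
    (pderiv i p).totalDegree ≤ p.totalDegree - 1 := by
  classical
  refine Finset.sup_le fun m hm => ?_
  rw [MvPolynomial.mem_support_iff, coeff_pderiv] at hm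
  have h1 := le_totalDegree (MvPolynomial.mem_support_iff.2 (left_ne_zero_of_mul hm))
  have h2 : ((m + Finsupp.single i 1).sum fun _ e => e) = (m.sum fun _ e => e) + 1 := by
    rw [Finsupp.sum_add_index' (by simp) (by simp)]
    simp
  omega

lemma pderiv_eq_zero_of_dvd {G : MvPolynomial (Fin 2) ℝ} (hG : 0 < G.totalDegree) {i : Fin 2}
    (h : G ∣ pderiv i G) : pderiv i G = 0 := by
  by_contra h0
  obtain ⟨c, hc⟩ := h
  have hc0 : c ≠ 0 := by rintro rfl; exact h0 (by simp [hc])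
  have hG0 : G ≠ 0 := by rintro rfl; simp at hG
  have h1 := totalDegree_pderiv_le i G
  rw [hc, totalDegree_mul_of_isDomain hG0 hc0] at h1
  omega

lemma totalDegree_eq_zero_of_pderiv {G : MvPolynomial (Fin 2) ℝ} (h : ∀ i, pderiv i G = 0) :
    G.totalDegree = 0 := by
  rw [totalDegree_eq_zero_iff]
  intro m hm i
  by_contra hi
  have h1 := congrArg (coeff (m - Finsupp.single i 1)) (h i)
  rw [coeff_pderiv, coeff_zero] at h1
  have h2 : m - Finsupp.single i 1 + Finsupp.single i 1 = m := by
    apply tsub_add_cancel_of_le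
    rw [Finsupp.single_le_iff]
    omega
  rw [h2] at h1
  rcases mul_eq_zero.1 h1 with h3 | h3
  · exact (MvPolynomial.mem_support_iff.1 hm) h3
  · have : (0 : ℝ) < (((m - Finsupp.single i 1 : Fin 2 →₀ ℕ) i : ℕ) : ℝ) + 1 := by positivity
    exact absurd h3 this.ne'

/-- The polynomials in `fs` distinguish the points of `Y` by their signs. -/
def SignSep {σ : Type*} (fs : List (MvPolynomial σ ℝ)) (Y : Finset (σ → ℝ)) : Prop :=
  (∀ y ∈ Y, ∀ f ∈ fs, eval y f ≠ 0) ∧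
    ∀ y ∈ Y, ∀ z ∈ Y, (∀ f ∈ fs, 0 < eval y f * eval z f) → y = z

lemma SignSep.mono {σ : Type*} {fs : List (MvPolynomial σ ℝ)} {Y Z : Finset (σ → ℝ)}
    (h : SignSep fs Y) (hZ : Z ⊆ Y) : SignSep fs Z :=
  ⟨fun y hy => h.1 y (hZ hy), fun y hy z hz => h.2 y (hZ hy) z (hZ hz)⟩

lemma eval_list_prod_ne_zero {σ : Type*} {fs : List (MvPolynomial σ ℝ)} {y : σ → ℝ} :
    eval y fs.prod ≠ 0 ↔ ∀ f ∈ fs, eval y f ≠ 0 := by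
  rw [map_list_prod, Ne, List.prod_eq_zero_iff]
  simp

lemma exists_extremal_points (fs : List (MvPolynomial (Fin 2) ℝ))
    (Y : Finset (Fin 2 → ℝ)) (G q : MvPolynomial (Fin 2) ℝ) (K : Set (Fin 2 → ℝ))
    (hK : IsCompact K) (hKq : ∀ z ∈ K, eval z q ≠ 0 → K ∈ nhds z)
    (hYK : ∀ y ∈ Y, y ∈ K) (hYq : ∀ y ∈ Y, eval y q ≠ 0) (hYG : ∀ y ∈ Y, eval y G = 0)
    (hsep : SignSep fs Y) :
    ∃ ζ : (Fin 2 → ℝ) → (Fin 2 → ℝ), ∀ y ∈ Y, eval (ζ y) G = 0 ∧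
      (∀ f ∈ fs, 0 < eval y f * eval (ζ y) f) ∧
      IsLocalExtrOn (fun x => eval x (fs.prod * q)) {x | eval x G = 0} (ζ y) := by
  have key : ∀ y : Fin 2 → ℝ, ∃ z : Fin 2 → ℝ, y ∈ Y → eval z G = 0 ∧
      (∀ f ∈ fs, 0 < eval y f * eval z f) ∧
      IsLocalExtrOn (fun x => eval x (fs.prod * q)) {x | eval x G = 0} z := by
    intro y
    by_cases hy : y ∈ Y
    swap
    · exact ⟨y, fun h => absurd h hy⟩
    set φ : (Fin 2 → ℝ) → ℝ := fun x => eval x (fs.prod * q) with hφ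
    have hφc : Continuous φ := continuous_eval_poly _
    have hφy : φ y ≠ 0 := by
      simp only [hφ, map_mul]
      exact mul_ne_zero (eval_list_prod_ne_zero.2 (hsep.1 y hy)) (hYq y hy)
    set S : Set (Fin 2 → ℝ) :=
      K ∩ ({x | eval x G = 0} ∩ {x | ∀ f ∈ fs, 0 ≤ eval y f * eval x f})
    have hSc : IsCompact S := by
      refine hK.inter_right (IsClosed.inter ?_ ?_)
      · exact isClosed_eq (continuous_eval_poly G) continuous_const
      · have : {x : Fin 2 → ℝ | ∀ f ∈ fs, 0 ≤ eval y f * eval x f} =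
            ⋂ f ∈ fs, {x | 0 ≤ eval y f * eval x f} := by ext x; simp
        rw [this]
        exact isClosed_biInter fun f _ =>
          isClosed_le continuous_const (continuous_const.mul (continuous_eval_poly f))
    have hyS : y ∈ S := ⟨hYK y hy, hYG y hy, fun f _ => mul_self_nonneg _⟩
    obtain ⟨z, hzS, hz⟩ := hSc.exists_isMaxOn ⟨y, hyS⟩ hφc.abs.continuousOn
    have hφz : φ z ≠ 0 := by
      have : |φ y| ≤ |φ z| := hz hyS
      exact abs_pos.1 (lt_of_lt_of_le (abs_pos.2 hφy) this)
    have hz1 : eval z fs.prod ≠ 0 := by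
      simp only [hφ, map_mul] at hφz
      exact left_ne_zero_of_mul hφz
    have hz2 : eval z q ≠ 0 := by
      simp only [hφ, map_mul] at hφz
      exact right_ne_zero_of_mul hφz
    have hpos : ∀ f ∈ fs, 0 < eval y f * eval z f := fun f hf =>
      lt_of_le_of_ne (hzS.2.2 f hf)
        (mul_ne_zero (hsep.1 y hy f hf) (eval_list_prod_ne_zero.1 hz1 f hf)).symm
    refine ⟨z, fun _ => ⟨hzS.2.1, hpos, ?_⟩⟩
    have hev : ∀ᶠ x in nhds z, x ∈ K ∧ (∀ f ∈ fs, 0 ≤ eval y f * eval x f) ∧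
        0 < φ z * φ x := by
      refine Filter.Eventually.and (show ∀ᶠ x in nhds z, x ∈ K from hKq z hzS.1 hz2)
        (Filter.Eventually.and ?_ ?_)
      · have : ∀ f ∈ fs.toFinset, ∀ᶠ x in nhds z, 0 ≤ eval y f * eval x f := by
          intro f hf
          have hc : Continuous fun x => eval y f * eval x f :=
            continuous_const.mul (continuous_eval_poly f)
          exact (hc.continuousAt.eventually
            (lt_mem_nhds (hpos f (List.mem_toFinset.1 hf)))).mono fun x hx => le_of_lt hx
        have h2 := (Filter.eventually_all_finset fs.toFinset).2 this
        exact h2.mono fun x hx f hf => hx f (List.mem_toFinset.2 hf)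
      · have hc : Continuous fun x => φ z * φ x := continuous_const.mul hφc
        exact hc.continuousAt.eventually (lt_mem_nhds (mul_self_pos.2 hφz))
    have hev' : ∀ᶠ x in nhdsWithin z {x | eval x G = 0}, |φ x| ≤ |φ z| ∧ 0 < φ z * φ x := by
      filter_upwards [mem_nhdsWithin_of_mem_nhds hev, self_mem_nhdsWithin] with x hx hxG
      exact ⟨hz ⟨hx.1, hxG, hx.2.1⟩, hx.2.2⟩
    rcases lt_or_gt_of_ne hφz with h | h
    · left
      filter_upwards [hev'] with x hx
      have hx1 : φ x < 0 := by
        by_contra h0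
        nlinarith [hx.2]
      have := hx.1
      rw [abs_of_neg hx1, abs_of_neg h] at this
      linarith
    · right
      filter_upwards [hev'] with x hx
      have hx1 : 0 < φ x := by
        by_contra h0
        nlinarith [hx.2]
      have := hx.1
      rw [abs_of_pos hx1, abs_of_pos h] at this
      exact this
  choose ζ hζ using key
  exact ⟨ζ, fun y hy => hζ y hy⟩

lemma SignSep.image {fs : List (MvPolynomial (Fin 2) ℝ)} {Y : Finset (Fin 2 → ℝ)}
    (hsep : SignSep fs Y) (ζ : (Fin 2 → ℝ) → (Fin 2 → ℝ))
    (hζ : ∀ y ∈ Y, ∀ f ∈ fs, 0 < eval y f * eval (ζ y) f) [DecidableEq (Fin 2 → ℝ)] :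
    SignSep fs (Y.image ζ) ∧ (Y.image ζ).card = Y.card := by
  have key : ∀ y ∈ Y, ∀ z ∈ Y, (∀ f ∈ fs, 0 < eval (ζ y) f * eval (ζ z) f) → y = z := by
    intro y hy z hz h
    refine hsep.2 y hy z hz fun f hf => ?_
    have h1 := hζ y hy f hf
    have h2 := hζ z hz f hf
    have h3 := h f hf
    have h4 : 0 < (eval y f * eval z f) * (eval (ζ y) f * eval (ζ z) f) := by
      have := mul_pos h1 h2
      nlinarith
    exact (mul_pos_iff_of_pos_right h3).1 h4
  have hne : ∀ y ∈ Y, ∀ f ∈ fs, eval (ζ y) f ≠ 0 := fun y hy f hf h => by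
    have := hζ y hy f hf
    rw [h, mul_zero] at this
    exact lt_irrefl _ this
  refine ⟨⟨?_, ?_⟩, ?_⟩
  · intro y hy
    obtain ⟨x, hx, rfl⟩ := Finset.mem_image.1 hy
    exact hne x hx
  · intro y hy z hz h
    obtain ⟨x, hx, rfl⟩ := Finset.mem_image.1 hy
    obtain ⟨x', hx', rfl⟩ := Finset.mem_image.1 hz
    rw [key x hx x' hx' h]
  · refine Finset.card_image_of_injOn fun y hy z hz h => key y hy z hz fun f hf => ?_
    rw [show ζ y = ζ z from h]
    exact mul_self_pos.2 (hne z hz f hf)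

end SignPatterns

section SignCount

/-- The polynomial `R² - u² - v²`. -/
def discPoly (R : ℝ) : MvPolynomial (Fin 2) ℝ := C (R ^ 2) - X 0 ^ 2 - X 1 ^ 2

lemma eval_discPoly (R : ℝ) (x : Fin 2 → ℝ) :
    eval x (discPoly R) = R ^ 2 - x 0 ^ 2 - x 1 ^ 2 := by simp [discPoly]

lemma totalDegree_discPoly_le (R : ℝ) : (discPoly R).totalDegree ≤ 2 := by
  unfold discPoly
  refine (totalDegree_sub _ _).trans (max_le ((totalDegree_sub _ _).trans (max_le ?_ ?_)) ?_)
  · rw [totalDegree_C]; omega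
  · exact (totalDegree_X_pow _ _).le
  · exact (totalDegree_X_pow _ _).le

/-- The closed disc of radius `R`. -/
def disc (R : ℝ) : Set (Fin 2 → ℝ) := {x | 0 ≤ eval x (discPoly R)}

lemma isCompact_disc (R : ℝ) : IsCompact (disc R) := by
  refine Metric.isCompact_of_isClosed_isBounded ?_ ?_
  · exact isClosed_le continuous_const (continuous_eval_poly _)
  · refine (Metric.isBounded_closedBall (x := (0 : Fin 2 → ℝ)) (r := |R|)).subset ?_
    intro x hx
    rw [disc, Set.mem_ofPred_eq, eval_discPoly] at hx
    rw [mem_closedBall_zero_iff, pi_norm_le_iff_of_nonneg (abs_nonneg R)]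
    intro i
    rw [Real.norm_eq_abs]
    refine sq_le_sq.1 ?_
    fin_cases i
    · simp only [Fin.zero_eta]; nlinarith [sq_nonneg (x 1)]
    · simp only [Fin.mk_one]; nlinarith [sq_nonneg (x 0)]

lemma disc_mem_nhds {R : ℝ} {z : Fin 2 → ℝ} (hz : z ∈ disc R) (h : eval z (discPoly R) ≠ 0) :
    disc R ∈ nhds z := by
  have hpos : 0 < eval z (discPoly R) := lt_of_le_of_ne hz (Ne.symm h)
  exact ((continuous_eval_poly (discPoly R)).continuousAt.eventually
    (lt_mem_nhds hpos)).mono fun x hx => le_of_lt hx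

lemma exists_disc (Y : Finset (Fin 2 → ℝ)) :
    ∃ R : ℝ, 0 < R ∧ ∀ y ∈ Y, 0 < eval y (discPoly R) := by
  refine ⟨1 + ∑ y ∈ Y, (y 0 ^ 2 + y 1 ^ 2), ?_, ?_⟩
  · have : 0 ≤ ∑ y ∈ Y, (y 0 ^ 2 + y 1 ^ 2) := Finset.sum_nonneg fun y _ => by positivity
    linarith
  · intro y hy
    have h0 : 0 ≤ ∑ y ∈ Y, (y 0 ^ 2 + y 1 ^ 2) := Finset.sum_nonneg fun y _ => by positivity
    have h1 : y 0 ^ 2 + y 1 ^ 2 ≤ ∑ y ∈ Y, (y 0 ^ 2 + y 1 ^ 2) :=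
      Finset.single_le_sum (f := fun y : Fin 2 → ℝ => y 0 ^ 2 + y 1 ^ 2)
        (fun y _ => by positivity) hy
    rw [eval_discPoly]
    nlinarith

/-- The Jacobian determinant of two plane polynomials. -/
def jac (p q : MvPolynomial (Fin 2) ℝ) : MvPolynomial (Fin 2) ℝ :=
  pderiv 0 p * pderiv 1 q - pderiv 1 p * pderiv 0 q

lemma totalDegree_jac_le (p q : MvPolynomial (Fin 2) ℝ) :
    (jac p q).totalDegree ≤ p.totalDegree + q.totalDegree := by
  have h : ∀ i j, (pderiv i p * pderiv j q).totalDegree ≤ p.totalDegree + q.totalDegree := by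
    intro i j
    refine (totalDegree_mul _ _).trans ?_
    have := totalDegree_pderiv_le i p
    have := totalDegree_pderiv_le j q
    omega
  exact (totalDegree_sub _ _).trans (max_le (h _ _) (h _ _))

lemma eval_jac_eq_zero {p q : MvPolynomial (Fin 2) ℝ} {z : Fin 2 → ℝ} (hz : eval z q = 0)
    (h : IsLocalExtrOn (fun x => eval x p) {x | eval x q = 0} z) : eval z (jac p q) = 0 := by
  have h' : IsLocalExtrOn (fun x => eval x p) {x | eval x q = eval z q} z := by rwa [hz]
  obtain ⟨a, b, hab, heq⟩ := IsLocalExtrOn.exists_multipliers_of_hasStrictFDerivAt_1d h'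
    (hasStrictFDerivAt_eval q z) (hasStrictFDerivAt_eval p z)
  have h0 := congrArg (fun L : (Fin 2 → ℝ) →L[ℝ] ℝ => L (Pi.single 0 1)) heq
  have h1 := congrArg (fun L : (Fin 2 → ℝ) →L[ℝ] ℝ => L (Pi.single 1 1)) heq
  simp [gradL_apply] at h0 h1
  simp only [jac, map_sub, map_mul]
  by_cases hb : b = 0
  · have ha : a ≠ 0 := by
      rintro rfl
      exact hab (by simp [hb])
    subst hb
    simp [ha] at h0 h1
    simp [h0, h1]
  · have : b * (eval z (pderiv 0 p) * eval z (pderiv 1 q) -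
        eval z (pderiv 1 p) * eval z (pderiv 0 q)) = 0 := by
      linear_combination (eval z (pderiv 1 q)) * h0 - (eval z (pderiv 0 q)) * h1
    exact (mul_eq_zero.1 this).resolve_left hb

lemma card_le_of_irreducible {fs : List (MvPolynomial (Fin 2) ℝ)} {D : ℕ}
    (hD : fs.prod.totalDegree ≤ D) {G : MvPolynomial (Fin 2) ℝ} (hG : Irreducible G)
    {Y : Finset (Fin 2 → ℝ)} (hYG : ∀ y ∈ Y, eval y G = 0) (hsep : SignSep fs Y) :
    Y.card ≤ G.totalDegree * (D + 3 + G.totalDegree) := by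
  classical
  rcases Y.eq_empty_or_nonempty with rfl | ⟨y₀, hy₀⟩
  · simp
  obtain ⟨R, hR, hYR⟩ := exists_disc Y
  set F := fs.prod * discPoly R with hF
  have hGF : ¬ G ∣ F := by
    rintro ⟨c, hc⟩
    have h1 := congrArg (eval y₀) hc
    rw [hF, map_mul, map_mul, hYG y₀ hy₀, zero_mul] at h1
    exact mul_ne_zero (eval_list_prod_ne_zero.2 (hsep.1 y₀ hy₀)) (hYR y₀ hy₀).ne' h1
  have hG1 : 0 < G.totalDegree := by
    rw [Nat.pos_iff_ne_zero]
    intro h0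
    rw [totalDegree_eq_zero_iff_eq_C] at h0
    have h1 := hYG y₀ hy₀
    rw [h0, eval_C] at h1
    rw [h1, map_zero] at h0
    exact hG.ne_zero h0
  have main : ∀ l : MvPolynomial (Fin 2) ℝ, l.totalDegree ≤ 1 →
      (∀ z ∈ disc R, 0 < eval z l) → ¬ G ∣ jac (F * l) G →
      Y.card ≤ G.totalDegree * (D + 3 + G.totalDegree) := by
    intro l hl hlpos hnd
    obtain ⟨ζ, hζ⟩ := exists_extremal_points fs Y G (discPoly R * l) (disc R) (isCompact_disc R)
      (fun z hz h => disc_mem_nhds hz (by rw [map_mul] at h; exact left_ne_zero_of_mul h))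
      (fun y hy => (hYR y hy).le)
      (fun y hy => by
        rw [map_mul]; exact mul_ne_zero (hYR y hy).ne' (hlpos y (hYR y hy).le).ne') hYG hsep
    obtain ⟨-, hcard⟩ := hsep.image ζ fun y hy => (hζ y hy).2.1
    rw [← hcard]
    have hb := card_le_mul_of_irreducible hG hnd (Y.image ζ) ?_ ?_
    · refine hb.trans (Nat.mul_le_mul_left _ ?_)
      refine (totalDegree_jac_le _ _).trans ?_
      have h1 := totalDegree_mul F l
      have h2 := totalDegree_mul fs.prod (discPoly R)
      have h3 := totalDegree_discPoly_le R
      rw [← hF] at h2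
      omega
    · intro z hz
      obtain ⟨y, hy, rfl⟩ := Finset.mem_image.1 hz
      exact (hζ y hy).1
    · intro z hz
      obtain ⟨y, hy, rfl⟩ := Finset.mem_image.1 hz
      refine eval_jac_eq_zero (hζ y hy).1 ?_
      rw [hF, mul_assoc]
      exact (hζ y hy).2.2
  by_cases h1 : G ∣ jac (F * 1) G
  swap
  · exact main 1 (by simp) (by simp) h1
  have hXdeg : ∀ i : Fin 2, (C (R + 1) + X i : MvPolynomial (Fin 2) ℝ).totalDegree ≤ 1 :=
    fun i => (totalDegree_add _ _).trans (max_le (by rw [totalDegree_C]; omega) (totalDegree_X _).le)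
  have hXpos : ∀ i : Fin 2, ∀ z ∈ disc R, 0 < eval z (C (R + 1) + X i) := by
    intro i z hz
    rw [disc, Set.mem_ofPred_eq, eval_discPoly] at hz
    simp only [map_add, eval_C, eval_X]
    have : |z i| ≤ |R| := by
      refine sq_le_sq.1 ?_
      fin_cases i
      · simp only [Fin.zero_eta]; nlinarith [sq_nonneg (z 1)]
      · simp only [Fin.mk_one]; nlinarith [sq_nonneg (z 0)]
    rw [abs_of_pos hR] at this
    linarith [neg_le_of_abs_le this]
  have hder : ∀ i : Fin 2, G ∣ jac (F * (C (R + 1) + X i)) G → pderiv (1 - i) G = 0 := by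
    intro i hi
    refine pderiv_eq_zero_of_dvd hG1 ?_
    have h2 : F * pderiv (1 - i) G = (if i = 0 then 1 else -1) *
        (jac (F * (C (R + 1) + X i)) G - (C (R + 1) + X i) * jac (F * 1) G) := by
      fin_cases i
      · simp [jac, pderiv_X]; ring
      · simp [jac, pderiv_X]; ring
    have h3 : G ∣ F * pderiv (1 - i) G := by
      rw [h2]
      exact Dvd.dvd.mul_left (dvd_sub hi (Dvd.dvd.mul_left h1 _)) _
    exact (hG.prime.dvd_or_dvd h3).resolve_left hGF
  by_cases h2 : G ∣ jac (F * (C (R + 1) + X 0)) G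
  swap
  · exact main _ (hXdeg 0) (hXpos 0) h2
  by_cases h3 : G ∣ jac (F * (C (R + 1) + X 1)) G
  swap
  · exact main _ (hXdeg 1) (hXpos 1) h3
  exfalso
  refine hG1.ne' (totalDegree_eq_zero_of_pderiv fun i => ?_)
  fin_cases i
  · exact hder 1 h3
  · exact hder 0 h2

lemma card_le_of_vanishing {fs : List (MvPolynomial (Fin 2) ℝ)} {D : ℕ}
    (hD : fs.prod.totalDegree ≤ D) {G : MvPolynomial (Fin 2) ℝ} (hG : G ≠ 0)
    {Y : Finset (Fin 2 → ℝ)} (hYG : ∀ y ∈ Y, eval y G = 0) (hsep : SignSep fs Y) :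
    Y.card ≤ G.totalDegree * (D + 3 + G.totalDegree) := by
  classical
  induction G using WfDvdMonoid.induction_on_irreducible generalizing Y with
  | zero => exact absurd rfl hG
  | unit u hu =>
    have : Y = ∅ := by
      rw [Finset.eq_empty_iff_forall_notMem]
      intro y hy
      have := hu.map (eval y)
      rw [hYG y hy] at this
      exact not_isUnit_zero this
    simp [this]
  | mul a p ha hp ih =>
    have h1 := card_le_of_irreducible hD hp (Y := Y.filter fun y => eval y p = 0)
      (fun y hy => (Finset.mem_filter.1 hy).2) (hsep.mono (Finset.filter_subset _ _))
    have h2 := ih ha (Y := Y.filter fun y => ¬ eval y p = 0) (fun y hy => by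
      have := hYG y (Finset.mem_filter.1 hy).1
      rw [map_mul] at this
      exact (mul_eq_zero.1 this).resolve_left (Finset.mem_filter.1 hy).2)
      (hsep.mono (Finset.filter_subset _ _))
    have h3 := Finset.card_filter_add_card_filter_not (s := Y) (fun y => eval y p = 0)
    rw [totalDegree_mul_of_isDomain hp.ne_zero ha]
    nlinarith

lemma card_le_sq {fs : List (MvPolynomial (Fin 2) ℝ)} {D : ℕ}
    (hD : fs.prod.totalDegree ≤ D) {Y : Finset (Fin 2 → ℝ)} (hsep : SignSep fs Y) :
    Y.card ≤ (D + 2) * (2 * D + 5) := by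
  classical
  rcases Y.eq_empty_or_nonempty with rfl | ⟨y₀, hy₀⟩
  · simp
  obtain ⟨R, hR, hYR⟩ := exists_disc Y
  set F := fs.prod * discPoly R with hF
  obtain ⟨ζ, hζ⟩ := exists_extremal_points fs Y 0 (discPoly R) (disc R) (isCompact_disc R)
    (fun z hz h => disc_mem_nhds hz h) (fun y hy => (hYR y hy).le)
    (fun y hy => (hYR y hy).ne') (fun y hy => map_zero _) hsep
  obtain ⟨hsep', hcard⟩ := hsep.image ζ fun y hy => (hζ y hy).2.1
  have hdF : F.totalDegree ≤ D + 2 := by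
    have h2 := totalDegree_mul fs.prod (discPoly R)
    have h3 := totalDegree_discPoly_le R
    rw [← hF] at h2
    omega
  have hd : (pderiv 0 F).totalDegree ≤ D + 1 := by
    have := totalDegree_pderiv_le 0 F
    omega
  have h0 : pderiv 0 F ≠ 0 := by
    intro h0
    have hpos := hYR y₀ hy₀
    rw [eval_discPoly] at hpos
    set γ : ℝ → (Fin 2 → ℝ) := fun s => ![s, y₀ 1] with hγ
    have hγd : ∀ s, HasDerivAt γ (Pi.single 0 1) s := by
      intro s
      rw [hasDerivAt_pi]
      intro i
      fin_cases i
      · exact (hasDerivAt_id' s).congr_of_eventuallyEq (Filter.Eventually.of_forall fun z => by simp [hγ]) |>.congr_deriv (by simp)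
      · simpa [hγ] using hasDerivAt_const s (y₀ 1)
    have hder : ∀ s, HasDerivAt (fun s => eval (γ s) F) 0 s := by
      intro s
      have h1 := (hasStrictFDerivAt_eval F (γ s)).hasFDerivAt.comp_hasDerivAt s (hγd s)
      have e0 : gradL F (γ s) (Pi.single 0 1) = 0 := by simp [gradL_apply, h0]
      rw [e0] at h1
      exact h1
    have hconst := is_const_of_deriv_eq_zero (fun s => (hder s).differentiableAt)
      (fun s => (hder s).deriv) (y₀ 0) (Real.sqrt (R ^ 2 - y₀ 1 ^ 2))
    have e1 : γ (y₀ 0) = y₀ := by ext i; fin_cases i <;> simp [hγ]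
    have e2 : eval (γ (Real.sqrt (R ^ 2 - y₀ 1 ^ 2))) (discPoly R) = 0 := by
      rw [eval_discPoly]
      simp only [hγ, Matrix.cons_val_zero, Matrix.cons_val_one]
      rw [Real.sq_sqrt (by nlinarith [sq_nonneg (y₀ 0)])]
      ring
    simp only [e1, hF, map_mul, e2, mul_zero] at hconst
    exact mul_ne_zero (eval_list_prod_ne_zero.2 (hsep.1 y₀ hy₀)) (hYR y₀ hy₀).ne' hconst
  have h := card_le_of_vanishing hD h0 (Y := Y.image ζ) ?_ hsep'
  · rw [hcard] at h
    refine h.trans ?_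
    calc _ ≤ (D + 1) * (D + 3 + (D + 1)) := Nat.mul_le_mul hd (by omega)
      _ ≤ _ := Nat.mul_le_mul (by omega) (by omega)
  · intro z hz
    obtain ⟨y, hy, rfl⟩ := Finset.mem_image.1 hz
    have h3 := (hζ y hy).2.2
    have h4 : IsLocalExtr (fun x => eval x F) (ζ y) := by
      have h5 : {x : Fin 2 → ℝ | eval x (0 : MvPolynomial (Fin 2) ℝ) = 0} = Set.univ := by
        ext x; simp
      rw [h5] at h3
      rcases h3 with h6 | h6
      · left; exact isLocalMinOn_univ_iff.1 h6
      · right; exact isLocalMaxOn_univ_iff.1 h6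
    have h7 := h4.hasFDerivAt_eq_zero (hasStrictFDerivAt_eval F (ζ y)).hasFDerivAt
    have h8 := congrArg (fun L : (Fin 2 → ℝ) →L[ℝ] ℝ => L (Pi.single 0 1)) h7
    simpa [gradL_apply] using h8

lemma card_le_ten_mul_hil_of_irreducible {fs : List (MvPolynomial (Fin 2) ℝ)} {D : ℕ}
    (hD : fs.prod.totalDegree ≤ D) {G : MvPolynomial (Fin 2) ℝ} (hG : Irreducible G)
    (he1 : 0 < G.totalDegree) (heD : G.totalDegree ≤ D)
    {Y : Finset (Fin 2 → ℝ)} (hYG : ∀ y ∈ Y, eval y G = 0)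
    (hmin : ∀ p : MvPolynomial (Fin 2) ℝ, p ≠ 0 → (∀ y ∈ Y, eval y p = 0) →
      G.totalDegree ≤ p.totalDegree) (hsep : SignSep fs Y) :
    Y.card ≤ 10 * hil Y (D + G.totalDegree) := by
  have hb := card_le_of_irreducible hD hG hYG hsep
  set e := G.totalDegree with he
  by_cases hsmall : Y.card ≤ 2 * e ^ 2
  · have h1 : finrank ℝ (van Y (e - 1)) = 0 := by
      have : van Y (e - 1) = ⊥ := by
        rw [eq_bot_iff]
        intro p hp
        obtain ⟨hp1, hp2⟩ := mem_van.1 hp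
        rw [Submodule.mem_bot]
        by_contra h0
        have := hmin p h0 hp2
        omega
      rw [this, finrank_bot]
    have h2 := hil_add_finrank_van Y (e - 1)
    have h3 := two_mul_rdim (e - 1)
    have h4 := hil_mono_right Y (show e - 1 ≤ D + e by omega)
    obtain ⟨c, hc⟩ : ∃ c, e = c + 1 := ⟨e - 1, by omega⟩
    rw [h1, add_zero] at h2
    rw [← h2, hc, Nat.add_sub_cancel] at h3
    rw [hc, Nat.add_sub_cancel] at h4
    rw [hc] at hsmall ⊢
    nlinarith
  · rw [not_le] at hsmall
    obtain ⟨q, hq⟩ : ∃ q, q = (Y.card - 1) / e := ⟨_, rfl⟩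
    have hq1 : e * q ≤ Y.card - 1 := by rw [hq]; exact Nat.mul_div_le _ _
    have hq2 : Y.card - 1 < e * (q + 1) := by
      rw [hq]; exact Nat.lt_mul_div_succ _ he1
    have heq : e ≤ q := by
      by_contra h
      have : e * (q + 1) ≤ e * e := Nat.mul_le_mul_left _ (by omega)
      have h0 : e ^ 2 = e * e := sq e
      have h2 : 0 < e * e := Nat.mul_pos he1 he1
      omega
    set t := min D q with ht
    have het : e ≤ t := le_min heD heq
    have hle : van Y t ≤ multiples G (t - e) := by
      intro p hp
      obtain ⟨hp1, hp2⟩ := mem_van.1 hp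
      have hdvd : G ∣ p := by
        by_contra hnd
        have h1 := card_le_mul_of_irreducible hG hnd Y hYG hp2
        rw [← he] at h1
        have h2 : e * p.totalDegree ≤ e * q :=
          Nat.mul_le_mul_left _ (hp1.trans (min_le_right _ _))
        have h3 : 0 < Y.card := by omega
        omega
      obtain ⟨c, rfl⟩ := hdvd
      refine mem_multiples.2 ⟨c, ?_, rfl⟩
      by_cases hc : c = 0
      · simp [hc]
      · rw [totalDegree_mul_of_isDomain hG.ne_zero hc] at hp1
        omega
    have h1 := Submodule.finrank_mono hle
    rw [finrank_multiples hG.ne_zero] at h1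
    have h2 := hil_add_finrank_van Y t
    have h3 := two_mul_rdim t
    have h4 := two_mul_rdim (t - e)
    have h5 := hil_mono_right Y (show t ≤ D + e from (min_le_left _ _).trans (by omega))
    obtain ⟨c, hc⟩ : ∃ c, t = c + e := ⟨t - e, by omega⟩
    rw [hc, Nat.add_sub_cancel] at h4
    have h6 : rdim t ≤ hil Y t + rdim c := by
      rw [hc, Nat.add_sub_cancel] at h1
      rw [hc] at h2 ⊢
      omega
    have h7 : e * (t + 3) ≤ 2 * hil Y t := by
      rw [hc] at h3 h6 ⊢
      nlinarith
    have h8 : Y.card ≤ 5 * (e * (t + 3)) := by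
      rcases min_choice D q with h | h
      · rw [ht, h]
        refine hb.trans ?_
        have : e * (D + 3 + e) ≤ e * (5 * (D + 3)) := Nat.mul_le_mul_left _ (by omega)
        linarith
      · rw [ht, h]
        have : e * (q + 1) ≤ e * (q + 3) := Nat.mul_le_mul_left _ (by omega)
        omega
    omega

lemma card_le_ten_mul_hil_of_minimal {fs : List (MvPolynomial (Fin 2) ℝ)} {D : ℕ}
    (hD : fs.prod.totalDegree ≤ D) {G : MvPolynomial (Fin 2) ℝ} (hG : G ≠ 0)
    (heD : G.totalDegree ≤ D)
    {Y : Finset (Fin 2 → ℝ)} (hYG : ∀ y ∈ Y, eval y G = 0)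
    (hmin : ∀ p : MvPolynomial (Fin 2) ℝ, p ≠ 0 → (∀ y ∈ Y, eval y p = 0) →
      G.totalDegree ≤ p.totalDegree) (hsep : SignSep fs Y) :
    Y.card ≤ 10 * hil Y (D + G.totalDegree) := by
  classical
  induction G using WfDvdMonoid.induction_on_irreducible generalizing Y with
  | zero => exact absurd rfl hG
  | unit u hu =>
    have : Y = ∅ := by
      rw [Finset.eq_empty_iff_forall_notMem]
      intro y hy
      have := hu.map (eval y)
      rw [hYG y hy] at this
      exact not_isUnit_zero this
    simp [this]
  | mul a p ha hp ih =>
    have hdeg := totalDegree_mul_of_isDomain hp.ne_zero ha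
    rw [hdeg] at heD hmin ⊢
    set A := Y.filter fun y => eval y p = 0
    set B := Y.filter fun y => ¬ eval y p = 0
    have hYaB : ∀ y ∈ B, eval y a = 0 := fun y hy => by
      have := hYG y (Finset.mem_filter.1 hy).1
      rw [map_mul] at this
      exact (mul_eq_zero.1 this).resolve_left (Finset.mem_filter.1 hy).2
    have hminA : ∀ q : MvPolynomial (Fin 2) ℝ, q ≠ 0 → (∀ y ∈ A, eval y q = 0) →
        p.totalDegree ≤ q.totalDegree := by
      intro q hq hqA
      have h1 := hmin (q * a) (mul_ne_zero hq ha) (fun y hy => by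
        by_cases h : eval y p = 0
        · rw [map_mul, hqA y (Finset.mem_filter.2 ⟨hy, h⟩), zero_mul]
        · rw [map_mul, hYaB y (Finset.mem_filter.2 ⟨hy, h⟩), mul_zero])
      rw [totalDegree_mul_of_isDomain hq ha] at h1
      omega
    have hminB : ∀ q : MvPolynomial (Fin 2) ℝ, q ≠ 0 → (∀ y ∈ B, eval y q = 0) →
        a.totalDegree ≤ q.totalDegree := by
      intro q hq hqA
      have h1 := hmin (q * p) (mul_ne_zero hq hp.ne_zero) (fun y hy => by
        by_cases h : eval y p = 0
        · rw [map_mul, h, mul_zero]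
        · rw [map_mul, hqA y (Finset.mem_filter.2 ⟨hy, h⟩), zero_mul])
      rw [totalDegree_mul_of_isDomain hq hp.ne_zero] at h1
      omega
    have h1 : A.card ≤ 10 * hil A (D + p.totalDegree) := by
      have hpA : ∀ y ∈ A, eval y p = 0 := fun y hy => (Finset.mem_filter.1 hy).2
      have hsA := hsep.mono (Finset.filter_subset _ _ : A ⊆ Y)
      rcases Nat.eq_zero_or_pos p.totalDegree with h0 | h0
      · have : A = ∅ := by
          rw [Finset.eq_empty_iff_forall_notMem]
          intro y hy
          rw [totalDegree_eq_zero_iff_eq_C] at h0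
          have h1 := hpA y hy
          rw [h0, eval_C] at h1
          rw [h1, map_zero] at h0
          exact hp.ne_zero h0
        simp [this]
      · exact card_le_ten_mul_hil_of_irreducible hD hp h0 (by omega) hpA hminA hsA
    have h2 : B.card ≤ 10 * hil B (D + a.totalDegree) :=
      ih ha (by omega) hYaB hminB (hsep.mono (Finset.filter_subset _ _))
    have h3 : A.card + B.card = Y.card :=
      Finset.card_filter_add_card_filter_not (s := Y) (fun y => eval y p = 0)
    have h4 := hil_split Y A B (Finset.filter_subset _ _) (Finset.filter_subset _ _) p
      (fun y hy => (Finset.mem_filter.1 hy).2) (fun y hy => (Finset.mem_filter.1 hy).2)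
      (fun y hy => by
        by_cases h : eval y p = 0
        · exact Or.inl (Finset.mem_filter.2 ⟨hy, h⟩)
        · exact Or.inr (Finset.mem_filter.2 ⟨hy, h⟩))
      (t := D + (p.totalDegree + a.totalDegree)) le_rfl
      (show D + a.totalDegree + p.totalDegree ≤ _ by omega)
    have h5 := hil_mono_right A
      (show D + p.totalDegree ≤ D + (p.totalDegree + a.totalDegree) by omega)
    omega

lemma card_le_ten_mul_hil {fs : List (MvPolynomial (Fin 2) ℝ)} {D : ℕ}
    (hD : fs.prod.totalDegree ≤ D) {Y : Finset (Fin 2 → ℝ)} (hsep : SignSep fs Y) :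
    Y.card ≤ 10 * hil Y (2 * D) := by
  classical
  have hfree : (∀ p : MvPolynomial (Fin 2) ℝ, p ≠ 0 → (∀ y ∈ Y, eval y p = 0) →
      D < p.totalDegree) → Y.card ≤ 10 * hil Y (2 * D) := by
    intro hmin
    have h1 : finrank ℝ (van Y D) = 0 := by
      have : van Y D = ⊥ := by
        rw [eq_bot_iff]
        intro p hp
        obtain ⟨hp1, hp2⟩ := mem_van.1 hp
        rw [Submodule.mem_bot]
        by_contra h0
        have := hmin p h0 hp2
        omega
      rw [this, finrank_bot]
    have h2 := hil_add_finrank_van Y D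
    have h3 := two_mul_rdim D
    have h4 := hil_mono_right Y (show D ≤ 2 * D by omega)
    have h5 := card_le_sq hD hsep
    rw [h1, add_zero] at h2
    rw [← h2] at h3
    nlinarith
  by_cases h : ∃ e, ∃ G : MvPolynomial (Fin 2) ℝ, G ≠ 0 ∧ G.totalDegree = e ∧
      ∀ y ∈ Y, eval y G = 0
  · obtain ⟨G, hG, hGe, hYG⟩ := Nat.find_spec h
    have hmin : ∀ p : MvPolynomial (Fin 2) ℝ, p ≠ 0 → (∀ y ∈ Y, eval y p = 0) →
        G.totalDegree ≤ p.totalDegree := fun p hp hpY => by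
      rw [hGe]
      exact Nat.find_min' h ⟨p, hp, rfl, hpY⟩
    by_cases heD : G.totalDegree ≤ D
    · exact (card_le_ten_mul_hil_of_minimal hD hG heD hYG hmin hsep).trans
        (Nat.mul_le_mul_left _ (hil_mono_right _ (by omega)))
    · exact hfree fun p hp hpY => by
        have := hmin p hp hpY
        omega
  · exact hfree fun p hp hpY => absurd ⟨_, p, hp, rfl, hpY⟩ h

end SignCount

/-! ### Rational charts -/

section Homog

variable {σ τ : Type*}

/-- The polynomial `q ^ t * f (s / q)`. -/
def homog (s : σ → MvPolynomial τ ℝ) (q : MvPolynomial τ ℝ) (t : ℕ) (f : MvPolynomial σ ℝ) :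
    MvPolynomial τ ℝ :=
  ∑ α ∈ f.support, C (coeff α f) * (α.prod fun i n => s i ^ n) * q ^ (t - α.degree)

lemma totalDegree_homog_le {s : σ → MvPolynomial τ ℝ} {q : MvPolynomial τ ℝ} {e : ℕ}
    (hs : ∀ i, (s i).totalDegree ≤ e) (hq : q.totalDegree ≤ e) {t : ℕ} {f : MvPolynomial σ ℝ}
    (hf : f.totalDegree ≤ t) : (homog s q t f).totalDegree ≤ e * t := by
  refine totalDegree_finsetSum_le fun α hα => ?_
  have hα' : α.degree ≤ t := (le_totalDegree hα).trans hf
  have h1 : (α.prod fun i n => s i ^ n).totalDegree ≤ e * α.degree := by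
    have hdeg : α.degree = ∑ i ∈ α.support, α i := rfl
    rw [Finsupp.prod, hdeg, Finset.mul_sum]
    refine (totalDegree_finsetProd _ _).trans (Finset.sum_le_sum fun i _ => ?_)
    refine (totalDegree_pow _ _).trans ?_
    rw [mul_comm]
    exact Nat.mul_le_mul_right _ (hs i)
  have h2 : (q ^ (t - α.degree)).totalDegree ≤ e * (t - α.degree) := by
    refine (totalDegree_pow _ _).trans ?_
    rw [mul_comm]
    exact Nat.mul_le_mul_right _ hq
  refine (totalDegree_mul _ _).trans ?_
  have h3 := totalDegree_mul (C (coeff α f)) (α.prod fun i n => s i ^ n)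
  rw [totalDegree_C, zero_add] at h3
  calc _ ≤ e * α.degree + e * (t - α.degree) := by omega
    _ = e * t := by rw [← mul_add]; congr 1; omega

lemma eval_homog {s : σ → MvPolynomial τ ℝ} {q : MvPolynomial τ ℝ} {t : ℕ}
    {f : MvPolynomial σ ℝ} (hf : f.totalDegree ≤ t) {u : τ → ℝ} (hu : eval u q ≠ 0) :
    eval u (homog s q t f) =
      eval u q ^ t * eval (fun i => eval u (s i) / eval u q) f := by
  rw [homog, map_sum, eval_eq (fun i => eval u (s i) / eval u q) f, Finset.mul_sum]
  refine Finset.sum_congr rfl fun α hα => ?_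
  have hα' : α.degree ≤ t := (le_totalDegree hα).trans hf
  rw [map_mul, map_mul, eval_C, map_pow, Finsupp.prod, map_prod]
  simp only [map_pow, div_pow, Finset.prod_div_distrib]
  rw [Finset.prod_pow_eq_pow_sum]
  have : ∑ i ∈ α.support, α i = α.degree := rfl
  rw [this]
  obtain ⟨c, rfl⟩ := Nat.exists_eq_add_of_le hα'
  rw [Nat.add_sub_cancel_left, pow_add]
  field_simp

lemma hil_image_le [Finite σ] [Finite τ] [DecidableEq (τ → ℝ)] (s : τ → MvPolynomial σ ℝ)
    (q : MvPolynomial σ ℝ)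
    (hs : ∀ i, (s i).totalDegree ≤ 1) (hq : q.totalDegree ≤ 1) (Y : Finset (σ → ℝ))
    (hY : ∀ y ∈ Y, eval y q ≠ 0) (t : ℕ) :
    hil (Y.image fun y i => eval y (s i) / eval y q) t ≤ hil Y t := by
  classical
  set φ : (σ → ℝ) → (τ → ℝ) := fun y i => eval y (s i) / eval y q
  have hψ : ∀ u, ∃ y, u ∈ Y.image φ → y ∈ Y ∧ φ y = u := fun u => by
    by_cases hu : u ∈ Y.image φ
    · obtain ⟨y, hy, rfl⟩ := Finset.mem_image.1 hu
      exact ⟨y, fun _ => ⟨hy, rfl⟩⟩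
    · exact ⟨0, fun h => absurd h hu⟩
  choose ψ hψ using hψ
  let L : ((σ → ℝ) → ℝ) →ₗ[ℝ] ((τ → ℝ) → ℝ) :=
    { toFun := fun F u => if u ∈ Y.image φ then F (ψ u) / eval (ψ u) q ^ t else 0
      map_add' := fun F G => by
        ext u
        by_cases hu : u ∈ Y.image φ <;> simp only [hu, if_true, if_false, Pi.add_apply]
        · ring
        · simp
      map_smul' := fun c F => by
        ext u
        by_cases hu : u ∈ Y.image φ <;>
          simp only [hu, if_true, if_false, Pi.smul_apply, smul_eq_mul, RingHom.id_apply]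
        · ring
        · simp }
  refine finrank_le_of_le_map L ?_
  rintro _ ⟨f, hf, rfl⟩
  rw [SetLike.mem_coe, mem_restrictTotalDegree] at hf
  refine ⟨ev Y (homog s q t f), ⟨homog s q t f, ?_, rfl⟩, ?_⟩
  · rw [SetLike.mem_coe, mem_restrictTotalDegree]
    simpa using totalDegree_homog_le hs hq hf
  · ext u
    change (if u ∈ Y.image φ then ev Y (homog s q t f) (ψ u) / eval (ψ u) q ^ t else 0) = _
    by_cases hu : u ∈ Y.image φ
    · obtain ⟨h1, h2⟩ := hψ u hu
      rw [if_pos hu, ev_apply_mem h1, ev_apply_mem hu, eval_homog hf (hY _ h1),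
        mul_div_cancel_left₀ _ (pow_ne_zero _ (hY _ h1))]
      exact congrArg (fun z => eval z f) h2
    · rw [if_neg hu, ev_apply, if_neg hu]

end Homog

/-! ### Sign patterns on spheres -/

section Sphere

/-- Numerators of stereographic projection. -/
def projNum (c : Fin 3 → ℝ) (i : Fin 2) : MvPolynomial (Fin 3) ℝ :=
  X i.castSucc - C (c i.castSucc)

/-- Denominator of stereographic projection. -/
def projDen (c : Fin 3 → ℝ) (w : ℝ) : MvPolynomial (Fin 3) ℝ := C (w + c 2) - X 2

/-- Denominator of inverse stereographic projection. -/
def liftDen : MvPolynomial (Fin 2) ℝ := 1 + X 0 ^ 2 + X 1 ^ 2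

/-- Numerators of inverse stereographic projection. -/
def liftNum (c : Fin 3 → ℝ) (w : ℝ) : Fin 3 → MvPolynomial (Fin 2) ℝ :=
  ![C (c 0) * liftDen + C (2 * w) * X 0, C (c 1) * liftDen + C (2 * w) * X 1,
    C (c 2 + w) * liftDen - C (2 * w)]

lemma totalDegree_liftDen_le : liftDen.totalDegree ≤ 2 := by
  refine (totalDegree_add _ _).trans (max_le ((totalDegree_add _ _).trans (max_le ?_ ?_)) ?_)
  · simp
  · exact (totalDegree_pow _ _).trans (by simp)
  · exact (totalDegree_pow _ _).trans (by simp)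

lemma totalDegree_C_mul_le {σ : Type*} (a : ℝ) (p : MvPolynomial σ ℝ) :
    (C a * p).totalDegree ≤ p.totalDegree := by
  have := totalDegree_mul (C a) p
  rwa [totalDegree_C, zero_add] at this

lemma totalDegree_liftNum_le (c : Fin 3 → ℝ) (w : ℝ) (i : Fin 3) :
    (liftNum c w i).totalDegree ≤ 2 := by
  have h1 : ∀ a : ℝ, (C a * liftDen).totalDegree ≤ 2 := fun a =>
    (totalDegree_C_mul_le _ _).trans totalDegree_liftDen_le
  have h2 : ∀ (a : ℝ) (i : Fin 2), (C a * X i : MvPolynomial (Fin 2) ℝ).totalDegree ≤ 2 :=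
    fun a i => (totalDegree_C_mul_le _ _).trans (by simp)
  fin_cases i
  · exact (totalDegree_add _ _).trans (max_le (h1 _) (h2 _ _))
  · exact (totalDegree_add _ _).trans (max_le (h1 _) (h2 _ _))
  · exact (totalDegree_sub _ _).trans (max_le (h1 _) ((totalDegree_C _).trans_le (by simp)))

lemma eval_liftDen_pos (u : Fin 2 → ℝ) : 0 < eval u liftDen := by
  simp only [liftDen, map_add, map_pow, eval_X, map_one]
  positivity

lemma lift_proj {c : Fin 3 → ℝ} {w : ℝ} {y : Fin 3 → ℝ}
    (hy : ∑ i, (y i - c i) ^ 2 = w ^ 2) (hd : eval y (projDen c w) ≠ 0) {u : Fin 2 → ℝ}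
    (hu : u = fun i => eval y (projNum c i) / eval y (projDen c w)) :
    (fun i => eval u (liftNum c w i) / eval u liftDen) = y := by
  have hL := eval_liftDen_pos u
  have e0 : eval u liftDen * (w + c 2 - y 2) = 2 * w := by
    simp only [projDen, map_sub, eval_C, eval_X] at hd
    rw [Fin.sum_univ_three] at hy
    simp only [hu, liftDen, map_add, map_pow, eval_X, map_one, projNum, projDen, map_sub, eval_C]
    simp only [Fin.castSucc_zero, Fin.castSucc_one]
    field_simp
    linear_combination hy
  simp only [projDen, map_sub, eval_C, eval_X] at hd
  have hu0 : u 0 * (w + c 2 - y 2) = y 0 - c 0 := by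
    simp only [hu, projNum, projDen, map_sub, eval_C, eval_X, Fin.castSucc_zero]
    field_simp
  have hu1 : u 1 * (w + c 2 - y 2) = y 1 - c 1 := by
    simp only [hu, projNum, projDen, map_sub, eval_C, eval_X, Fin.castSucc_one]
    field_simp
  ext i
  rw [div_eq_iff hL.ne']
  fin_cases i
  · simp only [liftNum, Fin.zero_eta, Matrix.cons_val_zero, map_add, map_mul, eval_C, eval_X]
    linear_combination (-u 0) * e0 + eval u liftDen * hu0
  · simp only [liftNum, Fin.mk_one, Matrix.cons_val_one, Matrix.cons_val_zero, map_add, map_mul, eval_C, eval_X]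
    linear_combination (-u 1) * e0 + eval u liftDen * hu1
  · simp only [liftNum, Fin.reduceFinMk, Matrix.cons_val, map_sub, map_mul, eval_C]
    linear_combination e0

/-- On a sphere, the number of sign patterns is controlled by the Hilbert function. -/
lemma card_le_mul_hil_of_sphere {c : Fin 3 → ℝ} {w : ℝ} {Y : Finset (Fin 3 → ℝ)}
    (hY : ∀ y ∈ Y, ∑ i, (y i - c i) ^ 2 = w ^ 2) {fs : List (MvPolynomial (Fin 3) ℝ)} {D : ℕ}
    (hD : (fs.map totalDegree).sum ≤ D) (hsep : SignSep fs Y) : Y.card ≤ 11 * hil Y (4 * D) := by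
  classical
  rcases Y.eq_empty_or_nonempty with rfl | hne
  · simp
  have hpos := hil_pos hne (4 * D)
  set Z := Y.filter fun y => eval y (projDen c w) ≠ 0 with hZ
  have h1 : (Y.filter fun y => ¬ eval y (projDen c w) ≠ 0).card ≤ 1 := by
    refine Finset.card_le_one.2 fun a ha b hb => ?_
    have key : ∀ y ∈ Y.filter (fun y => ¬ eval y (projDen c w) ≠ 0),
        y = ![c 0, c 1, w + c 2] := by
      intro y hy
      obtain ⟨hy1, hy2⟩ := Finset.mem_filter.1 hy
      have h := hY y hy1
      simp only [projDen, map_sub, eval_C, eval_X, not_not] at hy2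
      rw [Fin.sum_univ_three] at h
      have e2 : y 2 = w + c 2 := by linarith
      rw [e2] at h
      have e0 : y 0 - c 0 = 0 := by nlinarith [sq_nonneg (y 0 - c 0), sq_nonneg (y 1 - c 1)]
      have e1 : y 1 - c 1 = 0 := by nlinarith [sq_nonneg (y 0 - c 0), sq_nonneg (y 1 - c 1)]
      ext i
      fin_cases i
      · simpa [sub_eq_zero] using e0
      · simpa [sub_eq_zero] using e1
      · simpa using e2
    rw [key a ha, key b hb]
  have h2 := Finset.card_filter_add_card_filter_not (s := Y) (fun y => eval y (projDen c w) ≠ 0)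
  set φ : (Fin 3 → ℝ) → (Fin 2 → ℝ) :=
    fun y i => eval y (projNum c i) / eval y (projDen c w)
  have hlift : ∀ y ∈ Z, (fun i => eval (φ y) (liftNum c w i) / eval (φ y) liftDen) = y := by
    intro y hy
    obtain ⟨hy1, hy2⟩ := Finset.mem_filter.1 hy
    exact lift_proj (hY y hy1) hy2 rfl
  have hinj : Set.InjOn φ Z := by
    intro a ha b hb hab
    rw [← hlift a ha, ← hlift b hb, hab]
  have h3 : (Z.image φ).card = Z.card := Finset.card_image_of_injOn hinj
  have h4 : hil (Z.image φ) (4 * D) ≤ hil Z (4 * D) := by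
    refine hil_image_le (projNum c) (projDen c w) (fun i => ?_) ?_ Z
      (fun y hy => (Finset.mem_filter.1 hy).2) _
    · exact (totalDegree_sub _ _).trans (max_le (totalDegree_X _).le
        ((totalDegree_C _).trans_le (by simp)))
    · exact (totalDegree_sub _ _).trans (max_le ((totalDegree_C _).trans_le (by simp))
        (totalDegree_X _).le)
  have h5 := hil_mono_left (Finset.filter_subset _ _ : Z ⊆ Y) (4 * D)
  set gs := fs.map fun f => homog (liftNum c w) liftDen f.totalDegree f with hgs
  have h6 : gs.prod.totalDegree ≤ 2 * D := by
    refine le_trans ?_ (Nat.mul_le_mul_left 2 hD)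
    rw [hgs]
    clear hsep hD hgs gs
    induction fs with
    | nil => simp
    | cons f fs ih =>
      simp only [List.map_cons, List.prod_cons, List.sum_cons]
      have := totalDegree_mul (homog (liftNum c w) liftDen f.totalDegree f)
        (List.map (fun f => homog (liftNum c w) liftDen f.totalDegree f) fs).prod
      have := totalDegree_homog_le (totalDegree_liftNum_le c w) totalDegree_liftDen_le
        (le_refl f.totalDegree)
      omega
  have hev : ∀ y ∈ Z, ∀ f : MvPolynomial (Fin 3) ℝ,
      eval (φ y) (homog (liftNum c w) liftDen f.totalDegree f) =
        eval (φ y) liftDen ^ f.totalDegree * eval y f := by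
    intro y hy f
    rw [eval_homog le_rfl (eval_liftDen_pos _).ne', hlift y hy]
  have hsep' : SignSep gs (Z.image φ) := by
    constructor
    · intro u hu g hg
      obtain ⟨y, hy, rfl⟩ := Finset.mem_image.1 hu
      obtain ⟨f, hf, rfl⟩ := List.mem_map.1 hg
      rw [hev y hy]
      exact mul_ne_zero (pow_pos (eval_liftDen_pos _) _).ne'
        (hsep.1 y (Finset.mem_filter.1 hy).1 f hf)
    · intro u hu v hv h
      obtain ⟨y, hy, rfl⟩ := Finset.mem_image.1 hu
      obtain ⟨z, hz, rfl⟩ := Finset.mem_image.1 hv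
      congr 1
      refine hsep.2 y (Finset.mem_filter.1 hy).1 z (Finset.mem_filter.1 hz).1 fun f hf => ?_
      have h7 := h _ (List.mem_map.2 ⟨f, hf, rfl⟩)
      rw [hev y hy, hev z hz] at h7
      have h8 : 0 < eval (φ y) liftDen ^ f.totalDegree * eval (φ z) liftDen ^ f.totalDegree :=
        mul_pos (pow_pos (eval_liftDen_pos _) _) (pow_pos (eval_liftDen_pos _) _)
      refine (mul_pos_iff_of_pos_left h8).1 ?_
      linarith
  have h7 := card_le_ten_mul_hil h6 hsep'
  rw [show 2 * (2 * D) = 4 * D by ring] at h7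
  rw [← hZ] at h2 h5
  omega

end Sphere

end StarBounds

namespace StarBounds

open Module

/-! ### Rescaling to bounded leverage -/

section Scaling

variable {ι : Type*} [Fintype ι]

/-- Restriction of functions to a finset. -/
abbrev res (Q : Finset ι) : (ι → ℝ) →ₗ[ℝ] (Q → ℝ) := LinearMap.funLeft ℝ ℝ Subtype.val

lemma exists_large_coordinate {κ : Type*} [Fintype κ] (U : Submodule ℝ (EuclideanSpace ℝ κ))
    (hU : 0 < finrank ℝ U) :
    ∃ x, ∃ z ∈ U, z ≠ 0 ∧ finrank ℝ U * ‖z‖ ^ 2 ≤ Fintype.card κ * z x ^ 2 := by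
  classical
  set f := stdOrthonormalBasis ℝ U
  set c : κ → ℝ := fun x => ∑ j, (f j : EuclideanSpace ℝ κ) x ^ 2 with hc
  have hsum : ∑ x, c x = finrank ℝ U := by
    simp only [hc]
    rw [Finset.sum_comm]
    have : ∀ j, ∑ x, (f j : EuclideanSpace ℝ κ) x ^ 2 = 1 := by
      intro j
      rw [← EuclideanSpace.real_norm_sq_eq]
      have := f.orthonormal.1 j
      rw [Submodule.coe_norm] at this
      rw [this, one_pow]
    simp [this]
  have hne : (Finset.univ : Finset κ).Nonempty := by
    by_contra h
    rw [Finset.not_nonempty_iff_eq_empty] at h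
    rw [h, Finset.sum_empty] at hsum
    have : (0 : ℝ) < finrank ℝ U := by exact_mod_cast hU
    linarith
  obtain ⟨x, -, hx⟩ : ∃ x ∈ (Finset.univ : Finset κ),
      (finrank ℝ U : ℝ) / Fintype.card κ ≤ c x := by
    refine Finset.exists_le_of_sum_le hne ?_
    rw [hsum, Finset.sum_const, Finset.card_univ, nsmul_eq_mul]
    have : (Fintype.card κ : ℝ) ≠ 0 := by
      rw [← Finset.card_univ]
      exact_mod_cast hne.card_pos.ne'
    rw [mul_div_cancel₀ _ this]
  have hκ : (0 : ℝ) < Fintype.card κ := by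
    rw [← Finset.card_univ]
    exact_mod_cast hne.card_pos
  rw [div_le_iff₀ hκ] at hx
  have hcx : 0 < c x := by
    have : (0 : ℝ) < finrank ℝ U := by exact_mod_cast hU
    by_contra h
    nlinarith
  set z : U := ∑ j, (f j : EuclideanSpace ℝ κ) x • f j with hz
  have hzx : (z : EuclideanSpace ℝ κ) x = c x := by
    simp only [hz, Submodule.coe_sum, Submodule.coe_smul, hc]
    rw [WithLp.ofLp_sum, Finset.sum_apply]
    exact Finset.sum_congr rfl fun j _ => by simp [sq]
  have hzn : ‖(z : EuclideanSpace ℝ κ)‖ ^ 2 = c x := by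
    rw [← Submodule.coe_norm, ← real_inner_self_eq_norm_sq, hz,
      f.orthonormal.inner_sum]
    simp [hc, sq]
  refine ⟨x, z, z.2, ?_, ?_⟩
  · intro h
    rw [h] at hzn
    simp at hzn
    linarith
  · rw [hzn, hzx]
    nlinarith

lemma exists_bounded_extension (V : Submodule ℝ (ι → ℝ)) :
    ∃ K : ℝ, 1 ≤ K ∧ ∀ Q : Finset ι, ∀ z ∈ V, ∃ z' ∈ V, (∀ x ∈ Q, z' x = z x) ∧
      ∑ y, z' y ^ 2 ≤ K * ∑ x ∈ Q, z x ^ 2 := by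
  classical
  have key : ∀ Q : Finset ι, ∃ K : ℝ, 0 ≤ K ∧ ∀ z ∈ V, ∃ z' ∈ V, (∀ x ∈ Q, z' x = z x) ∧
      ∑ y, z' y ^ 2 ≤ K * ∑ x ∈ Q, z x ^ 2 := by
    intro Q
    obtain ⟨s, hs⟩ := LinearMap.exists_rightInverse_of_surjective
      ((res Q).domRestrict V).rangeRestrict (LinearMap.range_rangeRestrict _)
    let S : LinearMap.range ((res Q).domRestrict V) →ₗ[ℝ] (ι → ℝ) := V.subtype ∘ₗ s
    set C := ‖LinearMap.toContinuousLinearMap S‖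
    refine ⟨Fintype.card ι * C ^ 2, by positivity, fun z hz => ?_⟩
    set q : LinearMap.range ((res Q).domRestrict V) :=
      ((res Q).domRestrict V).rangeRestrict ⟨z, hz⟩
    have hqx : ∀ x : Q, (q : Q → ℝ) x = z x := fun x => rfl
    refine ⟨S q, (s q).2, fun x hx => ?_, ?_⟩
    · have h1 := congrArg (fun L => (L q : Q → ℝ) ⟨x, hx⟩) hs
      exact h1
    · have h1 : ‖S q‖ ≤ C * ‖q‖ := (LinearMap.toContinuousLinearMap S).le_opNorm q
      have h2 : ‖q‖ ^ 2 ≤ ∑ x ∈ Q, z x ^ 2 := by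
        have h0 : (0 : ℝ) ≤ ∑ x ∈ Q, z x ^ 2 := Finset.sum_nonneg fun x _ => sq_nonneg _
        rw [← Real.sq_sqrt h0]
        refine pow_le_pow_left₀ (norm_nonneg _) ?_ 2
        refine (pi_norm_le_iff_of_nonneg (Real.sqrt_nonneg _)).2 fun x => ?_
        refine Real.abs_le_sqrt ?_
        change z x ^ 2 ≤ _
        exact Finset.single_le_sum (f := fun x => z x ^ 2) (fun y _ => sq_nonneg _) x.2
      calc ∑ y, S q y ^ 2 ≤ ∑ y : ι, (C * ‖q‖) ^ 2 := by
            refine Finset.sum_le_sum fun y _ => ?_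
            rw [← sq_abs]
            refine pow_le_pow_left₀ (abs_nonneg _) ?_ 2
            rw [← Real.norm_eq_abs]
            exact (norm_le_pi_norm _ y).trans h1
        _ = Fintype.card ι * C ^ 2 * ‖q‖ ^ 2 := by
            rw [Finset.sum_const, Finset.card_univ, nsmul_eq_mul]
            ring
        _ ≤ _ := mul_le_mul_of_nonneg_left h2 (by positivity)
  choose K hK0 hK using key
  have hle : ∀ Q, K Q ≤ 1 + ∑ Q, K Q := fun Q => by
    have := Finset.single_le_sum (fun Q _ => hK0 Q) (Finset.mem_univ Q)
    linarith
  refine ⟨1 + ∑ Q, K Q, by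
    have := Finset.sum_nonneg (s := Finset.univ) (fun Q _ => hK0 Q)
    linarith, fun Q z hz => ?_⟩
  obtain ⟨z', h1, h2, h3⟩ := hK Q z hz
  refine ⟨z', h1, h2, h3.trans ?_⟩
  exact mul_le_mul_of_nonneg_right (hle Q) (Finset.sum_nonneg fun x _ => sq_nonneg _)

/-- The weights all of whose leverages are at most `1 / (2 * M)`. -/
def goodWeights (V : Submodule ℝ (ι → ℝ)) (M : ℝ) : Set (ι → ℝ) :=
  {b | (∀ x, 1 ≤ b x) ∧ ∀ x, ∀ z ∈ V, 2 * M * ((b x - 1) * z x ^ 2) ≤ ∑ y, b y * z y ^ 2}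

lemma no_gap {V : Submodule ℝ (ι → ℝ)} {M : ℝ} (hM : 0 < M)
    (hV : ∀ Q : Finset ι, (Q.card : ℝ) ≤ M * finrank ℝ (V.map (res Q)))
    {K : ℝ} (hK1 : 1 ≤ K) (hK : ∀ Q : Finset ι, ∀ z ∈ V, ∃ z' ∈ V, (∀ x ∈ Q, z' x = z x) ∧
      ∑ y, z' y ^ 2 ≤ K * ∑ x ∈ Q, z x ^ 2)
    {b : ι → ℝ} (hb : b ∈ goodWeights V M) {Q : Finset ι} (hQ : Q.Nonempty) {θ : ℝ} (hθ : 1 ≤ θ)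
    (h1 : ∀ x ∉ Q, b x ≤ θ) (h2 : ∀ x ∈ Q, θ * (4 * K) < b x) : False := by
  classical
  let D : (Q → ℝ) →ₗ[ℝ] EuclideanSpace ℝ Q :=
    { toFun := fun z => WithLp.toLp 2 fun x => √(b x) * z x
      map_add' := fun z z' => by ext x; simp [mul_add]
      map_smul' := fun c z => by ext x; simp; ring }
  have hpos : ∀ x, 0 < b x := fun x => by linarith [hb.1 x]
  have hDx : ∀ z x, D z x = √(b x) * z x := fun z x => rfl
  have hD : Function.Injective D := by
    intro z z' h
    ext x
    have h3 := congrArg (fun v : EuclideanSpace ℝ Q => v x) h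
    simp only [hDx] at h3
    exact mul_left_cancel₀ (Real.sqrt_pos.2 (hpos x)).ne' h3
  set U := (V.map (res Q)).map D
  have hUr : finrank ℝ U = finrank ℝ (V.map (res Q)) :=
    LinearEquiv.finrank_eq (Submodule.equivMapOfInjective D hD _).symm
  have hQr := hV Q
  have hQp : (0 : ℝ) < Q.card := by exact_mod_cast hQ.card_pos
  rw [← hUr] at hQr
  have hr : 0 < finrank ℝ U := by
    by_contra h
    rw [not_lt, Nat.le_zero] at h
    rw [h] at hQr
    simp at hQr
    simp [hQr] at hQp
  obtain ⟨x, _, ⟨_, ⟨z, hz, rfl⟩, rfl⟩, hp0, hp⟩ := exists_large_coordinate U hr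
  obtain ⟨z', hz', hzz, hKz⟩ := hK Q z hz
  have hn : ‖D (res Q z)‖ ^ 2 = ∑ y ∈ Q, b y * z y ^ 2 := by
    rw [EuclideanSpace.real_norm_sq_eq, ← Finset.sum_coe_sort Q]
    refine Finset.sum_congr rfl fun y _ => ?_
    rw [hDx, mul_pow, Real.sq_sqrt (hpos y).le]
    rfl
  have hx : D (res Q z) x ^ 2 = b x * z x ^ 2 := by
    rw [hDx, mul_pow, Real.sq_sqrt (hpos x).le]
    rfl
  have hnp : 0 < ‖D (res Q z)‖ ^ 2 := by positivity
  have hle := hb.2 x z' hz'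
  rw [hzz x x.2] at hle
  have hsplit : ∑ y, b y * z' y ^ 2 ≤ 5 / 4 * ∑ y ∈ Q, b y * z y ^ 2 := by
    rw [← Finset.sum_add_sum_compl Q]
    have e1 : ∑ y ∈ Q, b y * z' y ^ 2 = ∑ y ∈ Q, b y * z y ^ 2 :=
      Finset.sum_congr rfl fun y hy => by rw [hzz y hy]
    have e2 : ∑ y ∈ Qᶜ, b y * z' y ^ 2 ≤ θ * ∑ y, z' y ^ 2 := by
      rw [Finset.mul_sum]
      refine (Finset.sum_le_sum fun y hy => mul_le_mul_of_nonneg_right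
        (h1 y (Finset.mem_compl.1 hy)) (sq_nonneg _)).trans ?_
      exact Finset.sum_le_sum_of_subset_of_nonneg (Finset.subset_univ _)
        fun y _ _ => by positivity
    have e3 : θ * (4 * K) * ∑ y ∈ Q, z y ^ 2 ≤ ∑ y ∈ Q, b y * z y ^ 2 := by
      rw [Finset.mul_sum]
      exact Finset.sum_le_sum fun y hy => mul_le_mul_of_nonneg_right (h2 y hy).le (sq_nonneg _)
    have e4 : θ * ∑ y, z' y ^ 2 ≤ θ * (K * ∑ x ∈ Q, z x ^ 2) :=
      mul_le_mul_of_nonneg_left hKz (by linarith)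
    rw [e1]
    linarith
  rw [Fintype.card_coe] at hp
  rw [hx] at hp
  rw [← hn] at hsplit
  have hb4 : 4 ≤ b x := by
    have := h2 x x.2
    nlinarith
  have h3 : 3 * (b x * z x ^ 2) ≤ 4 * ((b x - 1) * z x ^ 2) := by nlinarith [sq_nonneg (z x)]
  have h4 : (Q.card : ℝ) * (b x * z x ^ 2) ≤ M * finrank ℝ U * (b x * z x ^ 2) :=
    mul_le_mul_of_nonneg_right hQr (mul_nonneg (hpos x).le (sq_nonneg _))
  have h5 : M * (b x * z x ^ 2) ≤ 5 / 6 * ‖D (res Q z)‖ ^ 2 := by nlinarith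
  have hr' : (0 : ℝ) < finrank ℝ U := by exact_mod_cast hr
  nlinarith [mul_pos hr' hnp, mul_le_mul_of_nonneg_left h5 hr'.le]

/-- A subspace of functions satisfying the rank condition can be rescaled so that every
evaluation has leverage at least `1 / (2 * M)`. -/
theorem exists_weights (V : Submodule ℝ (ι → ℝ)) {M : ℝ} (hM : 0 < M)
    (hV : ∀ Q : Finset ι, (Q.card : ℝ) ≤ M * finrank ℝ (V.map (res Q))) :
    ∃ b : ι → ℝ, (∀ x, 1 ≤ b x) ∧ ∀ x, ∃ z ∈ V, z ≠ 0 ∧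
      ∑ y, b y * z y ^ 2 ≤ 2 * M * (b x * z x ^ 2) := by
  classical
  obtain ⟨K, hK1, hK⟩ := exists_bounded_extension V
  have hbdd : ∀ b ∈ goodWeights V M, ∀ x, b x ≤ (4 * K) ^ Fintype.card ι := by
    intro b hb
    have hcount : ∀ j ≤ Fintype.card ι,
        (Finset.univ.filter fun x => (4 * K) ^ j < b x).card ≤ Fintype.card ι - j := by
      intro j
      induction j with
      | zero =>
        intro _
        exact Finset.card_le_univ _
      | succ j ih =>
        intro hj
        have h0 := ih (by omega)
        have hsub : (Finset.univ.filter fun x => (4 * K) ^ (j + 1) < b x) ⊆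
            Finset.univ.filter fun x => (4 * K) ^ j < b x := by
          intro x hx
          simp only [Finset.mem_filter, Finset.mem_univ, true_and] at hx ⊢
          exact (pow_le_pow_right₀ (by linarith) (Nat.le_succ j)).trans_lt hx
        by_cases heq : (Finset.univ.filter fun x => (4 * K) ^ (j + 1) < b x) =
            Finset.univ.filter fun x => (4 * K) ^ j < b x
        · rcases Finset.eq_empty_or_nonempty
            (Finset.univ.filter fun x => (4 * K) ^ (j + 1) < b x) with he | hne
          · rw [he]; simp
          · exfalso
            refine no_gap hM hV hK1 hK hb hne (θ := (4 * K) ^ j) (one_le_pow₀ (by linarith)) ?_ ?_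
            · intro x hx
              rw [heq] at hx
              simpa using hx
            · intro x hx
              rw [← pow_succ]
              simpa using hx
        · have := Finset.card_lt_card (hsub.ssubset_of_ne heq)
          omega
    intro x
    have h := hcount _ le_rfl
    rw [Nat.sub_self, Nat.le_zero, Finset.card_eq_zero] at h
    by_contra hx
    have : x ∈ Finset.univ.filter fun x => (4 * K) ^ Fintype.card ι < b x := by simpa using hx
    rw [h] at this
    simp at this
  have hcompact : IsCompact (goodWeights V M) := by
    refine (isCompact_univ_pi (fun _ : ι => isCompact_Icc (a := (1 : ℝ))
      (b := (4 * K) ^ Fintype.card ι))).of_isClosed_subset ?_ ?_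
    · have : goodWeights V M = (⋂ x, {b : ι → ℝ | 1 ≤ b x}) ∩ ⋂ x, ⋂ z ∈ V,
          {b : ι → ℝ | 2 * M * ((b x - 1) * z x ^ 2) ≤ ∑ y, b y * z y ^ 2} := by
        ext b
        simp [goodWeights]
      rw [this]
      refine (isClosed_iInter fun x => isClosed_le (by fun_prop) (by fun_prop)).inter
        (isClosed_iInter fun x => isClosed_iInter fun z => isClosed_iInter fun _ =>
          isClosed_le (by fun_prop) (by fun_prop))
    · intro b hb x _
      exact ⟨hb.1 x, hbdd b hb x⟩
  have hone : (fun _ => 1 : ι → ℝ) ∈ goodWeights V M := by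
    refine ⟨fun x => le_rfl, fun x z _ => ?_⟩
    simp only [sub_self, zero_mul, mul_zero, one_mul]
    exact Finset.sum_nonneg fun y _ => sq_nonneg _
  obtain ⟨b, hb, hmax⟩ := hcompact.exists_isMaxOn ⟨_, hone⟩
    (f := fun b : ι → ℝ => ∑ x, b x) (by fun_prop)
  refine ⟨b, hb.1, fun x => ?_⟩
  have hVne : ∃ z ∈ V, z ≠ 0 := by
    by_contra h
    push Not at h
    have hV0 : V = ⊥ := by
      rw [eq_bot_iff]
      exact fun z hz => (Submodule.mem_bot ℝ).2 (h z hz)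
    have := hV {x}
    rw [hV0, Submodule.map_bot, finrank_bot] at this
    norm_num at this
  have hcpt : IsCompact ((V : Set (ι → ℝ)) ∩ Metric.sphere 0 1) :=
    (isCompact_sphere _ _).inter_left V.closed_of_finiteDimensional
  have hsne : ((V : Set (ι → ℝ)) ∩ Metric.sphere 0 1).Nonempty := by
    obtain ⟨z, hz, hz0⟩ := hVne
    refine ⟨‖z‖⁻¹ • z, V.smul_mem _ hz, ?_⟩
    rw [mem_sphere_zero_iff_norm, norm_smul, norm_inv, norm_norm,
      inv_mul_cancel₀ (norm_ne_zero_iff.2 hz0)]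
  set φ : (ι → ℝ) → ℝ := fun z => ∑ y, b y * z y ^ 2 - 2 * M * ((b x - 1) * z x ^ 2) with hφ
  obtain ⟨z₀, hz₀, hmin⟩ := hcpt.exists_isMinOn hsne (f := φ) (by fun_prop)
  have hz₀n : ‖z₀‖ = 1 := mem_sphere_zero_iff_norm.1 hz₀.2
  have hz₀0 : z₀ ≠ 0 := by
    rintro rfl
    simp at hz₀n
  by_cases hpos : φ z₀ ≤ 0
  · refine ⟨z₀, hz₀.1, hz₀0, ?_⟩
    have : 0 ≤ 2 * M * z₀ x ^ 2 := by positivity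
    simp only [hφ] at hpos
    nlinarith
  · rw [not_le] at hpos
    exfalso
    set δ := φ z₀ / (2 * M) with hδ
    have hδp : 0 < δ := by positivity
    have hscale : ∀ z ∈ V, φ z₀ * ‖z‖ ^ 2 ≤ φ z := by
      intro z hz
      by_cases hz0 : z = 0
      · simp [hz0, hφ]
      · have hzn : ‖z‖ ≠ 0 := norm_ne_zero_iff.2 hz0
        have h1 : φ z₀ ≤ φ (‖z‖⁻¹ • z) := hmin ⟨V.smul_mem _ hz, by
          rw [mem_sphere_zero_iff_norm, norm_smul, norm_inv, norm_norm, inv_mul_cancel₀ hzn]⟩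
        have h2 : φ (‖z‖⁻¹ • z) * ‖z‖ ^ 2 = φ z := by
          simp only [hφ, Pi.smul_apply, smul_eq_mul, mul_pow]
          rw [sub_mul, Finset.sum_mul]
          congr 1
          · refine Finset.sum_congr rfl fun y _ => ?_
            field_simp
          · field_simp
        rw [← h2]
        exact mul_le_mul_of_nonneg_right h1 (by positivity)
    have hmem : Function.update b x (b x + δ) ∈ goodWeights V M := by
      have hge : ∀ y, b y ≤ Function.update b x (b x + δ) y := by
        intro y
        by_cases hy : y = x
        · subst hy
          rw [Function.update_self]
          linarith
        · rw [Function.update_of_ne hy]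
      refine ⟨fun y => (hb.1 y).trans (hge y), fun y z hz => ?_⟩
      have hW : ∑ y, b y * z y ^ 2 ≤ ∑ y, Function.update b x (b x + δ) y * z y ^ 2 :=
        Finset.sum_le_sum fun y _ => mul_le_mul_of_nonneg_right (hge y) (sq_nonneg _)
      refine le_trans ?_ hW
      by_cases hy : y = x
      · subst hy
        rw [Function.update_self]
        have h1 := hscale z hz
        have h2 : z y ^ 2 ≤ ‖z‖ ^ 2 := by
          rw [← sq_abs, ← Real.norm_eq_abs]
          exact pow_le_pow_left₀ (norm_nonneg _) (norm_le_pi_norm z y) 2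
        have h3 : 2 * M * δ = φ z₀ := by rw [hδ]; field_simp
        have h4 : 2 * M * (δ * z y ^ 2) ≤ φ z := by
          rw [← mul_assoc, h3]
          exact (mul_le_mul_of_nonneg_left h2 hpos.le).trans h1
        simp only [hφ] at h4
        linarith
      · rw [Function.update_of_ne hy]
        exact hb.2 y z hz
    have := hmax hmem
    simp only [Set.mem_ofPred_eq] at this
    rw [Finset.sum_update_of_mem (Finset.mem_univ x), ← Finset.add_sum_erase _ b (Finset.mem_univ x),
      Finset.erase_eq] at this
    linarith

end Scaling

end StarBounds

namespace StarBounds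

open Module MeasureTheory

/-! ### Random hyperplanes -/

section RandomSplit

variable {F : Type*} [NormedAddCommGroup F] [InnerProductSpace ℝ F]

lemma inner_symm_apply_of_involutive (φ : F ≃ₗᵢ[ℝ] F) (hφ : ∀ v, φ (φ v) = v) (v g : F) :
    ⟪v, φ g⟫_ℝ = ⟪φ v, g⟫_ℝ := by
  rw [← φ.inner_map_map v (φ g), hφ]

variable [FiniteDimensional ℝ F]

lemma volume_orthogonal_hyperplane [MeasurableSpace F] [BorelSpace F] {v : F} (hv : v ≠ 0) :
    volume {g : F | ⟪v, g⟫_ℝ = 0} = 0 := by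
  have h : {g : F | ⟪v, g⟫_ℝ = 0} = ((ℝ ∙ v)ᗮ : Submodule ℝ F) := by
    ext g
    simp [Submodule.mem_orthogonal_singleton_iff_inner_right]
  rw [h]
  refine Measure.addHaar_submodule _ _ fun h => ?_
  have h2 : v ∈ (ℝ ∙ v)ᗮ := by rw [h]; trivial
  rw [Submodule.mem_orthogonal_singleton_iff_inner_right, inner_self_eq_zero] at h2
  exact hv h2

lemma volume_ball_le_of_orthonormal [MeasurableSpace F] [BorelSpace F] {u z : F} (hu : ‖u‖ = 1)
    (hz : ‖z‖ = 1) (huz : ⟪u, z⟫_ℝ = 0) :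
    volume (Metric.ball (0 : F) 1) ≤ 4 * volume (Metric.ball (0 : F) 1 ∩
      {g | ⟪u, g⟫_ℝ * ⟪z, g⟫_ℝ < 0 ∧ |⟪u, g⟫_ℝ| < |⟪z, g⟫_ℝ|}) := by
  set A : Set F := Metric.ball (0 : F) 1 ∩
    {g | ⟪u, g⟫_ℝ * ⟪z, g⟫_ℝ < 0 ∧ |⟪u, g⟫_ℝ| < |⟪z, g⟫_ℝ|} with hA
  have hAm : MeasurableSet A := by
    refine measurableSet_ball.inter (IsOpen.measurableSet ?_)
    have h1 : IsOpen {g : F | ⟪u, g⟫_ℝ * ⟪z, g⟫_ℝ < 0} := isOpen_lt (by fun_prop) (by fun_prop)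
    have h2 : IsOpen {g : F | |⟪u, g⟫_ℝ| < |⟪z, g⟫_ℝ|} := isOpen_lt (by fun_prop) (by fun_prop)
    exact h1.inter h2
  set R : F ≃ₗᵢ[ℝ] F := Submodule.reflection (ℝ ∙ u)ᗮ
  set S : F ≃ₗᵢ[ℝ] F := Submodule.reflection (ℝ ∙ (u - z))ᗮ
  have hRR : ∀ v, R (R v) = v := fun v => Submodule.reflection_reflection _ v
  have hSS : ∀ v, S (S v) = v := fun v => Submodule.reflection_reflection _ v
  have hRu : R u = -u := Submodule.reflection_orthogonalComplement_singleton_eq_neg u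
  have hRz : R z = z := Submodule.reflection_mem_subspace_eq_self
    (Submodule.mem_orthogonal_singleton_iff_inner_right.2 huz)
  have hSu : S u = z := Submodule.reflection_sub (hu.trans hz.symm)
  have hSz : S z = u := by rw [← hSu, hSS]
  have hn : ∀ (φ : F ≃ₗᵢ[ℝ] F) (g : F), φ g ∈ Metric.ball (0 : F) 1 ↔ g ∈ Metric.ball (0 : F) 1 :=
    fun φ g => by simp
  set N : Set F := {g | ⟪u, g⟫_ℝ = 0} ∪ {g | ⟪z, g⟫_ℝ = 0} ∪ {g | ⟪u - z, g⟫_ℝ = 0} ∪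
    {g | ⟪u + z, g⟫_ℝ = 0} with hN
  have hzz : ⟪z, z⟫_ℝ = 1 := by rw [real_inner_self_eq_norm_sq, hz, one_pow]
  have huu : ⟪u, u⟫_ℝ = 1 := by rw [real_inner_self_eq_norm_sq, hu, one_pow]
  have hN0 : volume N = 0 := by
    refine measure_union_null (measure_union_null (measure_union_null ?_ ?_) ?_) ?_
    · exact volume_orthogonal_hyperplane (by rintro rfl; simp at hu)
    · exact volume_orthogonal_hyperplane (by rintro rfl; simp at hz)
    · refine volume_orthogonal_hyperplane fun h => ?_
      have : ⟪u, u - z⟫_ℝ = 0 := by rw [h, inner_zero_right]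
      rw [inner_sub_right, huu, huz] at this
      norm_num at this
    · refine volume_orthogonal_hyperplane fun h => ?_
      have : ⟪u, u + z⟫_ℝ = 0 := by rw [h, inner_zero_right]
      rw [inner_add_right, huu, huz] at this
      norm_num at this
  have hcover : Metric.ball (0 : F) 1 ⊆
      N ∪ (A ∪ R ⁻¹' A ∪ S ⁻¹' A ∪ (R.trans S) ⁻¹' A) := by
    intro g hg
    by_cases hgN : g ∈ N
    · exact Or.inl hgN
    right
    simp only [hN, Set.mem_union, Set.mem_ofPred_eq, not_or, inner_sub_left, inner_add_left] at hgN
    obtain ⟨⟨⟨h1, h2⟩, h3⟩, h4⟩ := hgN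
    have hRg : ∀ v, ⟪v, R g⟫_ℝ = ⟪R v, g⟫_ℝ := fun v => inner_symm_apply_of_involutive R hRR v g
    have hSg : ∀ v g, ⟪v, S g⟫_ℝ = ⟪S v, g⟫_ℝ :=
      fun v g => inner_symm_apply_of_involutive S hSS v g
    have habs : |⟪u, g⟫_ℝ| ≠ |⟪z, g⟫_ℝ| := by
      intro h
      rcases abs_eq_abs.1 h with h | h
      · exact h3 (by linarith)
      · exact h4 (by linarith)
    simp only [hA, Set.mem_union, Set.mem_preimage, Set.mem_inter_iff, hn, hg, true_and,
      Set.mem_ofPred_eq, LinearIsometryEquiv.trans_apply, hSg, hRg, hSu, hSz, hRu, hRz,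
      inner_neg_left, abs_neg]
    rcases lt_or_gt_of_ne (mul_ne_zero h1 h2) with h5 | h5 <;>
      rcases lt_or_gt_of_ne habs with h6 | h6
    · exact Or.inl (Or.inl (Or.inl ⟨h5, h6⟩))
    · exact Or.inl (Or.inr ⟨by linarith, h6⟩)
    · exact Or.inl (Or.inl (Or.inr ⟨by linarith, h6⟩))
    · exact Or.inr ⟨by linarith, h6⟩
  have hpre : ∀ φ : F ≃ₗᵢ[ℝ] F, volume (φ ⁻¹' A) = volume A := fun φ =>
    φ.measurePreserving.measure_preimage hAm.nullMeasurableSet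
  calc volume (Metric.ball (0 : F) 1)
      ≤ volume (N ∪ (A ∪ R ⁻¹' A ∪ S ⁻¹' A ∪ (R.trans S) ⁻¹' A)) := measure_mono hcover
    _ ≤ volume N + (volume A + volume (R ⁻¹' A) + volume (S ⁻¹' A) +
          volume ((R.trans S) ⁻¹' A)) := by
        refine (measure_union_le _ _).trans (add_le_add le_rfl ?_)
        refine (measure_union_le _ _).trans (add_le_add ?_ le_rfl)
        refine (measure_union_le _ _).trans (add_le_add ?_ le_rfl)
        exact measure_union_le _ _
    _ = 4 * volume A := by
        rw [hN0, hpre, hpre, hpre]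
        ring

lemma volume_ball_le_of_inner_le [MeasurableSpace F] [BorelSpace F] {u v : F} (hu : ‖u‖ = 1)
    (hv : ‖v‖ = 1) (huv : |⟪u, v⟫_ℝ| ≤ 1 / 2) :
    volume (Metric.ball (0 : F) 1) ≤ 4 * volume (Metric.ball (0 : F) 1 ∩
      {g | ⟪u, g⟫_ℝ * ⟪v, g⟫_ℝ < 0}) := by
  set ρ := ⟪u, v⟫_ℝ with hρ
  have huu : ⟪u, u⟫_ℝ = 1 := by rw [real_inner_self_eq_norm_sq, hu, one_pow]
  have hvv : ⟪v, v⟫_ℝ = 1 := by rw [real_inner_self_eq_norm_sq, hv, one_pow]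
  have hρ2 : ρ ^ 2 ≤ 1 / 4 := by
    rw [← sq_abs]
    nlinarith [abs_nonneg ρ]
  have hy : ‖v - ρ • u‖ ^ 2 = 1 - ρ ^ 2 := by
    rw [← real_inner_self_eq_norm_sq, inner_sub_left, inner_sub_right, inner_sub_right,
      inner_smul_left, inner_smul_left, inner_smul_right, inner_smul_right, huu, hvv,
      real_inner_comm, ← hρ]
    simp
    ring
  set s := ‖v - ρ • u‖ with hs
  have hs0 : 0 < s := by
    have : 0 ≤ s := norm_nonneg _
    rcases this.eq_or_lt with h | h
    · rw [← h] at hy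
      nlinarith
    · exact h
  have hz : ‖s⁻¹ • (v - ρ • u)‖ = 1 := by
    rw [norm_smul, norm_inv, Real.norm_of_nonneg hs0.le, ← hs, inv_mul_cancel₀ hs0.ne']
  have huz : ⟪u, s⁻¹ • (v - ρ • u)⟫_ℝ = 0 := by
    rw [inner_smul_right, inner_sub_right, inner_smul_right, huu, ← hρ]
    ring
  refine (volume_ball_le_of_orthonormal hu hz huz).trans ?_
  gcongr
  rename_i g
  rintro ⟨h1, h2⟩
  set x := ⟪u, g⟫_ℝ
  set y := ⟪s⁻¹ • (v - ρ • u), g⟫_ℝ with hydef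
  have hvg : ⟪v, g⟫_ℝ = ρ * x + s * y := by
    rw [hydef, inner_smul_left, inner_sub_left, inner_smul_left]
    simp
    field_simp
    ring
  change x * ⟪v, g⟫_ℝ < 0
  rw [hvg]
  have hρs : |ρ| ≤ s := by
    refine abs_le_of_sq_le_sq ?_ hs0.le
    nlinarith
  have h3 : |x * y| = -(x * y) := abs_of_neg h1
  rw [abs_mul] at h3
  have hx0 : 0 < |x| := by
    rw [abs_pos]
    rintro h
    rw [h, zero_mul] at h1
    exact lt_irrefl _ h1
  have h4 : ρ * x ^ 2 ≤ |ρ| * |x| ^ 2 := by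
    rw [sq_abs]
    exact mul_le_mul_of_nonneg_right (le_abs_self ρ) (sq_nonneg x)
  have h5 : |ρ| * |x| ^ 2 ≤ s * |x| ^ 2 := mul_le_mul_of_nonneg_right hρs (sq_nonneg _)
  have h6 : s * |x| ^ 2 < s * (|x| * |y|) := by
    refine mul_lt_mul_of_pos_left ?_ hs0
    rw [sq]
    exact mul_lt_mul_of_pos_left h2 hx0
  rw [h3] at h6
  nlinarith

lemma exists_card_le_four_mul {Ω κ : Type*} [MeasurableSpace Ω] (μ : Measure Ω) (B : Set Ω)
    (hB0 : μ B ≠ 0) (hB : μ B ≠ ⊤) (E : Finset κ) (A : κ → Set Ω)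
    [∀ g, DecidablePred fun e => g ∈ A e]
    (hA : ∀ e ∈ E, MeasurableSet (A e)) (h : ∀ e ∈ E, μ B ≤ 4 * μ (B ∩ A e)) :
    ∃ g ∈ B, E.card ≤ 4 * (E.filter fun e => g ∈ A e).card := by
  classical
  by_contra! hcon
  have h1 : ∀ g ∈ B, (4 * ∑ e ∈ E, (A e).indicator (fun _ => (1 : ENNReal)) g) + 1 ≤ E.card := by
    intro g hg
    have h2 : ∑ e ∈ E, (A e).indicator (fun _ => (1 : ENNReal)) g =
        ((E.filter fun e => g ∈ A e).card : ENNReal) := by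
      rw [Finset.card_filter]
      push_cast
      exact Finset.sum_congr rfl fun e _ => by simp [Set.indicator_apply]
    rw [h2]
    exact_mod_cast hcon g hg
  have hmeas : ∀ e ∈ E, Measurable ((A e).indicator (fun _ => (1 : ENNReal))) :=
    fun e he => measurable_const.indicator (hA e he)
  have h2 : ∫⁻ g in B, ((4 * ∑ e ∈ E, (A e).indicator (fun _ => (1 : ENNReal)) g) + 1) ∂μ ≤
      ∫⁻ _ in B, (E.card : ENNReal) ∂μ :=
    setLIntegral_mono measurable_const h1
  rw [lintegral_add_right _ measurable_const, lintegral_const_mul _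
    (Finset.measurable_fun_sum _ hmeas), lintegral_finsetSum _ hmeas,
    setLIntegral_const, setLIntegral_const] at h2
  have h3 : ∀ e ∈ E, ∫⁻ g in B, (A e).indicator (fun _ => (1 : ENNReal)) g ∂μ = μ (B ∩ A e) := by
    intro e he
    rw [lintegral_indicator (hA e he), lintegral_const, one_mul, Measure.restrict_restrict (hA e he),
      Measure.restrict_apply_univ, Set.inter_comm]
  rw [Finset.sum_congr rfl h3, Finset.mul_sum, one_mul] at h2
  have h4 : (E.card : ENNReal) * μ B ≤ ∑ e ∈ E, 4 * μ (B ∩ A e) := by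
    rw [← nsmul_eq_mul, ← Finset.sum_const]
    exact Finset.sum_le_sum h
  have h5 : (E.card : ENNReal) * μ B + μ B ≤ E.card * μ B + 0 := by
    rw [add_zero]
    exact (add_le_add h4 le_rfl).trans h2
  have h6 := (ENNReal.add_le_add_iff_left (ENNReal.mul_ne_top (by simp) hB)).1 h5
  exact hB0 (le_antisymm h6 bot_le)

/-- Some vector splits at least a quarter of the given nearly orthogonal pairs. -/
theorem exists_splitting_vector {κ : Type*} (E : Finset κ) (u v : κ → F)
    (hu : ∀ e ∈ E, ‖u e‖ = 1) (hv : ∀ e ∈ E, ‖v e‖ = 1) (huv : ∀ e ∈ E, |⟪u e, v e⟫_ℝ| ≤ 1 / 2) :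
    ∃ g : F, E.card ≤ 4 * (E.filter fun e => ⟪u e, g⟫_ℝ * ⟪v e, g⟫_ℝ < 0).card := by
  classical
  let _ : MeasurableSpace F := borel F
  have : BorelSpace F := ⟨rfl⟩
  obtain ⟨g, -, hg⟩ := exists_card_le_four_mul (volume : Measure F) (Metric.ball 0 1)
    (Metric.measure_ball_pos _ _ one_pos).ne' measure_ball_lt_top.ne E
    (fun e => {g | ⟪u e, g⟫_ℝ * ⟪v e, g⟫_ℝ < 0})
    (fun e _ => (isOpen_lt (by fun_prop) (by fun_prop)).measurableSet)
    (fun e he => volume_ball_le_of_inner_le (hu e he) (hv e he) (huv e he))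
  refine ⟨g, hg.trans (le_of_eq ?_)⟩
  congr

end RandomSplit

end StarBounds

namespace StarBounds

open MvPolynomial Module

/-! ### Splitting pairs by polynomials -/

section Splitting

lemma exists_perturbation {ι : Type*} [Fintype ι] (z : ι → ℝ) :
    ∃ ε : ℝ, ∀ x, z x + ε ≠ 0 ∧ (z x ≠ 0 → 0 < z x * (z x + ε)) := by
  classical
  obtain ⟨ε, hε0, hε⟩ : ∃ ε > 0, ∀ x, z x ≠ 0 → ε < |z x| := by
    have h : ∀ x, ∀ᶠ ε in nhdsWithin (0 : ℝ) (Set.Ioi 0), z x ≠ 0 → ε < |z x| := fun x => by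
      by_cases hx : z x = 0
      · exact Filter.Eventually.of_forall fun _ h => absurd hx h
      · filter_upwards [Ioo_mem_nhdsGT (abs_pos.2 hx)] with ε hε _ using hε.2
    obtain ⟨ε, h1, h2⟩ := ((Filter.eventually_all.2 h).and self_mem_nhdsWithin).exists
    exact ⟨ε, h2, h1⟩
  refine ⟨ε, fun x => ?_⟩
  have key : z x ≠ 0 → 0 < z x * (z x + ε) := by
    intro hx
    have h1 := hε x hx
    have h2 : -(|z x| * ε) ≤ z x * ε := by
      have := neg_abs_le (z x * ε)
      rwa [abs_mul, abs_of_pos hε0] at this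
    have h3 : |z x| * ε < |z x| * |z x| := mul_lt_mul_of_pos_left h1 (abs_pos.2 hx)
    rw [abs_mul_abs_self] at h3
    linarith
  refine ⟨?_, key⟩
  by_cases hx : z x = 0
  · rw [hx, zero_add]; exact hε0.ne'
  · exact right_ne_zero_of_mul (key hx).ne'

lemma card_large_inner_le {ι : Type*} [Fintype ι] {F : Type*} [NormedAddCommGroup F]
    [InnerProductSpace ℝ F] {M : ℝ} (u : ι → F) (hun : ∀ x, ‖u x‖ = 1)
    (hframe : ∀ z : F, ∑ x, ⟪u x, z⟫_ℝ ^ 2 ≤ 2 * M * ‖z‖ ^ 2) (E : Finset (ι × ι)) :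
    ((E.filter fun e => ¬ |⟪u e.1, u e.2⟫_ℝ| ≤ 1 / 2).card : ℝ) ≤ 8 * M * Fintype.card ι := by
  classical
  have hbad : ∀ y, ((Finset.univ.filter fun x => ¬ |⟪u x, u y⟫_ℝ| ≤ 1 / 2).card : ℝ) ≤ 8 * M := by
    intro y
    have h3 := hframe (u y)
    rw [hun, one_pow, mul_one] at h3
    have h4 : ((Finset.univ.filter fun x => ¬ |⟪u x, u y⟫_ℝ| ≤ 1 / 2).card : ℝ) * (1 / 4) ≤
        ∑ x ∈ Finset.univ.filter (fun x => ¬ |⟪u x, u y⟫_ℝ| ≤ 1 / 2), ⟪u x, u y⟫_ℝ ^ 2 := by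
      rw [← nsmul_eq_mul]
      refine Finset.card_nsmul_le_sum _ _ _ fun x hx => ?_
      have h5 := (Finset.mem_filter.1 hx).2
      rw [not_le] at h5
      rw [← sq_abs]
      nlinarith
    have h5 := Finset.sum_le_sum_of_subset_of_nonneg
      (Finset.subset_univ (Finset.univ.filter fun x => ¬ |⟪u x, u y⟫_ℝ| ≤ 1 / 2))
      (f := fun x => ⟪u x, u y⟫_ℝ ^ 2) (fun x _ _ => sq_nonneg _)
    linarith
  have h3 : (E.filter fun e => ¬ |⟪u e.1, u e.2⟫_ℝ| ≤ 1 / 2).card ≤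
      ∑ y, (Finset.univ.filter fun x => ¬ |⟪u x, u y⟫_ℝ| ≤ 1 / 2).card := by
    rw [Finset.card_eq_sum_card_fiberwise (f := Prod.snd) (t := Finset.univ)
      (fun _ _ => Finset.mem_coe.2 (Finset.mem_univ _))]
    refine Finset.sum_le_sum fun y _ => ?_
    refine Finset.card_le_card_of_injOn Prod.fst ?_ ?_
    · rintro ⟨a, c⟩ hac
      simp only [Finset.coe_filter, Finset.mem_filter, Set.mem_ofPred_eq] at hac
      obtain ⟨⟨_, h4⟩, rfl⟩ := hac
      simpa using h4
    · rintro ⟨a, c⟩ hac ⟨a', c'⟩ hac' h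
      simp only [Finset.coe_filter, Finset.mem_filter, Set.mem_ofPred_eq] at hac hac'
      simp only at h
      rw [h, hac.2, hac'.2]
  calc _ ≤ ((∑ y, (Finset.univ.filter fun x => ¬ |⟪u x, u y⟫_ℝ| ≤ 1 / 2).card : ℕ) : ℝ) := by
        exact_mod_cast h3
    _ ≤ ∑ y : ι, 8 * M := by
        push_cast
        exact Finset.sum_le_sum fun y _ => hbad y
    _ = _ := by
        rw [Finset.sum_const, Finset.card_univ, nsmul_eq_mul]
        ring

lemma exists_frame {ι : Type*} [Fintype ι] [DecidableEq ι] (V : Submodule ℝ (ι → ℝ))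
    {M : ℝ} (hM : 0 < M)
    (hV : ∀ Q : Finset ι, (Q.card : ℝ) ≤ M * finrank ℝ (V.map (res Q))) :
    ∃ (U : Submodule ℝ (EuclideanSpace ℝ ι)) (u : ι → U), (∀ x, ‖u x‖ = 1) ∧
      (∀ z : U, ∑ x, ⟪u x, z⟫_ℝ ^ 2 ≤ 2 * M * ‖z‖ ^ 2) ∧
      ∀ g : U, ∃ z ∈ V, ∀ x, ∃ a > 0, ⟪u x, g⟫_ℝ = a * z x := by
  classical
  obtain ⟨b, hb1, hb⟩ := exists_weights V hM hV
  have hbp : ∀ x, 0 < b x := fun x => by linarith [hb1 x]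
  let D : (ι → ℝ) →ₗ[ℝ] EuclideanSpace ℝ ι :=
    { toFun := fun z => WithLp.toLp 2 fun x => √(b x) * z x
      map_add' := fun z z' => by ext x; simp [mul_add]
      map_smul' := fun c z => by ext x; simp; ring }
  have hDx : ∀ z x, D z x = √(b x) * z x := fun z x => rfl
  set U := V.map D
  let p : ι → U := fun x => U.orthogonalProjectionOnto (EuclideanSpace.single x 1)
  have hpz : ∀ x (z : U), ⟪p x, z⟫_ℝ = (z : EuclideanSpace ℝ ι) x := by
    intro x z
    rw [Submodule.inner_orthogonalProjectionOnto_eq_of_mem_right, EuclideanSpace.inner_single_left]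
    simp
  have hpn : ∀ x, 1 ≤ 2 * M * ‖p x‖ ^ 2 := by
    intro x
    obtain ⟨z, hz, hz0, hzx⟩ := hb x
    set q : U := ⟨D z, z, hz, rfl⟩
    have hqn : ‖q‖ ^ 2 = ∑ y, b y * z y ^ 2 := by
      rw [Submodule.coe_norm, EuclideanSpace.real_norm_sq_eq]
      refine Finset.sum_congr rfl fun y _ => ?_
      rw [hDx, mul_pow, Real.sq_sqrt (hbp y).le]
    have hqpos : 0 < ‖q‖ ^ 2 := by
      rw [hqn]
      obtain ⟨y, hy⟩ := Function.ne_iff.1 hz0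
      refine Finset.sum_pos' (fun y _ => mul_nonneg (hbp y).le (sq_nonneg _))
        ⟨y, Finset.mem_univ _, mul_pos (hbp y) (sq_pos_of_ne_zero hy)⟩
    have hqx : (q : EuclideanSpace ℝ ι) x ^ 2 = b x * z x ^ 2 := by
      change D z x ^ 2 = _
      rw [hDx, mul_pow, Real.sq_sqrt (hbp x).le]
    have hcs : (q : EuclideanSpace ℝ ι) x ^ 2 ≤ ‖p x‖ ^ 2 * ‖q‖ ^ 2 := by
      rw [← hpz, ← mul_pow, ← sq_abs]
      exact pow_le_pow_left₀ (abs_nonneg _) (abs_real_inner_le_norm _ _) 2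
    rw [← hqn, ← hqx] at hzx
    have h3 : ‖q‖ ^ 2 ≤ (2 * M * ‖p x‖ ^ 2) * ‖q‖ ^ 2 := by nlinarith
    exact le_of_mul_le_mul_right (by linarith) hqpos
  have hp0 : ∀ x, 0 < ‖p x‖ := fun x => by
    rcases (norm_nonneg (p x)).eq_or_lt with h | h
    · have := hpn x
      rw [← h] at this
      norm_num at this
    · exact h
  let u : ι → U := fun x => ‖p x‖⁻¹ • p x
  have hun : ∀ x, ‖u x‖ = 1 := fun x => by
    change ‖‖p x‖⁻¹ • p x‖ = 1
    rw [norm_smul, norm_inv, norm_norm, inv_mul_cancel₀ (hp0 x).ne']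
  have huz : ∀ x (z : U), ⟪u x, z⟫_ℝ = ‖p x‖⁻¹ * (z : EuclideanSpace ℝ ι) x := fun x z => by
    refine (inner_smul_left (𝕜 := ℝ) (p x) z ‖p x‖⁻¹).trans ?_
    rw [hpz]; rfl
  have hframe : ∀ z : U, ∑ x, ⟪u x, z⟫_ℝ ^ 2 ≤ 2 * M * ‖z‖ ^ 2 := by
    intro z
    rw [Submodule.coe_norm, EuclideanSpace.real_norm_sq_eq, Finset.mul_sum]
    refine Finset.sum_le_sum fun x _ => ?_
    rw [huz, mul_pow, inv_pow]
    refine mul_le_mul_of_nonneg_right ?_ (sq_nonneg _)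
    rw [inv_le_iff_one_le_mul₀ (pow_pos (hp0 x) 2)]
    exact hpn x
  refine ⟨U, u, hun, hframe, ?_⟩
  rintro ⟨_, z, hz, rfl⟩
  refine ⟨z, hz, fun x => ⟨‖p x‖⁻¹ * √(b x),
    mul_pos (inv_pos.2 (hp0 _)) (Real.sqrt_pos.2 (hbp _)), ?_⟩⟩
  rw [huz, mul_assoc]
  rfl

lemma exists_splitting_function {ι : Type*} [Fintype ι] [DecidableEq ι]
    (V : Submodule ℝ (ι → ℝ)) (h1 : (fun _ => 1) ∈ V)
    {M : ℝ} (hM : 0 < M)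
    (hV : ∀ Q : Finset ι, (Q.card : ℝ) ≤ M * finrank ℝ (V.map (res Q)))
    (E : Finset (ι × ι)) :
    ∃ f ∈ V, (∀ x, f x ≠ 0) ∧
      4 * ((E.filter fun e => 0 < f e.1 * f e.2).card : ℝ) ≤
        3 * E.card + 32 * M * Fintype.card ι := by
  classical
  obtain ⟨U, u, hun, hframe, hU⟩ := exists_frame V hM hV
  have hbadE := card_large_inner_le u hun hframe E
  obtain ⟨g, hg⟩ := exists_splitting_vector (E.filter fun e => |⟪u e.1, u e.2⟫_ℝ| ≤ 1 / 2)
    (fun e => u e.1) (fun e => u e.2) (fun e _ => hun _) (fun e _ => hun _)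
    (fun e he => (Finset.mem_filter.1 he).2)
  obtain ⟨z, hz, hzg⟩ := hU g
  obtain ⟨ε, hε⟩ := exists_perturbation z
  refine ⟨z + ε • fun _ => 1, V.add_mem hz (V.smul_mem _ h1), fun x => ?_, ?_⟩
  · simpa using (hε x).1
  have hsub : (E.filter fun e => |⟪u e.1, u e.2⟫_ℝ| ≤ 1 / 2).filter
      (fun e => ⟪u e.1, g⟫_ℝ * ⟪u e.2, g⟫_ℝ < 0) ⊆
      E.filter fun e => ¬ 0 < (z + ε • fun _ => 1 : ι → ℝ) e.1 * (z + ε • fun _ => 1 : ι → ℝ) e.2 := by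
    intro e he
    simp only [Finset.mem_filter] at he
    obtain ⟨⟨heE, _⟩, h3⟩ := he
    refine Finset.mem_filter.2 ⟨heE, ?_⟩
    obtain ⟨a, ha, hag⟩ := hzg e.1
    obtain ⟨c, hc, hcg⟩ := hzg e.2
    rw [hag, hcg] at h3
    have h4 : 0 < a * c := mul_pos ha hc
    have h5 : z e.1 * z e.2 < 0 := by
      by_contra h
      rw [not_lt] at h
      nlinarith [mul_nonneg h4.le h]
    have h6 := (hε e.1).2 (left_ne_zero_of_mul h5.ne)
    have h7 := (hε e.2).2 (right_ne_zero_of_mul h5.ne)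
    have h8 := mul_pos h6 h7
    simp only [Pi.add_apply, Pi.smul_apply, smul_eq_mul, mul_one]
    intro h9
    nlinarith [mul_pos h9 (neg_pos.2 h5)]
  have h3 := Finset.card_le_card hsub
  have h4 := Finset.card_filter_add_card_filter_not (s := E)
    (fun e => |⟪u e.1, u e.2⟫_ℝ| ≤ 1 / 2)
  have h5 := Finset.card_filter_add_card_filter_not (s := E)
    (fun e => 0 < (z + ε • fun _ => 1 : ι → ℝ) e.1 * (z + ε • fun _ => 1 : ι → ℝ) e.2)
  have h3' := (Nat.cast_le (α := ℝ)).2 h3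
  have h4' := congrArg (Nat.cast : ℕ → ℝ) h4
  have h5' := congrArg (Nat.cast : ℕ → ℝ) h5
  have hg' := (Nat.cast_le (α := ℝ)).2 hg
  push_cast at h4' h5' hg'
  linarith

lemma hil_le_finrank_res {σ : Type*} [Finite σ] {P : Finset (σ → ℝ)}
    {Q : Finset P} (d : ℕ) :
    hil (Q.map (Function.Embedding.subtype _)) d ≤ finrank ℝ
      (((restrictTotalDegree σ ℝ d).map
        ((LinearMap.funLeft ℝ ℝ (Subtype.val : P → (σ → ℝ))) ∘ₗ evalFun)).map (res Q)) := by
  classical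
  let L : (Q → ℝ) →ₗ[ℝ] ((σ → ℝ) → ℝ) :=
    { toFun := fun f y => if h : ∃ hP : y ∈ P, (⟨y, hP⟩ : P) ∈ Q then f ⟨⟨y, h.1⟩, h.2⟩ else 0
      map_add' := fun f g => by
        ext y
        by_cases h : ∃ hP : y ∈ P, (⟨y, hP⟩ : P) ∈ Q <;> simp [h]
      map_smul' := fun c f => by
        ext y
        by_cases h : ∃ hP : y ∈ P, (⟨y, hP⟩ : P) ∈ Q <;> simp [h] }
  refine finrank_le_of_le_map L ?_
  rintro _ ⟨f, hf, rfl⟩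
  refine ⟨_, ⟨_, ⟨f, hf, rfl⟩, rfl⟩, ?_⟩
  ext y
  change (if h : ∃ hP : y ∈ P, (⟨y, hP⟩ : P) ∈ Q then eval y f else 0) = _
  rw [ev_apply]
  simp

/-- If point sets impose many conditions on polynomials of degree `d`, then some polynomial of
degree `d` separates a positive proportion of any family of pairs. -/
theorem exists_splitting_polynomial {σ : Type*} [Finite σ] {P : Finset (σ → ℝ)} {d : ℕ}
    {M : ℝ} (hM : 0 < M) (hP : ∀ Q ⊆ P, (Q.card : ℝ) ≤ M * hil Q d)
    {E : Finset ((σ → ℝ) × (σ → ℝ))} (hE : E ⊆ P ×ˢ P) :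
    ∃ f : MvPolynomial σ ℝ, f.totalDegree ≤ d ∧ (∀ x ∈ P, eval x f ≠ 0) ∧
      4 * ((E.filter fun e => 0 < eval e.1 f * eval e.2 f).card : ℝ) ≤
        3 * E.card + 32 * M * P.card := by
  classical
  set V := (restrictTotalDegree σ ℝ d).map
    ((LinearMap.funLeft ℝ ℝ (Subtype.val : P → (σ → ℝ))) ∘ₗ evalFun)
  have h1 : (fun _ => 1 : P → ℝ) ∈ V := by
    refine ⟨1, ?_, ?_⟩
    · rw [SetLike.mem_coe, mem_restrictTotalDegree]; simp
    · ext x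
      exact map_one (eval (x : σ → ℝ))
  have hQ : ∀ Q : Finset P, (Q.card : ℝ) ≤ M * finrank ℝ (V.map (res Q)) := by
    intro Q
    have h2 := hP (Q.map (Function.Embedding.subtype _)) (fun y hy => by
      obtain ⟨x, -, rfl⟩ := Finset.mem_map.1 hy
      exact x.2)
    rw [Finset.card_map] at h2
    refine h2.trans (mul_le_mul_of_nonneg_left ?_ hM.le)
    exact_mod_cast hil_le_finrank_res d
  let ψ : P × P ↪ (σ → ℝ) × (σ → ℝ) :=
    (Function.Embedding.subtype _).prodMap (Function.Embedding.subtype _)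
  obtain ⟨_, ⟨f, hf, rfl⟩, hf0, hfE⟩ := exists_splitting_function V h1 hM hQ
    (Finset.univ.filter fun e => ψ e ∈ E)
  rw [SetLike.mem_coe, mem_restrictTotalDegree] at hf
  refine ⟨f, hf, fun x hx => hf0 ⟨x, hx⟩, ?_⟩
  have e1 : (Finset.univ.filter fun e => ψ e ∈ E).map ψ = E := by
    ext e
    simp only [Finset.mem_map, Finset.mem_filter, Finset.mem_univ, true_and]
    constructor
    · rintro ⟨e', he', rfl⟩
      exact he'
    · intro he
      obtain ⟨ha, hb⟩ := Finset.mem_product.1 (hE he)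
      exact ⟨(⟨e.1, ha⟩, ⟨e.2, hb⟩), he, rfl⟩
  have e2 : (Finset.univ.filter fun e => ψ e ∈ E).card = E.card := by
    rw [← Finset.card_map ψ, e1]
  have e3 : (E.filter fun e => 0 < eval e.1 f * eval e.2 f).card =
      ((Finset.univ.filter fun e => ψ e ∈ E).filter fun e =>
        0 < eval (ψ e).1 f * eval (ψ e).2 f).card := by
    conv_lhs => rw [← e1, Finset.filter_map, Finset.card_map]
    rfl
  rw [e2, Fintype.card_coe] at hfE
  rw [e3]
  exact hfE

end Splitting

/-! ### Partitioning by polynomials -/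

section Partition

open Classical in
/-- The pairs of points of `P` on which all polynomials of `fs` have the same nonzero sign. -/
def sameSign {σ : Type*} (fs : List (MvPolynomial σ ℝ)) (P : Finset (σ → ℝ)) :
    Finset ((σ → ℝ) × (σ → ℝ)) :=
  (P ×ˢ P).filter fun e => ∀ f ∈ fs, 0 < eval e.1 f * eval e.2 f

lemma exists_partition_step {σ : Type*} [Finite σ] {P : Finset (σ → ℝ)} {d : ℕ}
    {M : ℝ} (hM : 0 < M) (hP : ∀ Q ⊆ P, (Q.card : ℝ) ≤ M * hil Q d)
    (fs : List (MvPolynomial σ ℝ)) (hfs : ∀ x ∈ P, ∀ f ∈ fs, eval x f ≠ 0) (j : ℕ) :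
    ∃ gs : List (MvPolynomial σ ℝ), (∀ x ∈ P, ∀ f ∈ gs, eval x f ≠ 0) ∧
      (gs.map totalDegree).sum ≤ (fs.map totalDegree).sum + j * d ∧
      ((sameSign gs P).card : ℝ) ≤ (3 / 4) ^ j * (sameSign fs P).card + 32 * M * P.card := by
  classical
  induction j with
  | zero =>
    refine ⟨fs, hfs, by simp, ?_⟩
    rw [pow_zero, one_mul]
    have : 0 ≤ 32 * M * P.card := by positivity
    linarith
  | succ j ih =>
    obtain ⟨gs, h1, h2, h3⟩ := ih
    obtain ⟨f, hf, hf0, hfE⟩ := exists_splitting_polynomial hM hP (E := sameSign gs P)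
      (Finset.filter_subset _ _)
    refine ⟨f :: gs, ?_, ?_, ?_⟩
    · intro x hx g hg
      rcases List.mem_cons.1 hg with rfl | hg
      · exact hf0 x hx
      · exact h1 x hx g hg
    · rw [List.map_cons, List.sum_cons, add_mul, one_mul]
      omega
    · have h4 : sameSign (f :: gs) P =
          (sameSign gs P).filter fun e => 0 < eval e.1 f * eval e.2 f := by
        ext e
        simp only [sameSign, Finset.mem_filter, List.forall_mem_cons]
        tauto
      rw [h4, pow_succ]
      linarith

/-- Polynomial partitioning of a set on which the point count is controlled by the Hilbert
function. -/
theorem exists_partition {P : Finset (Fin 3 → ℝ)} {D : ℕ} {s : ℝ} (hs : 0 < s)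
    (hP : ∀ Q ⊆ P, (Q.card : ℝ) ≤ s * hil Q D) (j : ℕ) :
    ∃ fs : List (MvPolynomial (Fin 3) ℝ), (∀ x ∈ P, ∀ f ∈ fs, eval x f ≠ 0) ∧
      2 ^ j * (fs.map totalDegree).sum ≤ 20 * D ∧
      ((sameSign fs P).card : ℝ) ≤ 64 * 8 ^ j * s * P.card := by
  classical
  suffices h : ∀ i j : ℕ, D < 2 ^ (i + j) → ∃ fs : List (MvPolynomial (Fin 3) ℝ),
      (∀ x ∈ P, ∀ f ∈ fs, eval x f ≠ 0) ∧ 2 ^ j * (fs.map totalDegree).sum ≤ 20 * D ∧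
      ((sameSign fs P).card : ℝ) ≤ 64 * 8 ^ j * s * P.card from
    h D j (Nat.lt_two_pow_self.trans_le (Nat.pow_le_pow_right (by norm_num) (Nat.le_add_right _ _)))
  intro i
  induction i with
  | zero =>
    intro j hj
    rw [zero_add] at hj
    refine ⟨[], by simp, by simp, ?_⟩
    have h1 : (sameSign [] P).card ≤ P.card * P.card := by
      rw [← Finset.card_product]
      exact Finset.card_le_card (Finset.filter_subset _ _)
    have h2 : ((hil P D : ℕ) : ℝ) ≤ 8 ^ j := by
      have h3 : hil P D ≤ (2 ^ j) ^ 3 :=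
        (hil_le_pow P D).trans (Nat.pow_le_pow_left hj 3)
      rw [← pow_mul, mul_comm, pow_mul] at h3
      exact_mod_cast h3
    have h3 := hP P subset_rfl
    have h4 : (P.card : ℝ) ≤ s * 8 ^ j := h3.trans (mul_le_mul_of_nonneg_left h2 hs.le)
    calc ((sameSign [] P).card : ℝ) ≤ P.card * P.card := by exact_mod_cast h1
      _ ≤ (s * 8 ^ j) * P.card := mul_le_mul_of_nonneg_right h4 (Nat.cast_nonneg _)
      _ ≤ 64 * 8 ^ j * s * P.card := by
        have : 0 ≤ 63 * ((s * 8 ^ j) * P.card) := by positivity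
        linarith
  | succ i ih =>
    intro j hj
    obtain ⟨fs, h1, h2, h3⟩ := ih (j + 1) (by rwa [← add_assoc, add_right_comm])
    obtain ⟨gs, g1, g2, g3⟩ := exists_partition_step (d := D / 2 ^ j) (M := s * 8 ^ j)
      (by positivity) (fun Q hQ => (hP Q hQ).trans (by
        have h4 := hil_le_mul_hil_div Q D (l := 2 ^ j) (by positivity)
        rw [← pow_mul, mul_comm j, pow_mul] at h4
        have h5 : ((hil Q D : ℕ) : ℝ) ≤ 8 ^ j * hil Q (D / 2 ^ j) := by exact_mod_cast h4
        rw [mul_assoc]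
        exact mul_le_mul_of_nonneg_left h5 hs.le)) fs h1 10
    refine ⟨gs, g1, ?_, ?_⟩
    · have h4 : 2 ^ j * (D / 2 ^ j) ≤ D := Nat.mul_div_le D (2 ^ j)
      have h5 := Nat.mul_le_mul_left (2 ^ j) g2
      rw [pow_succ] at h2
      nlinarith
    · have h4 : (0 : ℝ) ≤ (sameSign fs P).card := Nat.cast_nonneg _
      have h5 : ((3 : ℝ) / 4) ^ 10 ≤ 1 / 16 := by norm_num
      have h6 := mul_le_mul_of_nonneg_right h5 h4
      rw [pow_succ] at h3
      linarith

end Partition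

/-! ### Counting incidences with spheres -/

section Incidences

/-- The points of `P` at distance `w` from `y`. -/
def onSphere (w : ℝ) (P : Finset (Fin 3 → ℝ)) (y : Fin 3 → ℝ) : Finset (Fin 3 → ℝ) :=
  P.filter fun x => ∑ i, (x i - y i) ^ 2 = w ^ 2

lemma mem_onSphere {w : ℝ} {P : Finset (Fin 3 → ℝ)} {x y : Fin 3 → ℝ} :
    x ∈ onSphere w P y ↔ x ∈ P ∧ ∑ i, (x i - y i) ^ 2 = w ^ 2 := Finset.mem_filter

lemma sum_card_onSphere_comm (w : ℝ) (P E : Finset (Fin 3 → ℝ)) :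
    ∑ x ∈ P, (onSphere w E x).card = ∑ y ∈ E, (onSphere w P y).card := by
  classical
  have h := Finset.sum_card_bipartiteAbove_eq_sum_card_bipartiteBelow
    (fun x y : Fin 3 → ℝ => ∑ i, (x i - y i) ^ 2 = w ^ 2) (s := P) (t := E)
  refine Eq.trans (Finset.sum_congr rfl fun x _ => ?_) (h.trans rfl)
  refine congrArg _ (Finset.filter_congr fun y _ => ?_)
  rw [Finset.sum_congr rfl fun i _ => sub_sq_comm (y i) (x i)]

lemma orthogonal_triples {V : Type*} [NormedAddCommGroup V] [InnerProductSpace ℝ V]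
    [FiniteDimensional ℝ V] {r : ℝ} {p c : Fin 3 → V} (hp : Function.Injective p)
    (hc : Function.Injective c) (h : ∀ i j, dist (p i) (c j) = r) : 4 ≤ finrank ℝ V := by
  have indep : ∀ {p c : Fin 3 → V}, Function.Injective p → (∀ i j, dist (p i) (c j) = r) →
      finrank ℝ (vectorSpan ℝ (Set.range p)) = 2 := fun {p c} hp h => by
    have h1 : EuclideanGeometry.Cospherical (Set.range p) :=
      ⟨c 0, r, by rintro _ ⟨i, rfl⟩; exact h i 0⟩
    exact (h1.affineIndependent subset_rfl hp).finrank_vectorSpan rfl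
  have h1 := indep hp h
  have h2 := indep hc fun i j => (dist_comm _ _).trans (h j i)
  have h3 : vectorSpan ℝ (Set.range c) ≤ (vectorSpan ℝ (Set.range p))ᗮ := by
    rw [← Submodule.isOrtho_iff_le, vectorSpan_range_eq_span_range_vsub_right ℝ c 0,
      vectorSpan_range_eq_span_range_vsub_right ℝ p 0, Submodule.isOrtho_span]
    rintro _ ⟨i, rfl⟩ _ ⟨j, rfl⟩
    exact EuclideanGeometry.inner_vsub_vsub_of_dist_eq_of_dist_eq
      ((h 0 0).trans (h j 0).symm) ((h 0 i).trans (h j i).symm)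
  have h4 := Submodule.finrank_mono h3
  have h5 := (vectorSpan ℝ (Set.range p)).finrank_add_finrank_orthogonal
  omega

lemma card_common_centers_le (w : ℝ) (E : Finset (Fin 3 → ℝ)) {a b c : Fin 3 → ℝ}
    (hab : a ≠ b) (hac : a ≠ c) (hbc : b ≠ c) :
    (E.filter fun y => a ∈ onSphere w {a} y ∧ b ∈ onSphere w {b} y ∧
      c ∈ onSphere w {c} y).card ≤ 2 := by
  classical
  by_contra! hlt
  obtain ⟨x, y, z, hx, hy, hz, hxy, hxz, hyz⟩ := Finset.two_lt_card_iff.1 hlt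
  simp only [Finset.mem_filter, mem_onSphere, Finset.mem_singleton, true_and] at hx hy hz
  have inj : ∀ {a b c : Fin 3 → ℝ}, a ≠ b → a ≠ c → b ≠ c →
      Function.Injective fun i => (WithLp.toLp 2 (![a, b, c] i) : EuclideanSpace ℝ (Fin 3)) := by
    intro a b c h1 h2 h3 i j hij
    have hij := WithLp.toLp_injective 2 hij
    fin_cases i <;> fin_cases j <;> simp_all
  have h := orthogonal_triples (r := √(w ^ 2)) (inj hab hac hbc) (inj hxy hxz hyz) (by
    intro i j
    rw [EuclideanSpace.dist_eq]
    congr 1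
    simp only [Real.dist_eq, sq_abs]
    fin_cases i <;> fin_cases j
    exacts [hx.2.1, hy.2.1, hz.2.1, hx.2.2.1, hy.2.2.1, hz.2.2.1, hx.2.2.2, hy.2.2.2, hz.2.2.2])
  rw [finrank_euclideanSpace_fin] at h
  omega

lemma sum_card_onSphere_le_of_small (w : ℝ) (A E : Finset (Fin 3 → ℝ)) :
    ∑ y ∈ E, (onSphere w A y).card ≤
      2 * (E.filter fun y => (onSphere w A y).Nonempty).card + 2 * A.card ^ 3 := by
  classical
  let tri : Finset ((Fin 3 → ℝ) × (Fin 3 → ℝ) × (Fin 3 → ℝ)) :=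
    (A ×ˢ A ×ˢ A).filter fun t => t.1 ≠ t.2.1 ∧ t.1 ≠ t.2.2 ∧ t.2.1 ≠ t.2.2
  let R : (Fin 3 → ℝ) → (Fin 3 → ℝ) × (Fin 3 → ℝ) × (Fin 3 → ℝ) → Prop := fun y t =>
    t.1 ∈ onSphere w {t.1} y ∧ t.2.1 ∈ onSphere w {t.2.1} y ∧ t.2.2 ∈ onSphere w {t.2.2} y
  have h1 : ∀ y ∈ E, (onSphere w A y).card ≤
      2 * (if (onSphere w A y).Nonempty then 1 else 0) + (tri.filter (R y)).card := by
    intro y _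
    split_ifs with hne
    · by_cases hlt : (onSphere w A y).card ≤ 2
      · omega
      push Not at hlt
      obtain ⟨a, b, _, ha, hb, _, hab, _, _⟩ := Finset.two_lt_card_iff.1 hlt
      have h2 : (((onSphere w A y).erase a).erase b).card ≤ (tri.filter (R y)).card := by
        refine Finset.card_le_card_of_injOn (fun c => (a, b, c)) ?_ ?_
        · intro c hc
          simp only [Finset.coe_erase, Set.mem_sdiff, Finset.mem_coe, Set.mem_singleton_iff] at hc
          obtain ⟨⟨hc, hca⟩, hcb⟩ := hc
          rw [mem_onSphere] at ha hb hc
          simp only [tri, R, Finset.coe_filter, Finset.mem_filter, Finset.mem_product,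
            Set.mem_ofPred_eq, mem_onSphere, Finset.mem_singleton, true_and]
          exact ⟨⟨⟨ha.1, hb.1, hc.1⟩, hab, Ne.symm hca, Ne.symm hcb⟩, ha.2, hb.2, hc.2⟩
        · intro c _ c' _ h
          simpa using h
      rw [Finset.card_erase_of_mem (Finset.mem_erase.2 ⟨hab.symm, hb⟩),
        Finset.card_erase_of_mem ha] at h2
      omega
    · rw [Finset.not_nonempty_iff_eq_empty] at hne
      rw [hne]
      simp
  have h2 : ∑ y ∈ E, (tri.filter (R y)).card ≤ 2 * A.card ^ 3 := by
    have h3 := Finset.sum_card_bipartiteAbove_eq_sum_card_bipartiteBelow R (s := E) (t := tri)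
    calc ∑ y ∈ E, (tri.filter (R y)).card = ∑ t ∈ tri, (E.filter fun y => R y t).card := h3
      _ ≤ ∑ t ∈ tri, 2 := Finset.sum_le_sum fun t ht => by
        obtain ⟨-, h4, h5, h6⟩ := Finset.mem_filter.1 ht
        exact card_common_centers_le w E h4 h5 h6
      _ = 2 * tri.card := by rw [Finset.sum_const, smul_eq_mul, mul_comm]
      _ ≤ 2 * A.card ^ 3 := by
        refine Nat.mul_le_mul_left _ ((Finset.card_filter_le _ _).trans_eq ?_)
        rw [Finset.card_product, Finset.card_product]
        ring
  calc _ ≤ ∑ y ∈ E, (2 * (if (onSphere w A y).Nonempty then 1 else 0) +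
        (tri.filter (R y)).card) := Finset.sum_le_sum h1
    _ ≤ _ := by
      rw [Finset.sum_add_distrib, ← Finset.mul_sum, Finset.sum_boole, Nat.cast_id]
      omega

/-- An incidence bound for points which are split into small classes. -/
theorem sum_card_onSphere_le {κ : Type*} [DecidableEq κ] (w : ℝ) (P E : Finset (Fin 3 → ℝ))
    (χ : (Fin 3 → ℝ) → κ) {L : ℕ} (hL : ∀ a, (P.filter fun x => χ x = a).card ≤ L) :
    ∑ y ∈ E, (onSphere w P y).card ≤
      2 * ∑ y ∈ E, ((onSphere w P y).image χ).card + 2 * L ^ 2 * P.card := by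
  classical
  have hPimg : ∀ y, ∀ x ∈ onSphere w P y, χ x ∈ P.image χ := fun y x hx =>
    Finset.mem_image_of_mem _ (mem_onSphere.1 hx).1
  have hfib : ∀ y a, ((onSphere w P y).filter fun x => χ x = a) =
      onSphere w (P.filter fun x => χ x = a) y := fun y a => Finset.filter_comm _ _ _
  calc ∑ y ∈ E, (onSphere w P y).card
      = ∑ y ∈ E, ∑ a ∈ P.image χ, (onSphere w (P.filter fun x => χ x = a) y).card := by
        refine Finset.sum_congr rfl fun y _ => ?_
        rw [Finset.card_eq_sum_card_fiberwise (hPimg y)]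
        simp_rw [hfib]
    _ = ∑ a ∈ P.image χ, ∑ y ∈ E, (onSphere w (P.filter fun x => χ x = a) y).card :=
        Finset.sum_comm
    _ ≤ ∑ a ∈ P.image χ, (2 * (E.filter fun y =>
          (onSphere w (P.filter fun x => χ x = a) y).Nonempty).card +
          2 * (P.filter fun x => χ x = a).card ^ 3) :=
        Finset.sum_le_sum fun a _ => sum_card_onSphere_le_of_small w _ E
    _ = 2 * ∑ a ∈ P.image χ, (E.filter fun y =>
          (onSphere w (P.filter fun x => χ x = a) y).Nonempty).card +
          ∑ a ∈ P.image χ, 2 * (P.filter fun x => χ x = a).card ^ 3 := by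
        rw [Finset.sum_add_distrib, Finset.mul_sum]
    _ ≤ _ := by
        refine Nat.add_le_add (Nat.mul_le_mul_left _ (le_of_eq ?_)) ?_
        · refine (Finset.sum_card_bipartiteAbove_eq_sum_card_bipartiteBelow _).trans ?_
          refine Finset.sum_congr rfl fun y _ => congrArg _ ?_
          ext a
          simp only [Finset.bipartiteBelow, Finset.mem_filter, Finset.mem_image]
          constructor
          · rintro ⟨-, x, hx⟩
            rw [← hfib, Finset.mem_filter] at hx
            exact ⟨x, hx⟩
          · rintro ⟨x, hx, rfl⟩
            exact ⟨⟨x, (mem_onSphere.1 hx).1, rfl⟩, x, by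
              rw [← hfib, Finset.mem_filter]; exact ⟨hx, rfl⟩⟩
        · rw [Finset.card_eq_sum_card_image χ P, Finset.mul_sum]
          refine Finset.sum_le_sum fun a _ => ?_
          rw [pow_succ, ← mul_assoc]
          gcongr
          exact hL a

end Incidences

/-! ### Rich points -/

section Rich

/-- The sign pattern of the polynomials `fs`. -/
def signs {σ : Type*} (fs : List (MvPolynomial σ ℝ)) (x : σ → ℝ) : List Prop :=
  fs.map fun f => 0 < eval x f

lemma signs_eq_iff {σ : Type*} {fs : List (MvPolynomial σ ℝ)} {x y : σ → ℝ}
    (hx : ∀ f ∈ fs, eval x f ≠ 0) (hy : ∀ f ∈ fs, eval y f ≠ 0) :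
    signs fs x = signs fs y ↔ ∀ f ∈ fs, 0 < eval x f * eval y f := by
  rw [signs, signs, List.map_inj_left]
  refine forall₂_congr fun f hf => ?_
  rw [eq_iff_iff]
  rcases (hx f hf).lt_or_gt with h1 | h1 <;> rcases (hy f hf).lt_or_gt with h2 | h2
  · simp [h1.le.not_gt, h2.le.not_gt, mul_pos_of_neg_of_neg h1 h2]
  · simp [h1.le.not_gt, h2, (mul_neg_of_neg_of_pos h1 h2).le.not_gt]
  · simp [h1, h2.le.not_gt, (mul_neg_of_pos_of_neg h1 h2).le.not_gt]
  · simp [h1, h2, mul_pos h1 h2]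

open Classical in
lemma card_image_signs_le {w : ℝ} {P Q : Finset (Fin 3 → ℝ)} (hQ : Q ⊆ P)
    {fs : List (MvPolynomial (Fin 3) ℝ)} (hfs : ∀ x ∈ P, ∀ f ∈ fs, eval x f ≠ 0) {D : ℕ}
    (hD : 4 * (fs.map totalDegree).sum ≤ D) (y : Fin 3 → ℝ) :
    ((onSphere w Q y).image (signs fs)).card ≤ 11 * hil (onSphere w P y) D := by
  obtain ⟨Y, hY, hinj, himg⟩ := Finset.exists_subset_injOn_image_eq_of_surjOn
    (f := signs fs) (onSphere w Q y : Set (Fin 3 → ℝ)) ((onSphere w Q y).image (signs fs))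
    (by rw [Finset.coe_image]; exact Set.surjOn_image _ _)
  rw [← himg, Finset.card_image_of_injOn hinj]
  have hY' : ∀ x ∈ Y, x ∈ Q ∧ ∑ i, (x i - y i) ^ 2 = w ^ 2 := fun x hx =>
    mem_onSphere.1 (Finset.mem_coe.1 (hY hx))
  have hYP : ∀ x ∈ Y, ∀ f ∈ fs, eval x f ≠ 0 := fun x hx => hfs x (hQ (hY' x hx).1)
  refine (card_le_mul_hil_of_sphere (c := y) (w := w) (fun x hx => (hY' x hx).2) le_rfl
    ⟨hYP, fun x hx z hz h => hinj hx hz ?_⟩).trans ?_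
  · exact (signs_eq_iff (hYP x hx) (hYP z hz)).2 h
  · refine Nat.mul_le_mul_left _ ((hil_mono_right _ hD).trans (hil_mono_left ?_ _))
    intro x hx
    exact mem_onSphere.2 ⟨hQ (hY' x hx).1, (hY' x hx).2⟩

lemma exists_small_jump {h : ℕ → ℕ} (hh : Monotone h) {D : ℕ} (hD : 3 ≤ D) :
    ∃ t, D / 2 ≤ t ∧ t + 2 ≤ D ∧ D * h (t + 2) ≤ 8 * h D + D * h t := by
  by_contra! hlt
  have key : ∀ i, D / 2 + 2 * i ≤ D → i * (8 * h D + 1) ≤ D * h (D / 2 + 2 * i) := by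
    intro i
    induction i with
    | zero => intro _; simp
    | succ i ih =>
      intro hi
      have h1 := ih (by omega)
      have h2 := hlt (D / 2 + 2 * i) (by omega) (by omega)
      have h3 : D / 2 + 2 * (i + 1) = D / 2 + 2 * i + 2 := by ring
      rw [h3, add_mul, one_mul]
      omega
  have h1 := key ((D - D / 2) / 2) (by omega)
  have h2 : D ≤ 8 * ((D - D / 2) / 2) := by omega
  have h3 := Nat.mul_le_mul_left D
    (hh (show D / 2 + 2 * ((D - D / 2) / 2) ≤ D by omega))
  have h4 := Nat.mul_le_mul_right (h D) h2
  have h5 : 0 < (D - D / 2) / 2 := by omega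
  nlinarith

/-- The equation of a sphere. -/
def sphereEq (w : ℝ) (y : Fin 3 → ℝ) : MvPolynomial (Fin 3) ℝ :=
  ∑ i, (X i - C (y i)) ^ 2 - C (w ^ 2)

lemma eval_sphereEq (w : ℝ) (x y : Fin 3 → ℝ) :
    eval x (sphereEq w y) = ∑ i, (x i - y i) ^ 2 - w ^ 2 := by
  simp [sphereEq]

lemma totalDegree_sphereEq_le (w : ℝ) (y : Fin 3 → ℝ) : (sphereEq w y).totalDegree ≤ 2 := by
  refine (totalDegree_sub_C_le _ _).trans (totalDegree_finsetSum_le fun i _ => ?_)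
  refine (totalDegree_pow _ _).trans ?_
  have := totalDegree_sub_C_le (X i : MvPolynomial (Fin 3) ℝ) (y i)
  rw [totalDegree_X] at this
  omega

lemma hil_onSphere_le {w : ℝ} {P : Finset (Fin 3 → ℝ)} {D : ℕ} {s : ℝ} (hs : 0 < s)
    (hP : ∀ Q ⊆ P, (Q.card : ℝ) ≤ s * hil Q D) (hPs : (P.card : ℝ) = s * hil P D)
    {t : ℕ} (ht : t ≤ D) {r : ℕ} (hr : r ≤ t + 2) (y : Fin 3 → ℝ) :
    (hil (onSphere w P y) r : ℝ) ≤
      (hil P (t + 2) - hil P t : ℝ) + (onSphere w P y).card / s := by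
  classical
  have hA : onSphere w P y ⊆ P := Finset.filter_subset _ _
  have hB : P \ onSphere w P y ⊆ P := Finset.sdiff_subset
  have h1 := hil_split P (onSphere w P y) (P \ onSphere w P y) hA hB (sphereEq w y)
    (fun x hx => by rw [eval_sphereEq, (mem_onSphere.1 hx).2, sub_self])
    (fun x hx => by
      rw [eval_sphereEq, sub_ne_zero]
      intro h
      exact (Finset.mem_sdiff.1 hx).2 (mem_onSphere.2 ⟨hB hx, h⟩))
    (fun x hx => by
      by_cases h : x ∈ onSphere w P y
      · exact Or.inl h
      · exact Or.inr (Finset.mem_sdiff.2 ⟨hx, h⟩))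
    (totalDegree_sphereEq_le w y) (le_refl (t + 2))
  have h2 := hil_add_hil_le hB ht
  have h3 := hil_mono_right (onSphere w P y) hr
  have h4 := hP _ hB
  have h5 := Finset.card_sdiff_add_card_eq_card hA
  have h1' := (Nat.cast_le (α := ℝ)).2 h1
  have h2' := (Nat.cast_le (α := ℝ)).2 h2
  have h3' := (Nat.cast_le (α := ℝ)).2 h3
  have h5' := congrArg (Nat.cast : ℕ → ℝ) h5
  push_cast at h1' h2' h3' h5'
  have h6 : (hil P D : ℝ) - hil (P \ onSphere w P y) D ≤ (onSphere w P y).card / s := by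
    rw [le_div_iff₀ hs]
    linarith
  linarith

lemma sum_card_onSphere_le_of_sq_le {w : ℝ} {P E : Finset (Fin 3 → ℝ)} {k : ℝ}
    (hk : ∀ p ∈ P, k ≤ (onSphere w E p).card) (h : 2 * (P.card : ℝ) ^ 2 ≤ k / 2) :
    P.card * k ≤ 4 * E.card := by
  have h1 := sum_card_onSphere_le w P E (fun _ => ()) (L := P.card)
    (fun _ => Finset.card_filter_le _ _)
  have h2 : ∑ y ∈ E, ((onSphere w P y).image fun _ => ()).card ≤ E.card := by
    rw [Finset.card_eq_sum_ones]
    exact Finset.sum_le_sum fun y _ => Finset.card_le_one.2 fun _ _ _ _ => rfl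
  rw [← sum_card_onSphere_comm] at h1
  have h3 : P.card * k ≤ ((∑ x ∈ P, (onSphere w E x).card : ℕ) : ℝ) := by
    push_cast
    rw [← nsmul_eq_mul]
    exact Finset.card_nsmul_le_sum _ _ _ hk
  have h1' := (Nat.cast_le (α := ℝ)).2 h1
  have h2' := (Nat.cast_le (α := ℝ)).2 h2
  push_cast at h1' h2' h3
  have h4 : (0 : ℝ) ≤ P.card := Nat.cast_nonneg _
  nlinarith

/-- The key estimate for a set of rich points which is extremal for its Hilbert function. -/
lemma mul_mul_le_of_extremal {w : ℝ} {P E : Finset (Fin 3 → ℝ)} {k : ℝ} {D : ℕ} (hD : 1 ≤ D)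
    (hne : P.Nonempty) {s : ℝ} (hs : 176 ≤ s) (hsk : 32 * (64 * 8 ^ 8) ^ 2 * s ^ 2 ≤ k / 4)
    (hP : ∀ Q ⊆ P, (Q.card : ℝ) ≤ s * hil Q D) (hPs : (P.card : ℝ) = s * hil P D)
    (hk : ∀ p ∈ P, k ≤ (onSphere w E p).card) (hk' : ∀ p ∈ P, (onSphere w E p).card ≤ 2 * k) :
    s * k * D ≤ 704 * E.card := by
  classical
  have hs0 : 0 < s := by linarith
  have hk0 : 0 < k := by nlinarith [sq_pos_of_pos hs0]
  have hh : (1 : ℝ) ≤ hil P D := by exact_mod_cast hil_pos hne D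
  have hE0 : (0 : ℝ) ≤ E.card := Nat.cast_nonneg _
  rcases lt_or_ge D 3 with hD3 | hD3
  · have h1 : (hil P D : ℝ) ≤ 27 := by
      have h2 : hil P D ≤ 3 ^ 3 := (hil_le_pow P D).trans (Nat.pow_le_pow_left hD3 3)
      exact_mod_cast h2
    have h2 : (P.card : ℝ) ≤ s * 27 := by
      rw [hPs]; exact mul_le_mul_of_nonneg_left h1 hs0.le
    have h3 : (P.card : ℝ) ^ 2 ≤ (s * 27) ^ 2 := pow_le_pow_left₀ (Nat.cast_nonneg _) h2 2
    have h4 := sum_card_onSphere_le_of_sq_le hk (by nlinarith [sq_nonneg s])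
    have h5 : s ≤ P.card := by rw [hPs]; nlinarith
    have h6 : s * k ≤ 4 * E.card := (mul_le_mul_of_nonneg_right h5 hk0.le).trans h4
    have h7 : (D : ℝ) ≤ 2 := by exact_mod_cast Nat.le_of_lt_succ hD3
    nlinarith [mul_pos hs0 hk0]
  obtain ⟨fs, hfs, hdeg, hΦ⟩ := exists_partition hs0 hP 8
  obtain ⟨B, hB⟩ : ∃ B : ℝ, B = 64 * 8 ^ 8 := ⟨_, rfl⟩
  have hB0 : 0 < B := by rw [hB]; positivity
  rw [← hB] at hsk hΦ
  set cell : (Fin 3 → ℝ) → Finset (Fin 3 → ℝ) := fun x =>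
    P.filter fun z => signs fs z = signs fs x
  set Q := P.filter fun x => ((cell x).card : ℝ) ≤ 4 * B * s
  have hQP : Q ⊆ P := Finset.filter_subset _ _
  have hcells : ((∑ x ∈ P, (cell x).card : ℕ) : ℝ) ≤ B * s * P.card := by
    refine le_trans ?_ hΦ
    rw [← Finset.card_sigma]
    refine Nat.cast_le.2 (Finset.card_le_card_of_injOn (fun e => (e.1, e.2)) ?_ ?_)
    · rintro ⟨x, z⟩ hxz
      obtain ⟨hx, hz⟩ := Finset.mem_sigma.1 (Finset.mem_coe.1 hxz)
      obtain ⟨hz, hzx⟩ := Finset.mem_filter.1 hz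
      refine Finset.mem_coe.2 (Finset.mem_filter.2 ⟨Finset.mem_product.2 ⟨hx, hz⟩, ?_⟩)
      exact (signs_eq_iff (hfs x hx) (hfs z hz)).1 hzx.symm
    · rintro ⟨x, z⟩ _ ⟨x', z'⟩ _ h
      simp only [Prod.mk.injEq] at h
      obtain ⟨rfl, rfl⟩ := h
      rfl
  have hQcard : 3 * (P.card : ℝ) ≤ 4 * Q.card := by
    have h1 : ((P \ Q).card : ℝ) * (4 * B * s) ≤ B * s * P.card := by
      refine le_trans ?_ hcells
      push_cast
      rw [← nsmul_eq_mul]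
      refine (Finset.card_nsmul_le_sum (P \ Q) (fun x => ((cell x).card : ℝ)) _ fun x hx => ?_).trans
        (Finset.sum_le_sum_of_subset_of_nonneg Finset.sdiff_subset
          fun _ _ _ => Nat.cast_nonneg _)
      obtain ⟨hx, hxQ⟩ := Finset.mem_sdiff.1 hx
      by_contra! hlt
      exact hxQ (Finset.mem_filter.2 ⟨hx, hlt.le⟩)
    have h2 : ((P \ Q).card : ℝ) + Q.card = P.card := by
      exact_mod_cast Finset.card_sdiff_add_card_eq_card hQP
    have h3 : 0 < B * s := mul_pos hB0 hs0
    have h4 : (B * s) * (4 * (P \ Q).card) ≤ (B * s) * P.card := by linarith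
    have h5 := le_of_mul_le_mul_left h4 h3
    linarith
  have hL : ∀ a, (Q.filter fun x => signs fs x = a).card ≤ ⌊4 * B * s⌋₊ := by
    intro a
    rcases (Q.filter fun x => signs fs x = a).eq_empty_or_nonempty with h | ⟨x, hx⟩
    · rw [h]; exact Nat.zero_le _
    · obtain ⟨hxQ, rfl⟩ := Finset.mem_filter.1 hx
      refine Nat.le_floor (le_trans ?_ (Finset.mem_filter.1 hxQ).2)
      exact Nat.cast_le.2 (Finset.card_le_card (Finset.filter_subset_filter _ hQP))
  have hCL := sum_card_onSphere_le w Q E (signs fs) hL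
  rw [← sum_card_onSphere_comm] at hCL
  have hsum1 : (Q.card : ℝ) * k ≤ ((∑ x ∈ Q, (onSphere w E x).card : ℕ) : ℝ) := by
    push_cast
    rw [← nsmul_eq_mul]
    exact Finset.card_nsmul_le_sum _ _ _ fun x hx => hk x (hQP hx)
  have hfloor : 2 * (⌊4 * B * s⌋₊ : ℝ) ^ 2 ≤ k / 4 := by
    have h1 : (⌊4 * B * s⌋₊ : ℝ) ≤ 4 * B * s := Nat.floor_le (by positivity)
    have h2 : (⌊4 * B * s⌋₊ : ℝ) ^ 2 ≤ (4 * B * s) ^ 2 :=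
      pow_le_pow_left₀ (Nat.cast_nonneg _) h1 2
    linarith
  obtain ⟨t, ht1, ht2, ht3⟩ := exists_small_jump (h := hil P)
    (fun a b hab => hil_mono_right P hab) hD3
  have himg : ∀ y, (((onSphere w Q y).image (signs fs)).card : ℝ) ≤
      11 * ((hil P (t + 2) - hil P t : ℝ) + (onSphere w P y).card / s) := by
    intro y
    have h1 := card_image_signs_le (w := w) hQP hfs (D := t + 2) (by omega) y
    have h2 := hil_onSphere_le (w := w) hs0 hP hPs (t := t) (by omega) le_rfl y
    calc _ ≤ (11 : ℝ) * hil (onSphere w P y) (t + 2) := by exact_mod_cast h1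
      _ ≤ _ := by linarith
  have hinc : ((∑ y ∈ E, (onSphere w P y).card : ℕ) : ℝ) ≤ P.card * (2 * k) := by
    rw [← sum_card_onSphere_comm]
    push_cast
    rw [← nsmul_eq_mul]
    exact Finset.sum_le_card_nsmul _ _ _ hk'
  have hsum2 : ((∑ y ∈ E, ((onSphere w Q y).image (signs fs)).card : ℕ) : ℝ) ≤
      11 * (E.card * (hil P (t + 2) - hil P t : ℝ) + P.card * (2 * k) / s) := by
    push_cast at hinc ⊢
    refine (Finset.sum_le_sum fun y _ => himg y).trans ?_
    rw [← Finset.mul_sum, Finset.sum_add_distrib, Finset.sum_const, nsmul_eq_mul,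
      ← Finset.sum_div]
    have := div_le_div_of_nonneg_right hinc hs0.le
    linarith
  have hCL' := (Nat.cast_le (α := ℝ)).2 hCL
  rw [Nat.cast_add, Nat.cast_mul, Nat.cast_mul, Nat.cast_mul, Nat.cast_pow] at hCL'
  push_cast at hCL' hsum1 hsum2
  have ht3' := (Nat.cast_le (α := ℝ)).2 ht3
  push_cast at ht3'
  have hQ0 : (0 : ℝ) ≤ Q.card := Nat.cast_nonneg _
  set m : ℝ := (P.card : ℝ)
  set h' : ℝ := (hil P D : ℝ)
  set δ : ℝ := (hil P (t + 2) - hil P t : ℝ) with hδ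
  have h1 : m * (2 * k) / s = 2 * k * h' := by
    rw [hPs]; field_simp
  rw [h1] at hsum2
  have h2 : 2 * (⌊4 * B * s⌋₊ : ℝ) ^ 2 * Q.card ≤ k / 4 * Q.card :=
    mul_le_mul_of_nonneg_right hfloor hQ0
  have h3 : m * k ≤ 44 * (E.card * δ + 2 * k * h') := by
    have h4 : 3 * m * k ≤ 4 * Q.card * k := mul_le_mul_of_nonneg_right hQcard hk0.le
    have h5 : 0 ≤ m * k := mul_nonneg (Nat.cast_nonneg _) hk0.le
    linarith
  have hDpos : (0 : ℝ) < D := by exact_mod_cast hD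
  have hδD : D * δ ≤ 8 * h' := by rw [hδ, mul_sub]; linarith
  have h4 : s * h' * k * D ≤ 44 * (E.card * (8 * h') + 2 * k * h' * D) := by
    rw [← hPs]
    calc m * k * D ≤ 44 * (E.card * δ + 2 * k * h') * D :=
          mul_le_mul_of_nonneg_right h3 hDpos.le
      _ = 44 * (E.card * (D * δ) + 2 * k * h' * D) := by ring
      _ ≤ _ := by
        have := mul_le_mul_of_nonneg_left hδD hE0
        linarith
  have h5 : h' * (s * k * D) ≤ h' * (352 * E.card + 88 * (k * D)) := by linarith
  have h6 := le_of_mul_le_mul_left h5 (by linarith)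
  have h7 : 176 * (k * D) ≤ s * (k * D) :=
    mul_le_mul_of_nonneg_right hs (mul_pos hk0 hDpos).le
  linarith

end Rich

/-! ### The number of rich points -/

section RichCount

lemma exists_extremal_subset {m : ℕ} {P : Finset (Fin m → ℝ)} {T : ℝ} (hT : 1 ≤ T)
    (hP : ¬ ∀ Q ⊆ P, (Q.card : ℝ) ≤ T * hil Q 0) :
    ∃ D ≥ 1, ∃ Q ⊆ P, Q.Nonempty ∧ ∃ s, T / 2 ^ m < s ∧ s ≤ T ∧
      (∀ R ⊆ P, (R.card : ℝ) ≤ s * hil R D) ∧ (Q.card : ℝ) = s * hil Q D := by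
  classical
  have hex : ∃ D, ∀ Q ⊆ P, (Q.card : ℝ) ≤ T * hil Q D := by
    refine ⟨P.card, fun Q hQ => ?_⟩
    have h1 : (Q.card : ℝ) ≤ hil Q P.card := by
      exact_mod_cast card_le_hil Q (Finset.card_le_card hQ)
    have h2 : (0 : ℝ) ≤ hil Q P.card := Nat.cast_nonneg _
    nlinarith
  set D := Nat.find hex
  have hD0 : D ≠ 0 := fun h => hP (h ▸ Nat.find_spec hex)
  have hmin := Nat.find_min hex (Nat.sub_lt (Nat.pos_of_ne_zero hD0) one_pos)
  push Not at hmin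
  obtain ⟨Q₀, hQ₀, hlt⟩ := hmin
  have hT0 : 0 < T := by linarith
  have hne₀ : Q₀.Nonempty := by
    rw [Finset.nonempty_iff_ne_empty]
    rintro rfl
    rw [Finset.card_empty, Nat.cast_zero] at hlt
    exact absurd hlt (not_lt.2 (mul_nonneg hT0.le (Nat.cast_nonneg _)))
  obtain ⟨Q, hQ, hmax⟩ := (P.powerset.filter Finset.Nonempty).exists_max_image
    (fun Q => (Q.card : ℝ) / hil Q D) ⟨Q₀, by simp [hQ₀, hne₀]⟩
  rw [Finset.mem_filter, Finset.mem_powerset] at hQ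
  have hpos : ∀ {R : Finset (Fin m → ℝ)}, R.Nonempty → (0 : ℝ) < hil R D := fun hR => by
    exact_mod_cast hil_pos hR D
  refine ⟨D, Nat.one_le_iff_ne_zero.2 hD0, Q, hQ.1, hQ.2, (Q.card : ℝ) / hil Q D, ?_, ?_,
    fun R hR => ?_, ?_⟩
  · refine lt_of_lt_of_le ?_ (hmax Q₀ (by simp [hQ₀, hne₀]))
    rw [div_lt_div_iff₀ (by positivity) (hpos hne₀)]
    have h1 : hil Q₀ D ≤ 2 ^ m * hil Q₀ (D - 1) :=
      (hil_le_mul_hil_div Q₀ D two_pos).trans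
        (Nat.mul_le_mul_left _ (hil_mono_right _ (by omega)))
    have h2 : (hil Q₀ D : ℝ) ≤ 2 ^ m * hil Q₀ (D - 1) := by exact_mod_cast h1
    calc T * hil Q₀ D ≤ T * (2 ^ m * hil Q₀ (D - 1)) := mul_le_mul_of_nonneg_left h2 hT0.le
      _ = (T * hil Q₀ (D - 1)) * 2 ^ m := by ring
      _ < _ := mul_lt_mul_of_pos_right hlt (by positivity)
  · rw [div_le_iff₀ (hpos hQ.2)]
    exact Nat.find_spec hex Q hQ.1
  · rcases R.eq_empty_or_nonempty with rfl | hR'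
    · rw [Finset.card_empty, Nat.cast_zero]; positivity
    · rw [← div_le_iff₀ (hpos hR')]
      exact hmax R (by simp [hR, hR'])
  · rw [div_mul_cancel₀ _ (hpos hQ.2).ne']

/-- A bound for the number of points with about `k` points at distance `w`. -/
theorem exists_card_rich_le : ∃ C : ℝ, 0 < C ∧ ∀ (w : ℝ) (P E : Finset (Fin 3 → ℝ)) (k : ℝ),
    1 ≤ k → P.card ≤ E.card → (∀ p ∈ P, k ≤ (onSphere w E p).card) →
    (∀ p ∈ P, (onSphere w E p).card ≤ 2 * k) →
    P.card * k ^ 4 ≤ C * ((E.card : ℝ) ^ 3 + E.card * k ^ 3) := by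
  obtain ⟨B, hB⟩ : ∃ B : ℝ, B = 64 * 8 ^ 8 := ⟨_, rfl⟩
  have hB1 : 1 ≤ B := by rw [hB]; norm_num
  obtain ⟨A, hA⟩ : ∃ A : ℝ, A = 8 * 704 ^ 3 * 64 * (144 * B ^ 2) := ⟨_, rfl⟩
  have hA0 : 0 < A := by rw [hA]; positivity
  refine ⟨(12 * B * 1408) ^ 2 + 4 + A, by positivity, fun w P E k hk1 hPE hk hk' => ?_⟩
  have hk0 : 0 < k := by linarith
  have hN : (0 : ℝ) ≤ E.card := Nat.cast_nonneg _
  have hN3 : (0 : ℝ) ≤ (E.card : ℝ) ^ 3 := by positivity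
  have hNk : 0 ≤ (E.card : ℝ) * k ^ 3 := by positivity
  have hB2 : 0 ≤ (12 * B * 1408) ^ 2 := sq_nonneg _
  by_cases hsmall : k < (12 * B * 1408) ^ 2
  · have h1 : (P.card : ℝ) ≤ E.card := by exact_mod_cast hPE
    calc P.card * k ^ 4 ≤ E.card * k ^ 4 := mul_le_mul_of_nonneg_right h1 (by positivity)
      _ = k * (E.card * k ^ 3) := by ring
      _ ≤ (12 * B * 1408) ^ 2 * (E.card * k ^ 3) := mul_le_mul_of_nonneg_right hsmall.le hNk
      _ ≤ _ := by nlinarith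
  rw [not_lt] at hsmall
  obtain ⟨T, hT⟩ : ∃ T, T = √k / (12 * B) := ⟨_, rfl⟩
  have hT2 : k = 144 * B ^ 2 * T ^ 2 := by
    rw [hT, div_pow, Real.sq_sqrt hk0.le]
    field_simp
    norm_num
  have hT1 : 1408 ≤ T := by
    rw [hT, le_div_iff₀ (by positivity), mul_comm]
    exact Real.le_sqrt_of_sq_le hsmall
  have hTk : 32 * B ^ 2 * T ^ 2 ≤ k / 4 := by
    have : 0 ≤ B ^ 2 * T ^ 2 := by positivity
    linarith
  by_cases h0 : ∀ Q ⊆ P, (Q.card : ℝ) ≤ T * hil Q 0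
  · have h1 : (P.card : ℝ) ≤ T := by
      refine (h0 P subset_rfl).trans (mul_le_of_le_one_right (by linarith) ?_)
      exact_mod_cast hil_zero_le P
    have h2 : (P.card : ℝ) ^ 2 ≤ T ^ 2 := pow_le_pow_left₀ (Nat.cast_nonneg _) h1 2
    have h3 : T ^ 2 ≤ B ^ 2 * T ^ 2 := le_mul_of_one_le_left (sq_nonneg _) (one_le_pow₀ hB1)
    have h4 := sum_card_onSphere_le_of_sq_le hk (by linarith [sq_nonneg T])
    calc P.card * k ^ 4 = (P.card * k) * k ^ 3 := by ring
      _ ≤ (4 * E.card) * k ^ 3 := mul_le_mul_of_nonneg_right h4 (by positivity)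
      _ ≤ _ := by nlinarith
  · obtain ⟨D, hD, Q, hQ, hne, s, hs1, hs2, hs3, hs4⟩ :=
      exists_extremal_subset (by linarith) h0
    have hs5 : T < 8 * s := by linarith
    have hs0 : 0 < s := by linarith
    have hs6 : s ^ 2 ≤ T ^ 2 := pow_le_pow_left₀ hs0.le hs2 2
    have h1 := mul_mul_le_of_extremal (w := w) (E := E) (k := k) hD hne (by linarith)
      (by
        rw [← hB]
        exact (mul_le_mul_of_nonneg_left hs6 (by positivity)).trans hTk)
      (fun R hR => hs3 R (hR.trans hQ)) hs4 (fun p hp => hk p (hQ hp)) (fun p hp => hk' p (hQ hp))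
    have hD' : (1 : ℝ) ≤ D := by exact_mod_cast hD
    have h2 : (s * k * D) ^ 3 ≤ (704 * E.card) ^ 3 := pow_le_pow_left₀ (by positivity) h1 3
    have h3 : (P.card : ℝ) ≤ s * (2 * D) ^ 3 := by
      refine (hs3 P subset_rfl).trans (mul_le_mul_of_nonneg_left ?_ hs0.le)
      have h4 : (hil P D : ℝ) ≤ (D + 1) ^ 3 := by exact_mod_cast hil_le_pow P D
      exact h4.trans (pow_le_pow_left₀ (by linarith) (by linarith) 3)
    have h4 : k ≤ 144 * B ^ 2 * (64 * s ^ 2) := by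
      rw [hT2]
      refine mul_le_mul_of_nonneg_left ?_ (by positivity)
      have := pow_le_pow_left₀ (by linarith) hs5.le 2
      linarith
    calc P.card * k ^ 4 ≤ (s * (2 * D) ^ 3) * k ^ 4 :=
          mul_le_mul_of_nonneg_right h3 (by positivity)
      _ = (8 * s * D ^ 3 * k ^ 3) * k := by ring
      _ ≤ (8 * s * D ^ 3 * k ^ 3) * (144 * B ^ 2 * (64 * s ^ 2)) :=
          mul_le_mul_of_nonneg_left h4 (by positivity)
      _ = 8 * 64 * (144 * B ^ 2) * (s * k * D) ^ 3 := by ring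
      _ ≤ 8 * 64 * (144 * B ^ 2) * (704 * E.card) ^ 3 :=
          mul_le_mul_of_nonneg_left h2 (by positivity)
      _ = A * (E.card : ℝ) ^ 3 := by rw [hA]; ring
      _ ≤ _ := by nlinarith

end RichCount

/-! ### The second moment of the degrees -/

section SecondMoment

lemma sum_Ico_quarter_pow_le (a b : ℕ) :
    ∑ i ∈ Finset.Ico a b, (1 / 4 : ℝ) ^ i ≤ 4 / 3 * (1 / 4) ^ a := by
  rcases le_or_gt a b with h | h
  · rw [geom_sum_Ico (by norm_num) h]
    have : (0 : ℝ) ≤ (1 / 4) ^ b := by positivity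
    rw [div_le_iff_of_neg (by norm_num)]
    linarith
  · rw [Finset.Ico_eq_empty_of_le h.le, Finset.sum_empty]
    positivity

lemma sum_Ico_two_pow_le (a b : ℕ) : ∑ i ∈ Finset.Ico a b, (2 : ℝ) ^ i ≤ 2 ^ b := by
  rcases le_or_gt a b with h | h
  · rw [geom_sum_Ico (by norm_num) h]
    have : (0 : ℝ) ≤ 2 ^ a := by positivity
    linarith
  · rw [Finset.Ico_eq_empty_of_le h.le, Finset.sum_empty]
    positivity

/-- The number of pairs of points at distance `w` from a common point is at most quadratic. -/
theorem exists_sum_sq_card_onSphere_le : ∃ C : ℝ, 0 < C ∧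
    ∀ (w : ℝ) (E : Finset (Fin 3 → ℝ)),
      ∑ x ∈ E, ((onSphere w E x).card : ℝ) ^ 2 ≤ C * (E.card : ℝ) ^ 2 := by
  classical
  obtain ⟨C, hC, hrich⟩ := exists_card_rich_le
  refine ⟨1 + 32 * C, by positivity, fun w E => ?_⟩
  set N := E.card
  set d : (Fin 3 → ℝ) → ℕ := fun x => (onSphere w E x).card
  have hdN : ∀ x, d x ≤ N := fun x => Finset.card_filter_le _ _
  have hex : ∃ i, N < 4 * 4 ^ i := ⟨N, by
    have : N < 4 ^ N := Nat.lt_pow_self (by norm_num)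
    omega⟩
  set a := Nat.find hex
  set b := Nat.log 2 N + 1 with hb
  set H := E.filter fun x => N < d x ^ 2
  set P : ℕ → Finset (Fin 3 → ℝ) := fun i => H.filter fun x => Nat.log 2 (d x) = i
  have hd0 : ∀ x ∈ H, d x ≠ 0 := by
    intro x hx h0
    have := (Finset.mem_filter.1 hx).2
    rw [h0] at this
    simp at this
  have hlo : ∀ x ∈ H, 2 ^ Nat.log 2 (d x) ≤ d x := fun x hx => Nat.pow_log_le_self 2 (hd0 x hx)
  have hup : ∀ x, d x < 2 * 2 ^ Nat.log 2 (d x) := fun x => by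
    have := Nat.lt_pow_succ_log_self (one_lt_two) (d x)
    rwa [pow_succ, mul_comm] at this
  have hmaps : ∀ x ∈ H, Nat.log 2 (d x) ∈ Finset.Ico a b := by
    intro x hx
    rw [Finset.mem_Ico]
    refine ⟨Nat.find_min' hex ((Finset.mem_filter.1 hx).2.trans ?_),
      Nat.lt_succ_of_le (Nat.log_mono_right (hdN x))⟩
    calc d x ^ 2 < (2 * 2 ^ Nat.log 2 (d x)) ^ 2 := Nat.pow_lt_pow_left (hup x) two_ne_zero
      _ = 4 * 4 ^ Nat.log 2 (d x) := by
        rw [mul_pow, ← pow_mul, mul_comm _ 2, pow_mul]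
        norm_num
  have hPi : ∀ i, ∑ x ∈ P i, (d x : ℝ) ^ 2 ≤
      4 * C * ((N : ℝ) ^ 3 * (1 / 4) ^ i + N * 2 ^ i) := by
    intro i
    have hq : (0 : ℝ) < 2 ^ i := by positivity
    have hPlo : ∀ x ∈ P i, (2 : ℝ) ^ i ≤ d x := fun x hx => by
      obtain ⟨hx1, rfl⟩ := Finset.mem_filter.1 hx
      exact_mod_cast hlo x hx1
    have hPup : ∀ x ∈ P i, (d x : ℝ) ≤ 2 * 2 ^ i := fun x hx => by
      obtain ⟨-, rfl⟩ := Finset.mem_filter.1 hx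
      exact_mod_cast (hup x).le
    have h1 := hrich w (P i) E (2 ^ i) (one_le_pow₀ one_le_two)
      (Finset.card_le_card ((Finset.filter_subset _ _).trans (Finset.filter_subset _ _)))
      hPlo hPup
    have h2 : ∑ x ∈ P i, (d x : ℝ) ^ 2 ≤ (P i).card * (2 * 2 ^ i) ^ 2 := by
      rw [← nsmul_eq_mul]
      exact Finset.sum_le_card_nsmul _ _ _ fun x hx =>
        pow_le_pow_left₀ (Nat.cast_nonneg _) (hPup x hx) 2
    refine h2.trans ?_
    have h3 : ((1 : ℝ) / 4) ^ i = ((2 ^ i) ^ 2)⁻¹ := by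
      rw [one_div, inv_pow, ← pow_mul, mul_comm, pow_mul]
      norm_num
    rw [h3]
    rw [← mul_le_mul_iff_left₀ (pow_pos hq 2)]
    calc ((P i).card : ℝ) * (2 * 2 ^ i) ^ 2 * (2 ^ i) ^ 2
        = 4 * ((P i).card * (2 ^ i) ^ 4) := by ring
      _ ≤ 4 * (C * ((N : ℝ) ^ 3 + N * (2 ^ i) ^ 3)) := by linarith
      _ = _ := by field_simp
  have hsumH : ∑ x ∈ H, (d x : ℝ) ^ 2 ≤ 32 * C * (N : ℝ) ^ 2 := by
    rw [← Finset.sum_fiberwise_of_maps_to hmaps]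
    refine (Finset.sum_le_sum fun i _ => hPi i).trans ?_
    rw [← Finset.mul_sum, Finset.sum_add_distrib, ← Finset.mul_sum, ← Finset.mul_sum]
    have h1 : (N : ℝ) * ∑ i ∈ Finset.Ico a b, (2 : ℝ) ^ i ≤ 2 * (N : ℝ) ^ 2 := by
      rcases Nat.eq_zero_or_pos N with h0 | h0
      · rw [h0]; simp
      · have h2 : 2 ^ b ≤ 2 * N := by
          rw [hb, pow_succ, mul_comm]
          exact Nat.mul_le_mul_left _ (Nat.pow_log_le_self 2 h0.ne')
        have h3 : (2 : ℝ) ^ b ≤ 2 * N := by exact_mod_cast h2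
        calc _ ≤ (N : ℝ) * (2 * N) := mul_le_mul_of_nonneg_left
              ((sum_Ico_two_pow_le a b).trans h3) (Nat.cast_nonneg _)
          _ = _ := by ring
    have h2 : (N : ℝ) ^ 3 * ∑ i ∈ Finset.Ico a b, (1 / 4 : ℝ) ^ i ≤ 6 * (N : ℝ) ^ 2 := by
      have h3 : (N : ℝ) ≤ 4 * 4 ^ a := by exact_mod_cast (Nat.find_spec hex).le
      have h4 : (N : ℝ) * (1 / 4) ^ a ≤ 4 := by
        rw [one_div, inv_pow, ← div_eq_mul_inv, div_le_iff₀ (by positivity)]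
        exact h3
      calc _ ≤ (N : ℝ) ^ 3 * (4 / 3 * (1 / 4) ^ a) :=
            mul_le_mul_of_nonneg_left (sum_Ico_quarter_pow_le a b) (by positivity)
        _ = (N : ℝ) ^ 2 * (4 / 3 * (N * (1 / 4) ^ a)) := by ring
        _ ≤ (N : ℝ) ^ 2 * (4 / 3 * 4) := by gcongr
        _ ≤ _ := by linarith [sq_nonneg (N : ℝ)]
    have h3 := mul_le_mul_of_nonneg_left (add_le_add h2 h1) (by positivity : 0 ≤ 4 * C)
    linarith
  rw [← Finset.sum_filter_add_sum_filter_not E (fun x => N < d x ^ 2)]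
  have hlow : ∑ x ∈ E.filter (fun x => ¬ N < d x ^ 2), (d x : ℝ) ^ 2 ≤ (N : ℝ) ^ 2 := by
    have h1 : ∑ x ∈ E.filter (fun x => ¬ N < d x ^ 2), (d x : ℝ) ^ 2 ≤
        (E.filter fun x => ¬ N < d x ^ 2).card * (N : ℝ) := by
      rw [← nsmul_eq_mul]
      refine Finset.sum_le_card_nsmul _ _ _ fun x hx => ?_
      exact_mod_cast not_lt.1 (Finset.mem_filter.1 hx).2
    have h2 : ((E.filter fun x => ¬ N < d x ^ 2).card : ℝ) ≤ N := by
      exact_mod_cast Finset.card_filter_le _ _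
    rw [sq]
    exact h1.trans (mul_le_mul_of_nonneg_right h2 (Nat.cast_nonneg _))
  change ∑ x ∈ H, (d x : ℝ) ^ 2 + _ ≤ _
  linarith

end SecondMoment

end StarBounds

namespace StarBounds

/-! ### Stars -/

section Stars

lemma finite_distStarConfigs3 (k : ℕ) (w : Fin k → ℝ) (E : Finset Pt3) :
    (distStarConfigs3 k w E).Finite :=
  (Fintype.piFinset fun _ : Fin (k + 1) => E).finite_toSet.subset fun _ hx =>
    Finset.mem_coe.2 (Fintype.mem_piFinset.2 hx.1)

lemma exists_sum_sq_card_dist_le : ∃ C : ℝ, 0 < C ∧ ∀ w : ℝ, 0 < w → ∀ E : Finset Pt3,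
    ∑ x ∈ E, ((E.filter fun y => ‖x - y‖ = w).card : ℝ) ^ 2 ≤ C * (E.card : ℝ) ^ 2 := by
  classical
  obtain ⟨C, hC, h⟩ := exists_sum_sq_card_onSphere_le
  refine ⟨C, hC, fun w hw E => ?_⟩
  let φ : Pt3 ↪ (Fin 3 → ℝ) := ⟨WithLp.ofLp, WithLp.ofLp_injective 2⟩
  have h1 := h w (E.map φ)
  rw [Finset.card_map, Finset.sum_map] at h1
  convert h1 using 5 with x
  have h2 : onSphere w (E.map φ) (φ x) = (E.filter fun y => ‖x - y‖ = w).map φ := by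
    rw [onSphere, Finset.filter_map]
    congr 1
    refine Finset.filter_congr fun y _ => ?_
    rw [Function.comp_apply, norm_sub_rev, EuclideanSpace.norm_eq,
      Real.sqrt_eq_iff_mul_self_eq_of_pos hw, ← sq, eq_comm]
    simp [φ]
  rw [h2, Finset.card_map]

lemma ncard_distStarConfigs3_le (k : ℕ) (w : Fin (k + 2) → ℝ) (E : Finset Pt3) :
    (distStarConfigs3 (k + 2) w E).ncard ≤ ∑ x ∈ E, (E.filter fun y => ‖x - y‖ = w 0).card *
      ((E.filter fun y => ‖x - y‖ = w 1).card * E.card ^ k) := by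
  classical
  let T : Finset (Σ _ : Pt3, Pt3 × Pt3 × (Fin k → Pt3)) := E.sigma fun x =>
    (E.filter fun y => ‖x - y‖ = w 0) ×ˢ (E.filter fun y => ‖x - y‖ = w 1) ×ˢ
      Fintype.piFinset fun _ => E
  have hT : T.card = ∑ x ∈ E, (E.filter fun y => ‖x - y‖ = w 0).card *
      ((E.filter fun y => ‖x - y‖ = w 1).card * E.card ^ k) := by
    rw [Finset.card_sigma]
    refine Finset.sum_congr rfl fun x _ => ?_
    rw [Finset.card_product, Finset.card_product, Fintype.card_piFinset_const]
  rw [← hT, ← Set.ncard_coe_finset]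
  refine Set.ncard_le_ncard_of_injOn
    (fun x => ⟨x 0, x 1, x 2, fun i => x i.succ.succ.succ⟩) ?_ ?_ T.finite_toSet
  · rintro x ⟨hE, -, hw⟩
    simp only [T, Finset.mem_coe, Finset.mem_sigma, Finset.mem_product, Finset.mem_filter,
      Fintype.mem_piFinset]
    exact ⟨hE _, ⟨hE _, hw 0⟩, ⟨hE _, hw 1⟩, fun _ => hE _⟩
  · intro x _ y _ h
    simp only [Sigma.mk.injEq, heq_eq_eq, Prod.mk.injEq] at h
    obtain ⟨h0, h1, h2, h3⟩ := h
    funext i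
    refine Fin.cases h0 (fun i => Fin.cases h1 (fun i => Fin.cases h2 (fun i => ?_) i) i) i
    exact congrFun h3 i

theorem exists_ncard_distStarConfigs3_le (k : ℕ) (w : Fin (k + 2) → ℝ) (hw : ∀ i, 0 < w i) :
    ∃ C : ℝ, 0 < C ∧ ∀ E : Finset Pt3,
      ((distStarConfigs3 (k + 2) w E).ncard : ℝ) ≤ C * (E.card : ℝ) ^ (k + 2) := by
  obtain ⟨C, hC, h⟩ := exists_sum_sq_card_dist_le
  refine ⟨C, hC, fun E => ?_⟩
  refine (Nat.cast_le.2 (ncard_distStarConfigs3_le k w E)).trans ?_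
  push_cast
  calc _ ≤ ∑ x ∈ E, ((((E.filter fun y => ‖x - y‖ = w 0).card : ℝ) ^ 2 +
        ((E.filter fun y => ‖x - y‖ = w 1).card : ℝ) ^ 2) / 2) * (E.card : ℝ) ^ k := by
        refine Finset.sum_le_sum fun x _ => ?_
        rw [← mul_assoc]
        refine mul_le_mul_of_nonneg_right ?_ (by positivity)
        have := two_mul_le_add_sq ((E.filter fun y => ‖x - y‖ = w 0).card : ℝ)
          ((E.filter fun y => ‖x - y‖ = w 1).card : ℝ)
        linarith
    _ = (∑ x ∈ E, ((E.filter fun y => ‖x - y‖ = w 0).card : ℝ) ^ 2 +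
        ∑ x ∈ E, ((E.filter fun y => ‖x - y‖ = w 1).card : ℝ) ^ 2) / 2 * (E.card : ℝ) ^ k := by
        rw [← Finset.sum_mul, ← Finset.sum_div, Finset.sum_add_distrib]
    _ ≤ (C * (E.card : ℝ) ^ 2) * (E.card : ℝ) ^ k := by
        refine mul_le_mul_of_nonneg_right ?_ (by positivity)
        linarith [h (w 0) (hw 0) E, h (w 1) (hw 1) E]
    _ = _ := by ring

/-- Distinct directions, scaled to prescribed lengths. -/
def starLeaf (r : ℕ → ℝ) (t : ℕ) : Pt3 :=
  (r t / ‖(!₂[1, (t : ℝ), 0] : Pt3)‖) • !₂[1, (t : ℝ), 0]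

lemma direction_ne_zero (t : ℕ) : (!₂[1, (t : ℝ), 0] : Pt3) ≠ 0 := fun h => by
  have := congrArg (fun v : Pt3 => v 0) h
  simp at this

lemma norm_starLeaf {r : ℕ → ℝ} (hr : ∀ t, 0 < r t) (t : ℕ) : ‖starLeaf r t‖ = r t := by
  rw [starLeaf, norm_smul, norm_div, norm_norm,
    div_mul_cancel₀ _ (norm_ne_zero_iff.2 (direction_ne_zero t)), Real.norm_of_nonneg (hr t).le]

lemma starLeaf_injective {r : ℕ → ℝ} (hr : ∀ t, 0 < r t) : Function.Injective (starLeaf r) := by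
  intro a b hab
  have hpos : ∀ t, 0 < r t / ‖(!₂[1, (t : ℝ), 0] : Pt3)‖ := fun t =>
    div_pos (hr t) (norm_pos_iff.2 (direction_ne_zero t))
  have h0 := congrArg (fun v : Pt3 => v 0) hab
  have h1 := congrArg (fun v : Pt3 => v 1) hab
  have e0 : ∀ t, (starLeaf r t) 0 = r t / ‖(!₂[1, (t : ℝ), 0] : Pt3)‖ := fun t => by
    simp [starLeaf]
  have e1 : ∀ t, (starLeaf r t) 1 = r t / ‖(!₂[1, (t : ℝ), 0] : Pt3)‖ * t := fun t => by
    simp [starLeaf]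
  simp only [e0, e1] at h0 h1
  rw [h0] at h1
  exact_mod_cast mul_left_cancel₀ (hpos b).ne' h1

theorem exists_le_ncard_distStarConfigs3 {k : ℕ} (hk : 0 < k) (w : Fin k → ℝ)
    (hw : ∀ i, 0 < w i) {n : ℕ} (hn : 0 < n) :
    ∃ E : Finset Pt3, E.card = n ∧ ((n - 1) / k) ^ k ≤ (distStarConfigs3 k w E).ncard := by
  classical
  set r : ℕ → ℝ := fun t => w ⟨t % k, Nat.mod_lt t hk⟩
  have hr0 : ∀ t, 0 < r t := fun t => hw _
  have hinj := starLeaf_injective hr0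
  have hne : ∀ t, starLeaf r t ≠ 0 := fun t => norm_ne_zero_iff.1 (by
    rw [norm_starLeaf hr0]; exact (hr0 t).ne')
  refine ⟨insert 0 ((Finset.range (n - 1)).image (starLeaf r)), ?_, ?_⟩
  · rw [Finset.card_insert_of_notMem, Finset.card_image_of_injective _ hinj, Finset.card_range]
    · omega
    · intro h
      obtain ⟨t, -, ht⟩ := Finset.mem_image.1 h
      exact hne t ht
  set q := (n - 1) / k
  have hmod : ∀ (j : ℕ) (i : Fin k), (k * j + i) % k = i := fun j i => by
    rw [Nat.mul_add_mod, Nat.mod_eq_of_lt i.2]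
  have hcard : (Set.univ : Set (Fin k → Fin q)).ncard = q ^ k := by
    rw [Set.ncard_univ, Nat.card_eq_fintype_card, Fintype.card_fun, Fintype.card_fin,
      Fintype.card_fin]
  rw [← hcard]
  refine Set.ncard_le_ncard_of_injOn
    (fun j => Fin.cons 0 fun i => starLeaf r (k * j i + i)) ?_ ?_ (finite_distStarConfigs3 _ _ _)
  · intro j _
    refine ⟨fun i => ?_, ?_, fun i => ?_⟩
    · refine Fin.cases (Finset.mem_insert_self _ _) (fun i => ?_) i
      change starLeaf r (k * j i + i) ∈ _
      refine Finset.mem_insert_of_mem (Finset.mem_image_of_mem _ (Finset.mem_range.2 ?_))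
      have h1 : k * (j i + 1) ≤ k * q := Nat.mul_le_mul_left _ (j i).2
      have h2 : k * q ≤ n - 1 := Nat.mul_div_le _ _
      have h3 := i.2
      rw [mul_add, mul_one] at h1
      omega
    · rw [Fin.cons_injective_iff]
      refine ⟨?_, fun a b hab => ?_⟩
      · rintro ⟨i, hi⟩
        exact hne _ hi
      · have h1 := congrArg (· % k) (hinj hab)
        simp only [hmod] at h1
        exact Fin.ext h1
    · rw [Fin.cons_zero, Fin.cons_succ, zero_sub, norm_neg, norm_starLeaf hr0]
      exact congrArg w (Fin.ext (hmod _ _))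
  · intro j _ j' _ h
    funext i
    have h1 := congrFun h i.succ
    simp only [Fin.cons_succ] at h1
    have h2 := hinj h1
    exact Fin.ext (Nat.eq_of_mul_eq_mul_left hk (by omega))

end Stars

end StarBounds

/-- **distance `k`-stars in three dimensions.** Fix `k ≥ 2` and positive
weights `w₁, …, w_k`.  (i) There is `C > 0` such that every set of `n` points in `ℝ³` has
at most `C · n^k` distance `k`-star configurations; (ii) there are `c > 0` and `N` such
that for every `n > N` some set of `n` points in `ℝ³` has at least `c · n^k` of them.
That is, `f₃(G; n) ≈ n^k` for the `k`-star `G`. -/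
theorem distance_kStar_bounds_threeDim (k : ℕ) (hk : 2 ≤ k) (w : Fin k → ℝ)
    (hw : ∀ i, 0 < w i) :
    (∃ C : ℝ, 0 < C ∧ ∀ (n : ℕ) (E : Finset Pt3), E.card = n →
      ((distStarConfigs3 k w E).ncard : ℝ) ≤ C * (n : ℝ) ^ k) ∧
    (∃ c : ℝ, 0 < c ∧ ∃ N : ℕ, ∀ n : ℕ, N < n →
      ∃ E : Finset Pt3, E.card = n ∧
        c * (n : ℝ) ^ k ≤ ((distStarConfigs3 k w E).ncard : ℝ)) := by
  constructor
  · obtain ⟨l, rfl⟩ := Nat.exists_eq_add_of_le' hk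
    obtain ⟨C, hC, h⟩ := StarBounds.exists_ncard_distStarConfigs3_le l w hw
    exact ⟨C, hC, fun n E hE => hE ▸ h E⟩
  · have hk0 : (0 : ℝ) < k := by exact_mod_cast (by omega : 0 < k)
    refine ⟨(1 / (2 * k)) ^ k, by positivity, 2 * k, fun n hn => ?_⟩
    obtain ⟨E, hE, h⟩ := StarBounds.exists_le_ncard_distStarConfigs3 (by omega : 0 < k) w hw
      (by omega : 0 < n)
    refine ⟨E, hE, le_trans ?_ (Nat.cast_le.2 h)⟩
    rw [← mul_pow, Nat.cast_pow]
    refine pow_le_pow_left₀ (by positivity) ?_ k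
    have h1 := Nat.div_add_mod (n - 1) k
    have h2 := Nat.mod_lt (n - 1) (by omega : 0 < k)
    have h3 : n ≤ 2 * (k * ((n - 1) / k)) := by omega
    have h4 : (n : ℝ) ≤ 2 * (k * ((n - 1) / k : ℕ)) := by exact_mod_cast h3
    rw [one_div, inv_mul_le_iff₀ (by positivity)]
    linarith
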